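/- arXiv:2403.10661 — 2 statements merged into one kernel-verified Lean document; each statement's English description precedes it below -/
import Mathlib

section
/- Let C ⊆ A^n be an algebraic curve with a parametric representation P(t) = (g₁(t)/g₀(t), …, g_n(t)/g₀(t)), with g₀,g₁,…,g_n ∈ K[t], gcd(g₀,g₁,…,g_n) = 1, satisfying condition (P1). Then deg(C) = max{deg(gᵢ) : 0 ≤ i ≤ n}. -/
open MvPolynomial

/-- A subset of affine space is an algebraic set if it is the zero locus of an
ideal of polynomials. -/
def IsAlgebraicSet {K : Type} [Field K] {n : ℕ} (W : Set (Fin n → K)) : Prop :=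
  ∃ I : Ideal (MvPolynomial (Fin n) K), W = zeroLocus K I

/-- An irreducible affine variety: an algebraic set whose vanishing ideal is prime. -/
def IsIrreducibleVariety {K : Type} [Field K] {n : ℕ} (W : Set (Fin n → K)) : Prop :=
  IsAlgebraicSet W ∧ (vanishingIdeal K W).IsPrime

/-- The dimension of an affine algebraic set: the Krull dimension of its coordinate ring. -/
noncomputable def varDim {K : Type} [Field K] {n : ℕ} (W : Set (Fin n → K)) : ℕ :=
  ENat.toNat ((ringKrullDim (MvPolynomial (Fin n) K ⧸ vanishingIdeal K W)).unbotD 0)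

/-- The (Zariski) tangent space of `W` at `p`:
all `y` with `∇f(p)·y = 0` for every `f ∈ I(W)`. -/
def tangentSpaceAt {K : Type} [Field K] {n : ℕ} (W : Set (Fin n → K)) (p : Fin n → K) :
    Set (Fin n → K) :=
  {y | ∀ f ∈ vanishingIdeal K W, ∑ i, eval p (pderiv i f) * y i = 0}

/-- The dimension of the tangent space at a point. -/
noncomputable def tangentDimAt {K : Type} [Field K] {n : ℕ} (W : Set (Fin n → K))
    (p : Fin n → K) : ℕ :=
  Module.finrank K (Submodule.span K (tangentSpaceAt W p))

/-- A point of an (irreducible) variety is a smooth point when the tangent space has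
the dimension of the variety. -/
def IsSmoothAt {K : Type} [Field K] {n : ℕ} (W : Set (Fin n → K)) (p : Fin n → K) : Prop :=
  tangentDimAt W p = varDim W

/-- A variety is smooth if it is smooth at each of its points. -/
def IsSmoothVariety {K : Type} [Field K] {n : ℕ} (W : Set (Fin n → K)) : Prop :=
  ∀ p ∈ W, IsSmoothAt W p

/-- Projection `A^{2n} → A^n` to the first `n` coordinates. -/
def fstProj {K : Type} {n : ℕ} (z : Fin (n + n) → K) : Fin n → K :=
  fun i => z (Fin.castAdd n i)

/-- Projection `A^{2n} → A^n` to the last `n` coordinates. -/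
def sndProj {K : Type} {n : ℕ} (z : Fin (n + n) → K) : Fin n → K :=
  fun i => z (Fin.natAdd n i)

/-- The tangent bundle `TW ⊆ A^{2n}`: pairs `(x, y)` with `x ∈ W` and `y ∈ T_x W`. -/
def tangentBundle {K : Type} [Field K] {n : ℕ} (W : Set (Fin n → K)) :
    Set (Fin (n + n) → K) :=
  {z | fstProj z ∈ W ∧ sndProj z ∈ tangentSpaceAt W (fstProj z)}

/-- Zariski closure of a subset of affine space. -/
def zclosure {K : Type} [Field K] {n : ℕ} (W : Set (Fin n → K)) : Set (Fin n → K) :=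
  zeroLocus K (vanishingIdeal K W)

/-- The tangential variety `Tan(W)`: the Zariski closure of `π₂(TW)`. -/
def tangentialVariety {K : Type} [Field K] {n : ℕ} (W : Set (Fin n → K)) :
    Set (Fin n → K) :=
  zclosure (sndProj '' tangentBundle W)

/-- The geometric degree of an (irreducible) affine algebraic set: the maximal finite
number of points in an intersection with an affine-linear subspace of complementary
dimension. -/
noncomputable def geomDegree {K : Type} [Field K] {n : ℕ} (W : Set (Fin n → K)) : ℕ :=
  sSup {m | ∃ L : AffineSubspace K (Fin n → K),
    Module.finrank K L.direction = n - varDim W ∧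
    (W ∩ (L : Set (Fin n → K))).Finite ∧ (W ∩ (L : Set (Fin n → K))).ncard = m}

/-- A linear variety: an affine-linear subspace of affine space. -/
def IsLinearVariety {K : Type} [Field K] {n : ℕ} (W : Set (Fin n → K)) : Prop :=
  ∃ L : AffineSubspace K (Fin n → K), W = (L : Set (Fin n → K))

/-- A line: an affine-linear subspace of dimension 1. -/
def IsLine {K : Type} [Field K] {n : ℕ} (W : Set (Fin n → K)) : Prop :=
  ∃ L : AffineSubspace K (Fin n → K), W = (L : Set (Fin n → K)) ∧
    Module.finrank K L.direction = 1

open Classical in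
/-- `ω(C)`: the number of points in the fiber of `π₂ : TC → Tan(C)` over a generic
point of `Tan(C)`; it is `0` when `C` is a line. -/
noncomputable def omegaCurve {K : Type} [Field K] {n : ℕ} (C : Set (Fin n → K)) : ℕ :=
  if IsLine C then 0
  else sInf {m | ∃ Z : Set (Fin n → K), IsAlgebraicSet Z ∧ ¬ tangentialVariety C ⊆ Z ∧
    ∀ v ∈ tangentialVariety C \ Z,
      {z ∈ tangentBundle C | sndProj z = v}.ncard = m}

/-- A smooth irreducible algebraic curve. -/
def IsSmoothCurve {K : Type} [Field K] {n : ℕ} (C : Set (Fin n → K)) : Prop :=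
  IsIrreducibleVariety C ∧ varDim C = 1 ∧ IsSmoothVariety C

section Helpers

variable {K : Type} [Field K]

lemma aux_avoid [Infinite K] (M : Submodule K (Polynomial K)) (S : Finset K)
    (h : ∀ r ∈ S, ∃ f ∈ M, f.eval r ≠ 0) : ∃ v ∈ M, ∀ r ∈ S, v.eval r ≠ 0 := by
  classical
  induction S using Finset.induction_on with
  | empty => exact ⟨0, M.zero_mem, by simp⟩
  | insert r S hr ih =>
    obtain ⟨v, hv, hvS⟩ := ih (fun s hs => h s (Finset.mem_insert_of_mem hs))
    obtain ⟨f, hf, hfr⟩ := h r (Finset.mem_insert_self _ _)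
    obtain ⟨c, hc⟩ := Infinite.exists_notMem_finset
      ((insert r S).image fun s => - v.eval s / f.eval s)
    refine ⟨v + c • f, M.add_mem hv (M.smul_mem c hf), ?_⟩
    intro s hs h0
    simp only [Polynomial.eval_add, Polynomial.eval_smul, smul_eq_mul] at h0
    by_cases hfs : f.eval s = 0
    · rcases Finset.mem_insert.1 hs with rfl | hs
      · exact hfr hfs
      · exact hvS s hs (by simpa [hfs] using h0)
    · apply hc
      refine Finset.mem_image.2 ⟨s, hs, ?_⟩
      field_simp
      linear_combination -h0

lemma aux_coprime [IsAlgClosed K] (u v : Polynomial K)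
    (h : ∀ r, u.eval r = 0 → v.eval r ≠ 0) : IsCoprime u v := by
  rw [Polynomial.isCoprime_iff_aeval_ne_zero_of_isAlgClosed K K]
  intro r
  by_cases hr : u.eval r = 0
  · right; simpa using h r hr
  · left; simpa using hr

lemma aux_pair [IsAlgClosed K] (M : Submodule K (Polynomial K)) (d : ℕ)
    (hb : ∀ r : K, ∃ f ∈ M, f.eval r ≠ 0) (hd : ∃ f ∈ M, f.coeff d ≠ 0)
    (hle : ∀ f ∈ M, f.natDegree ≤ d) :
    ∃ u ∈ M, ∃ v ∈ M, u.natDegree = d ∧ u.coeff d ≠ 0 ∧ IsCoprime u v := by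
  classical
  have : Infinite K := IsAlgClosed.instInfinite
  obtain ⟨u, hu, hud⟩ := hd
  obtain ⟨v, hv, hvr⟩ := aux_avoid M u.roots.toFinset (fun r _ => hb r)
  have hu0 : u ≠ 0 := by rintro rfl; simp at hud
  refine ⟨u, hu, v, hv, le_antisymm (hle u hu) (Polynomial.le_natDegree_of_ne_zero hud), hud, ?_⟩
  apply aux_coprime
  intro r hr
  exact hvr r (by simp [hu0, hr])

lemma aux_bertini [IsAlgClosed K] [CharZero K] (M : Submodule K (Polynomial K)) (d : ℕ)
    (hb : ∀ r : K, ∃ f ∈ M, f.eval r ≠ 0) (hd : ∃ f ∈ M, f.coeff d ≠ 0)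
    (hle : ∀ f ∈ M, f.natDegree ≤ d) (h1 : 1 ≤ d) (S : Finset K) :
    ∃ a ∈ M, a.natDegree = d ∧ a.Separable ∧ ∀ r ∈ S, a.eval r ≠ 0 := by
  classical
  have : Infinite K := IsAlgClosed.instInfinite
  obtain ⟨u, hu, v, hv, hdu, hud, hcop⟩ := aux_pair M d hb hd hle
  set W : Polynomial K := u.derivative * v - u * v.derivative with hW
  have hW0 : W ≠ 0 := by
    intro h0
    have h2 : u ∣ u.derivative * v := ⟨v.derivative, by linear_combination h0⟩
    have h3 := hcop.dvd_of_dvd_mul_right h2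
    have h4 : u.derivative = 0 := by
      apply Polynomial.eq_zero_of_dvd_of_natDegree_lt h3
      exact Polynomial.natDegree_derivative_lt (by omega)
    have := Polynomial.derivative_eq_zero.1 h4
    omega
  obtain ⟨c, hc⟩ := Infinite.exists_notMem_finset
    (insert (- u.coeff d / v.coeff d)
      ((S ∪ W.roots.toFinset).image fun s => - u.eval s / v.eval s))
  rw [Finset.mem_insert, not_or] at hc
  have hne : ∀ s ∈ S ∪ W.roots.toFinset, (u + c • v).eval s ≠ 0 := by
    intro s hs h0
    simp only [Polynomial.eval_add, Polynomial.eval_smul, smul_eq_mul] at h0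
    by_cases hvs : v.eval s = 0
    · have hus : u.eval s = 0 := by simpa [hvs] using h0
      obtain ⟨a, b, hab⟩ := hcop
      have := congrArg (Polynomial.eval s) hab
      simp [hvs, hus] at this
    · apply hc.2
      refine Finset.mem_image.2 ⟨s, hs, ?_⟩
      field_simp
      linear_combination -h0
  have hM : u + c • v ∈ M := M.add_mem hu (M.smul_mem c hv)
  have hcd : (u + c • v).coeff d ≠ 0 := by
    intro h0
    simp only [Polynomial.coeff_add, Polynomial.coeff_smul, smul_eq_mul] at h0
    by_cases hvs : v.coeff d = 0
    · exact hud (by simpa [hvs] using h0)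
    · apply hc.1
      field_simp
      linear_combination h0
  refine ⟨u + c • v, hM, le_antisymm (hle _ hM) (Polynomial.le_natDegree_of_ne_zero hcd), ?_,
    fun r hr => hne r (Finset.mem_union_left _ hr)⟩
  apply aux_coprime
  intro r hr hr'
  refine hne r (Finset.mem_union_right _ ?_) hr
  rw [Multiset.mem_toFinset, Polynomial.mem_roots hW0, Polynomial.IsRoot.def, hW]
  simp at hr hr' ⊢
  linear_combination (v.eval r) * hr' - v.derivative.eval r * hr

lemma aux_closed [IsAlgClosed K] {n : ℕ} (g0 : Polynomial K) (g : Fin n → Polynomial K) (d : ℕ)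
    (h1 : 1 ≤ d) (hb : ∀ r, g0.eval r = 0 → ∃ i, (g i).eval r ≠ 0)
    (hd : g0.coeff d = 0 → ∃ i, (g i).coeff d ≠ 0)
    (hle0 : g0.natDegree ≤ d) (hle : ∀ i, (g i).natDegree ≤ d) (p : Fin n → K)
    (hp : p ∈ zclosure ((fun t => fun i => (g i).eval t / g0.eval t) '' {t | g0.eval t ≠ 0})) :
    (∃ t, g0.eval t ≠ 0 ∧ p = fun i => (g i).eval t / g0.eval t) ∨
      (g0.coeff d ≠ 0 ∧ p = fun i => (g i).coeff d / g0.coeff d) := by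
  by_contra hcon
  push Not at hcon
  obtain ⟨hc1, hc2⟩ := hcon
  set h : Fin n → Polynomial K := fun i => g i - Polynomial.C (p i) * g0 with hh
  have hdeg : ∀ i (c : K), (g i - Polynomial.C c * g0).natDegree ≤ d := fun i c => by
    simpa using Polynomial.natDegree_sub_le_of_le (hle i)
      ((Polynomial.natDegree_C_mul_le c _).trans hle0)
  obtain ⟨u, hu, v, hv, hdu, hud, hcop⟩ := aux_pair (Submodule.span K (Set.range h)) d
    (by
      intro r
      by_contra hcon
      push Not at hcon
      have h0 : ∀ i, (g i).eval r = p i * g0.eval r := by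
        intro i
        have := hcon (h i) (Submodule.subset_span ⟨i, rfl⟩)
        simp [hh] at this
        linear_combination this
      by_cases hg : g0.eval r = 0
      · obtain ⟨i, hi⟩ := hb r hg
        exact hi (by simp [h0 i, hg])
      · apply hc1 r hg
        funext i
        rw [h0 i]; field_simp)
    (by
      by_contra hcon
      push Not at hcon
      have h0 : ∀ i, (g i).coeff d = p i * g0.coeff d := by
        intro i
        have := hcon (h i) (Submodule.subset_span ⟨i, rfl⟩)
        simp [hh] at this
        linear_combination this
      by_cases hg : g0.coeff d = 0
      · obtain ⟨i, hi⟩ := hd hg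
        exact hi (by simp [h0 i, hg])
      · apply hc2 hg
        funext i
        rw [h0 i]; field_simp)
    (by
      intro f hf
      have : Submodule.span K (Set.range h) ≤ Polynomial.degreeLE K d := by
        rw [Submodule.span_le]
        rintro _ ⟨i, rfl⟩
        exact Polynomial.mem_degreeLE.2 (Polynomial.natDegree_le_iff_degree_le.1 (hdeg i _))
      exact Polynomial.natDegree_le_iff_degree_le.2 (Polynomial.mem_degreeLE.1 (this hf)))
  have hvd : v.natDegree ≤ d := by
    have : Submodule.span K (Set.range h) ≤ Polynomial.degreeLE K d := by
      rw [Submodule.span_le]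
      rintro _ ⟨i, rfl⟩
      exact Polynomial.mem_degreeLE.2 (Polynomial.natDegree_le_iff_degree_le.1 (hdeg i _))
    exact Polynomial.natDegree_le_iff_degree_le.2 (Polynomial.mem_degreeLE.1 (this hv))
  obtain ⟨l, hl⟩ := (Submodule.mem_span_range_iff_exists_fun K).1 hu
  obtain ⟨m, hm⟩ := (Submodule.mem_span_range_iff_exists_fun K).1 hv
  let T : (Fin n → K) → Polynomial (MvPolynomial (Fin n) K) := fun l =>
    ∑ i, Polynomial.C (MvPolynomial.C (l i)) * ((g i).map MvPolynomial.C -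
      Polynomial.C (MvPolynomial.X i) * g0.map MvPolynomial.C)
  have hT : ∀ l x, (T l).map (MvPolynomial.aeval x : MvPolynomial (Fin n) K →ₐ[K] K).toRingHom =
      ∑ i, l i • (g i - Polynomial.C (x i) * g0) := by
    intro l x
    have hcomp : ((MvPolynomial.aeval x : MvPolynomial (Fin n) K →ₐ[K] K).toRingHom).comp
        MvPolynomial.C = RingHom.id K := by
      ext; simp
    simp only [T, Polynomial.map_sum, Polynomial.map_mul, Polynomial.map_sub, Polynomial.map_map,
      hcomp, Polynomial.map_id, Polynomial.map_C, Polynomial.smul_eq_C_mul]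
    simp
  set F := Polynomial.resultant (T l) (T m) d d with hF
  have hFx : ∀ x, MvPolynomial.aeval x F = Polynomial.resultant
      (∑ i, l i • (g i - Polynomial.C (x i) * g0))
      (∑ i, m i • (g i - Polynomial.C (x i) * g0)) d d := by
    intro x
    rw [← hT l x, ← hT m x, Polynomial.resultant_map_map]
    rfl
  have hFv : F ∈ vanishingIdeal K
      ((fun t => fun i => (g i).eval t / g0.eval t) '' {t | g0.eval t ≠ 0}) := by
    rw [mem_vanishingIdeal_iff]
    rintro _ ⟨t, ht, rfl⟩
    rw [hFx]
    have hnd : ∀ l x : Fin n → K,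
        (∑ i, l i • (g i - Polynomial.C (x i) * g0)).natDegree ≤ d := by
      intro l x
      apply Polynomial.natDegree_sum_le_of_forall_le
      intro i _
      exact (Polynomial.natDegree_smul_le _ _).trans (hdeg i _)
    have hev : ∀ l : Fin n → K, (∑ i, l i •
        (g i - Polynomial.C ((g i).eval t / g0.eval t) * g0)).eval t = 0 := by
      intro l
      rw [Polynomial.eval_finsetSum]
      apply Finset.sum_eq_zero
      intro i _
      have : g0.eval t ≠ 0 := ht
      simp only [Polynomial.eval_smul, Polynomial.eval_sub, Polynomial.eval_mul,
        Polynomial.eval_C, smul_eq_mul]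
      field_simp
      simp
    obtain ⟨a, b, -, -, hab⟩ := Polynomial.exists_mul_add_mul_eq_C_resultant _ _
      (hnd l fun i => (g i).eval t / g0.eval t) (hnd m fun i => (g i).eval t / g0.eval t)
      (by omega)
    have := congrArg (Polynomial.eval t) hab
    simp only [Polynomial.eval_add, Polynomial.eval_mul, hev, zero_mul, add_zero,
      Polynomial.eval_C] at this
    exact this.symm
  have h0 := mem_zeroLocus_iff.1 hp F hFv
  rw [hFx] at h0
  rw [hl, hm] at h0
  obtain ⟨k, rfl⟩ := Nat.exists_eq_add_of_le hvd
  rw [Polynomial.resultant_add_right_deg _ _ _ _ _ le_rfl] at h0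
  rcases mul_eq_zero.1 h0 with h0 | h0
  · exact hud (eq_zero_of_pow_eq_zero h0)
  · have := Polynomial.resultant_ne_zero u v hcop
    rw [hdu] at this
    exact this h0

lemma aux_count [IsAlgClosed K] {n : ℕ} (g0 : Polynomial K) (g : Fin n → Polynomial K) (d : ℕ)
    (h1 : 1 ≤ d) (hb : ∀ r, g0.eval r = 0 → ∃ i, (g i).eval r ≠ 0)
    (hd : g0.coeff d = 0 → ∃ i, (g i).coeff d ≠ 0)
    (hle0 : g0.natDegree ≤ d) (hle : ∀ i, (g i).natDegree ≤ d) (a0 : K) (a : Fin n → K)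
    (hA : a0 • g0 + ∑ i, a i • g i ≠ 0) (H : Set (Fin n → K))
    (hH : ∀ x ∈ H, a0 + ∑ i, a i * x i = 0) :
    (zclosure ((fun t => fun i => (g i).eval t / g0.eval t) '' {t | g0.eval t ≠ 0}) ∩ H).Finite ∧
    (zclosure ((fun t => fun i => (g i).eval t / g0.eval t) '' {t | g0.eval t ≠ 0}) ∩ H).ncard
      ≤ d := by
  classical
  set A := a0 • g0 + ∑ i, a i • g i with hAdef
  set P : K → Fin n → K := fun t => fun i => (g i).eval t / g0.eval t with hP
  have hAd : A.natDegree ≤ d := by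
    have h2 : (∑ i, a i • g i).natDegree ≤ d := by
      apply Polynomial.natDegree_sum_le_of_forall_le
      intro i _
      exact (Polynomial.natDegree_smul_le _ _).trans (hle i)
    simpa using Polynomial.natDegree_add_le_of_le
      ((Polynomial.natDegree_smul_le a0 _).trans hle0) h2
  have hroot : ∀ t, g0.eval t ≠ 0 → P t ∈ H → t ∈ A.roots.toFinset := by
    intro t ht hx
    have := hH _ hx
    rw [Multiset.mem_toFinset, Polynomial.mem_roots hA, Polynomial.IsRoot.def, hAdef]
    simp only [Polynomial.eval_add, Polynomial.eval_finsetSum, Polynomial.eval_smul, smul_eq_mul]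
    have h3 : (a0 + ∑ i, a i * P t i) * g0.eval t = 0 := by rw [this, zero_mul]
    rw [← h3, add_mul, Finset.sum_mul]
    congr 1
    apply Finset.sum_congr rfl
    intro i _
    simp only [hP]
    field_simp
  have hinf : g0.coeff d ≠ 0 → (fun i => (g i).coeff d / g0.coeff d) ∈ H → A.coeff d = 0 := by
    intro ht hx
    have := hH _ hx
    rw [hAdef]
    simp only [Polynomial.coeff_add, Polynomial.finsetSum_coeff, Polynomial.coeff_smul,
      smul_eq_mul]
    have h3 : (a0 + ∑ i, a i * ((g i).coeff d / g0.coeff d)) * g0.coeff d = 0 := by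
      rw [this, zero_mul]
    rw [← h3, add_mul, Finset.sum_mul]
    congr 1
    apply Finset.sum_congr rfl
    intro i _
    field_simp
  have hcard : A.roots.toFinset.card ≤ A.natDegree :=
    (Multiset.toFinset_card_le _).trans (Polynomial.card_roots' A)
  by_cases hc : A.coeff d = 0
  · have hlt : A.natDegree < d := by
      refine lt_of_le_of_ne hAd ?_
      intro he
      rw [← he] at hc
      exact hA (Polynomial.leadingCoeff_eq_zero.1 hc)
    have hsub : zclosure (P '' {t | g0.eval t ≠ 0}) ∩ H ⊆
        ((insert (fun i => (g i).coeff d / g0.coeff d) (A.roots.toFinset.image P) : Finset _) :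
          Set (Fin n → K)) := by
      rintro x ⟨hx, hxH⟩
      rcases aux_closed g0 g d h1 hb hd hle0 hle x hx with ⟨t, ht, rfl⟩ | ⟨h0, rfl⟩
      · exact Finset.mem_coe.2 (Finset.mem_insert_of_mem
          (Finset.mem_image_of_mem P (hroot t ht hxH)))
      · exact Finset.mem_coe.2 (Finset.mem_insert_self _ _)
    refine ⟨(Finset.finite_toSet _).subset hsub, ?_⟩
    refine (Set.ncard_le_ncard hsub (Finset.finite_toSet _)).trans ?_
    rw [Set.ncard_coe_finset]
    refine (Finset.card_insert_le _ _).trans ?_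
    have : (A.roots.toFinset.image P).card ≤ A.roots.toFinset.card := Finset.card_image_le
    omega
  · have hsub : zclosure (P '' {t | g0.eval t ≠ 0}) ∩ H ⊆
        ((A.roots.toFinset.image P : Finset _) : Set (Fin n → K)) := by
      rintro x ⟨hx, hxH⟩
      rcases aux_closed g0 g d h1 hb hd hle0 hle x hx with ⟨t, ht, rfl⟩ | ⟨h0, rfl⟩
      · exact Finset.mem_coe.2 (Finset.mem_image_of_mem P (hroot t ht hxH))
      · exact absurd (hinf h0 hxH) hc
    refine ⟨(Finset.finite_toSet _).subset hsub, ?_⟩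
    refine (Set.ncard_le_ncard hsub (Finset.finite_toSet _)).trans ?_
    rw [Set.ncard_coe_finset]
    exact Finset.card_image_le.trans (hcard.trans hAd)

lemma aux_finrank_ker {n : ℕ} (φ : (Fin n → K) →ₗ[K] K) (hφ : φ ≠ 0) :
    Module.finrank K (LinearMap.ker φ) = n - 1 := by
  have h1 := LinearMap.finrank_range_add_finrank_ker φ
  have h2 : LinearMap.range φ = ⊤ := LinearMap.range_eq_top.2 (LinearMap.surjective hφ)
  rw [h2, finrank_top, Module.finrank_self, Module.finrank_fin_fun] at h1
  omega

end Helpers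
/-- For an (irreducible) algebraic curve `C ⊆ A^n` with a proper rational parametric
representation `P(t) = (g₁/g₀, …, g_n/g₀)` with `gcd(g₀, …, g_n) = 1`,
`deg(C) = max{deg(gᵢ) : 0 ≤ i ≤ n}`. -/
theorem degree_of_rationally_parametrized_curve {K : Type} [Field K] [IsAlgClosed K]
    [CharZero K] {n : ℕ} (C : Set (Fin n → K)) (hC : IsIrreducibleVariety C)
    (hdim : varDim C = 1) (g0 : Polynomial K) (g : Fin n → Polynomial K) (hg0 : g0 ≠ 0)
    (hgcd : ∀ q : Polynomial K, q ∣ g0 → (∀ i, q ∣ g i) → IsUnit q)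
    (hdom : C = zclosure
      ((fun t => fun i => (g i).eval t / g0.eval t) '' {t | g0.eval t ≠ 0}))
    (U : Set K) (hUopen : Uᶜ.Finite) (hUne : U.Nonempty)
    (hUD : U ⊆ {t | g0.eval t ≠ 0})
    (hP1 : Set.InjOn (fun t => fun i => (g i).eval t / g0.eval t) U) :
    geomDegree C = max g0.natDegree (Finset.univ.sup fun i => (g i).natDegree) := by
  classical
  have hInf : Infinite K := IsAlgClosed.instInfinite
  set P : K → Fin n → K := fun t => fun i => (g i).eval t / g0.eval t with hP
  set d := max g0.natDegree (Finset.univ.sup fun i => (g i).natDegree) with hd_def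
  have hUinf : U.Infinite := by
    intro hfin
    have := hfin.union hUopen
    rw [Set.union_compl_self] at this
    exact Set.infinite_univ this
  have hle0 : g0.natDegree ≤ d := le_max_left _ _
  have hle : ∀ i, (g i).natDegree ≤ d := fun i =>
    (Finset.le_sup (f := fun i => (g i).natDegree) (Finset.mem_univ i)).trans (le_max_right _ _)
  have hb : ∀ r, g0.eval r = 0 → ∃ i, (g i).eval r ≠ 0 := by
    intro r hr
    by_contra hcon
    push Not at hcon
    exact Polynomial.not_isUnit_X_sub_C r (hgcd (Polynomial.X - Polynomial.C r)
      (Polynomial.dvd_iff_isRoot.2 hr) fun i => Polynomial.dvd_iff_isRoot.2 (hcon i))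
  have h1 : 1 ≤ d := by
    by_contra hlt
    obtain ⟨s, hs, t, ht, hst⟩ := hUinf.nontrivial
    apply hst
    apply hP1 hs ht
    have hz : ∀ f : Polynomial K, f.natDegree ≤ d → f.eval s = f.eval t := by
      intro f hf
      rw [Polynomial.eq_C_of_natDegree_eq_zero (p := f) (by omega)]
      simp
    funext i
    simp only [hP]
    rw [hz _ (hle i), hz _ hle0]
  have hn : 1 ≤ n := by
    by_contra hlt
    obtain ⟨s, hs, t, ht, hst⟩ := hUinf.nontrivial
    apply hst
    apply hP1 hs ht
    funext i
    exact absurd i.2 (by omega)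
  have hd : g0.coeff d = 0 → ∃ i, (g i).coeff d ≠ 0 := by
    intro h0
    have hne : d ≠ g0.natDegree := by
      intro he
      rw [he] at h0
      exact hg0 (Polynomial.leadingCoeff_eq_zero.1 h0)
    have hds : d = Finset.univ.sup fun i => (g i).natDegree := by
      rcases max_choice g0.natDegree (Finset.univ.sup fun i => (g i).natDegree) with h | h
      · exact absurd h hne
      · exact h
    obtain ⟨i, -, hi⟩ := Finset.exists_mem_eq_sup (Finset.univ : Finset (Fin n))
      ⟨⟨0, hn⟩, Finset.mem_univ _⟩ (fun i => (g i).natDegree)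
    refine ⟨i, ?_⟩
    have hdi : d = (g i).natDegree := hds.trans hi
    rw [hdi]
    intro hz
    have := Polynomial.leadingCoeff_eq_zero.1 hz
    rw [this] at hdi
    simp at hdi
    omega
  have hPC : ∀ t, g0.eval t ≠ 0 → P t ∈ C := by
    intro t ht
    rw [hdom]
    exact zeroLocus_vanishingIdeal_le _ ⟨t, ht, rfl⟩
  have hCH : ∀ t a0 (a : Fin n → K), g0.eval t ≠ 0 → (a0 • g0 + ∑ i, a i • g i).eval t = 0 →
      a0 + ∑ i, a i * P t i = 0 := by
    intro t a0 a ht h0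
    simp only [Polynomial.eval_add, Polynomial.eval_finsetSum, Polynomial.eval_smul,
      smul_eq_mul] at h0
    apply mul_right_cancel₀ ht
    rw [zero_mul, ← h0, add_mul, Finset.sum_mul]
    congr 1
    apply Finset.sum_congr rfl
    intro i _
    simp only [hP]
    field_simp
  unfold geomDegree
  rw [hdim]
  apply IsGreatest.csSup_eq
  constructor
  · -- existence of a good hyperplane
    have hdegM : ∀ f ∈ Submodule.span K (insert g0 (Set.range g)), f.natDegree ≤ d := by
      intro f hf
      have : Submodule.span K (insert g0 (Set.range g)) ≤ Polynomial.degreeLE K d := by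
        rw [Submodule.span_le]
        rintro _ (rfl | ⟨i, rfl⟩)
        · exact Polynomial.mem_degreeLE.2 (Polynomial.natDegree_le_iff_degree_le.1 hle0)
        · exact Polynomial.mem_degreeLE.2 (Polynomial.natDegree_le_iff_degree_le.1 (hle i))
      exact Polynomial.natDegree_le_iff_degree_le.2 (Polynomial.mem_degreeLE.1 (this hf))
    have hg0M : g0 ∈ Submodule.span K (insert g0 (Set.range g)) :=
      Submodule.subset_span (Set.mem_insert _ _)
    have hgM : ∀ i, g i ∈ Submodule.span K (insert g0 (Set.range g)) := fun i =>
      Submodule.subset_span (Set.mem_insert_of_mem _ ⟨i, rfl⟩)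
    obtain ⟨A, hAM, hAd, hAsep, hAS⟩ := aux_bertini
      (Submodule.span K (insert g0 (Set.range g))) d
      (by
        intro r
        by_cases hr : g0.eval r = 0
        · obtain ⟨i, hi⟩ := hb r hr
          exact ⟨g i, hgM i, hi⟩
        · exact ⟨g0, hg0M, hr⟩)
      (by
        by_cases hr : g0.coeff d = 0
        · obtain ⟨i, hi⟩ := hd hr
          exact ⟨g i, hgM i, hi⟩
        · exact ⟨g0, hg0M, hr⟩)
      hdegM h1 hUopen.toFinset
    obtain ⟨a0, z, hz, hAz⟩ := Submodule.mem_span_insert.1 hAM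
    obtain ⟨a, rfl⟩ := (Submodule.mem_span_range_iff_exists_fun K).1 hz
    have hA0 : A ≠ 0 := by
      rintro rfl
      simp at hAd
      omega
    have hrU : ∀ t ∈ A.roots.toFinset, t ∈ U := by
      intro t ht
      by_contra hU
      refine hAS t (by simpa using hU) ?_
      exact (Polynomial.mem_roots hA0).1 (Multiset.mem_toFinset.1 ht)
    have hcard : A.roots.toFinset.card = d := by
      rw [Multiset.toFinset_card_of_nodup (Polynomial.nodup_roots hAsep), ← hAd]
      exact ((IsAlgClosed.splits A).natDegree_eq_card_roots).symm
    obtain ⟨t0, ht0⟩ : A.roots.toFinset.Nonempty := Finset.card_pos.1 (by omega)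
    have hon : ∀ t ∈ A.roots.toFinset, a0 + ∑ i, a i * P t i = 0 := by
      intro t ht
      apply hCH t a0 a (hUD (hrU t ht))
      rw [← hAz]
      exact (Polynomial.mem_roots hA0).1 (Multiset.mem_toFinset.1 ht)
    let φ : (Fin n → K) →ₗ[K] K := ∑ i, a i • LinearMap.proj i
    have hφx : ∀ x, φ x = ∑ i, a i * x i := by
      intro x
      simp [φ, LinearMap.sum_apply]
    have hφ : φ ≠ 0 := by
      intro h0
      have ha : ∀ i, a i = 0 := by
        intro i
        have := hφx (Pi.single i 1)
        simpa [h0, Pi.single_apply] using this.symm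
      have := hon t0 ht0
      simp [ha] at this
      simp [ha, this] at hAz
      exact hA0 hAz
    have hmem : ∀ x, x ∈ AffineSubspace.mk' (P t0) (LinearMap.ker φ) ↔
        a0 + ∑ i, a i * x i = 0 := by
      intro x
      rw [AffineSubspace.mem_mk', LinearMap.mem_ker, vsub_eq_sub, map_sub, hφx, hφx]
      have := hon t0 ht0
      constructor
      · intro h; linear_combination h + this
      · intro h; linear_combination h - this
    have hcnt := aux_count g0 g d h1 hb hd hle0 hle a0 a (hAz ▸ hA0)
      (AffineSubspace.mk' (P t0) (LinearMap.ker φ) : Set (Fin n → K))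
      (fun x hx => (hmem x).1 hx)
    rw [← hdom] at hcnt
    refine ⟨AffineSubspace.mk' (P t0) (LinearMap.ker φ), ?_, hcnt.1, le_antisymm hcnt.2 ?_⟩
    · rw [AffineSubspace.direction_mk', aux_finrank_ker φ hφ]
    · have hsub : ((A.roots.toFinset.image P : Finset _) : Set (Fin n → K)) ⊆
          C ∩ (AffineSubspace.mk' (P t0) (LinearMap.ker φ) : Set (Fin n → K)) := by
        intro x hx
        obtain ⟨t, ht, rfl⟩ := Finset.mem_image.1 (Finset.mem_coe.1 hx)
        exact ⟨hPC t (hUD (hrU t ht)), (hmem _).2 (hon t ht)⟩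
      have := Set.ncard_le_ncard hsub hcnt.1
      rw [Set.ncard_coe_finset, Finset.card_image_of_injOn
        (fun s hs t ht h => hP1 (hrU s hs) (hrU t ht) h), hcard] at this
      exact this
  · -- upper bound
    rintro m ⟨L, hL, hfin, rfl⟩
    rcases L.eq_bot_or_nonempty with rfl | ⟨p, hpL⟩
    · simp
    · have hlt : L.direction < ⊤ := by
        rw [lt_top_iff_ne_top]
        intro h
        rw [h, finrank_top, Module.finrank_fin_fun] at hL
        omega
      obtain ⟨φ, hφ, hker⟩ := Submodule.exists_le_ker_of_lt_top _ hlt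
      have heq : L.direction = LinearMap.ker φ := by
        apply Submodule.eq_of_le_of_finrank_eq hker
        rw [hL, aux_finrank_ker φ hφ]
      have hφx : ∀ x, φ x = ∑ i, φ (Pi.single i 1) * x i := by
        intro x
        rw [LinearMap.pi_apply_eq_sum_univ φ x]
        apply Finset.sum_congr rfl
        intro i _
        rw [smul_eq_mul, mul_comm]
        congr 2
        funext j
        simp [Pi.single_apply, eq_comm]
      have hmem : ∀ x, x ∈ L ↔ -φ p + ∑ i, φ (Pi.single i 1) * x i = 0 := by
        intro x
        rw [← hφx, ← AffineSubspace.vsub_right_mem_direction_iff_mem hpL, heq, LinearMap.mem_ker,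
          vsub_eq_sub, map_sub]
        constructor
        · intro h; linear_combination h
        · intro h; linear_combination h
      by_cases hA : (-φ p) • g0 + ∑ i, φ (Pi.single i 1) • g i = 0
      · exfalso
        refine (hUinf.image hP1) (hfin.subset ?_)
        rintro _ ⟨t, ht, rfl⟩
        refine ⟨hPC t (hUD ht), (hmem _).2 ?_⟩
        apply hCH t _ (fun i => φ (Pi.single i 1)) (hUD ht)
        rw [hA, Polynomial.eval_zero]
      · have hcnt := aux_count g0 g d h1 hb hd hle0 hle _ (fun i => φ (Pi.single i 1)) hA
          (L : Set (Fin n → K)) (fun x hx => (hmem x).1 hx)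
        rw [← hdom] at hcnt
        exact hcnt.2
end

section
/- Let V ⊆ A^n be a smooth irreducible algebraic variety of dimension d. Then deg(TV) ≤ (deg(V))^{n+d+1}. -/
open MvPolynomial

namespace TB

section KrullDim

theorem exists_ltSeries_lift {R S : Type*} [CommRing R] [CommRing S] [Algebra R S]
    [Algebra.IsIntegral R S] (hinj : Function.Injective (algebraMap R S))
    (m : ℕ) : ∀ (l : LTSeries (PrimeSpectrum R)), l.length = m →
      ∃ l' : LTSeries (PrimeSpectrum S), l'.length = m ∧
        l'.last.comap (algebraMap R S) = l.last := by
  induction m with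
  | zero =>
    intro l hl
    obtain ⟨Q, -, hQ, hQ2⟩ := Ideal.exists_ideal_over_prime_of_isIntegral l.last.asIdeal
      (⊥ : Ideal S) (by
        rw [← RingHom.ker_eq_comap_bot, (RingHom.injective_iff_ker_eq_bot _).1 hinj]
        exact bot_le)
    exact ⟨RelSeries.singleton _ ⟨Q, hQ⟩, rfl, PrimeSpectrum.ext hQ2⟩
  | succ m ih =>
    intro l hl
    obtain ⟨l', hl', hlast⟩ := ih l.eraseLast (by simp [hl])
    have hlt : l.eraseLast.last < l.last := RelSeries.eraseLast_last_rel_last l (by omega)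
    obtain ⟨Q, hQge, hQ, hQ2⟩ := Ideal.exists_ideal_over_prime_of_isIntegral l.last.asIdeal
      l'.last.asIdeal (by
        have := congrArg PrimeSpectrum.asIdeal hlast
        rw [PrimeSpectrum.comap_asIdeal] at this
        rw [this]
        exact hlt.le)
    have hlt' : l'.last < (⟨Q, hQ⟩ : PrimeSpectrum S) := by
      refine lt_of_le_of_ne hQge ?_
      intro h
      apply hlt.ne
      rw [← hlast]
      exact PrimeSpectrum.ext (by rw [PrimeSpectrum.comap_asIdeal, h]; exact hQ2)
    refine ⟨l'.snoc ⟨Q, hQ⟩ hlt', by simp [hl'], ?_⟩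
    rw [RelSeries.last_snoc]
    exact PrimeSpectrum.ext hQ2

theorem ringKrullDim_eq_of_integral {R S : Type*} [CommRing R] [CommRing S] [Algebra R S]
    [Algebra.IsIntegral R S] (hinj : Function.Injective (algebraMap R S)) :
    ringKrullDim S = ringKrullDim R := by
  apply le_antisymm
  · refine Order.krullDim_le_of_strictMono (PrimeSpectrum.comap (algebraMap R S)) ?_
    intro P Q hPQ
    obtain ⟨x, hx1, hx2⟩ := Set.exists_of_ssubset (show (P.asIdeal : Set S) ⊂ Q.asIdeal from hPQ)
    exact Ideal.comap_lt_comap_of_integral_mem_sdiff (le_of_lt hPQ) ⟨hx1, hx2⟩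
      (Algebra.IsIntegral.isIntegral x)
  · refine iSup_le fun l => ?_
    obtain ⟨l', hl', -⟩ := exists_ltSeries_lift hinj _ l rfl
    rw [← hl']
    exact le_iSup (fun l : LTSeries (PrimeSpectrum S) => (l.length : WithBot ℕ∞)) l'

theorem ringKrullDim_mvPoly_integral {K : Type*} [Field K] {r : ℕ} {S : Type*} [CommRing S]
    [Algebra (MvPolynomial (Fin r) K) S]
    [Algebra.IsIntegral (MvPolynomial (Fin r) K) S]
    (hinj : Function.Injective (algebraMap (MvPolynomial (Fin r) K) S)) :
    ringKrullDim S = (r : WithBot ℕ∞) := by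
  rw [ringKrullDim_eq_of_integral hinj, MvPolynomial.ringKrullDim_of_isNoetherianRing,
    ringKrullDim_eq_zero_of_field]
  simp

end KrullDim
end TB

namespace TB

section Noether

/-- `x` satisfies a monic equation over `K[z]` with coefficients of bounded degree. -/
def FilInt (K : Type*) {ι E : Type*} [Field K] [CommRing E] [Algebra K E] (z : ι → E) (x : E) :
    Prop :=
  ∃ (N : ℕ) (c : ℕ → MvPolynomial ι K), (∀ i < N, (c i).totalDegree + i ≤ N) ∧
    x ^ N + ∑ i ∈ Finset.range N, aeval z (c i) * x ^ i = 0

theorem aeval_lin_homog {K R : Type*} [Field K] [CommRing R] [Algebra K R] {r : ℕ}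
    (b : Fin r → K) (c : Fin r → R) (p : MvPolynomial (Fin r) K) (k : ℕ) (hp : p.IsHomogeneous k) :
    (aeval (fun i => Polynomial.C (c i) + Polynomial.C (algebraMap K R (b i)) * Polynomial.X) p :
      Polynomial R).natDegree ≤ k ∧
    (aeval (fun i => Polynomial.C (c i) + Polynomial.C (algebraMap K R (b i)) * Polynomial.X) p :
      Polynomial R).coeff k = algebraMap K R (eval b p) := by
  have hmon : ∀ s : Fin r →₀ ℕ, ∀ t : Finset (Fin r),
      (∏ i ∈ t, (Polynomial.C (c i) + Polynomial.C (algebraMap K R (b i)) * Polynomial.X) ^ s i :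
        Polynomial R).natDegree ≤ ∑ i ∈ t, s i ∧
      (∏ i ∈ t, (Polynomial.C (c i) + Polynomial.C (algebraMap K R (b i)) * Polynomial.X) ^ s i :
        Polynomial R).coeff (∑ i ∈ t, s i) = algebraMap K R (∏ i ∈ t, b i ^ s i) := by
    intro s t
    induction t using Finset.induction_on with
    | empty => simp
    | insert i t hi ih =>
      have h1 : (Polynomial.C (c i) + Polynomial.C (algebraMap K R (b i)) * Polynomial.X :
          Polynomial R).natDegree ≤ 1 := by compute_degree
      have h2 : ((Polynomial.C (c i) + Polynomial.C (algebraMap K R (b i)) * Polynomial.X :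
          Polynomial R) ^ s i).natDegree ≤ s i := by
        simpa using Polynomial.natDegree_pow_le_of_le (s i) h1
      have h3 : ((Polynomial.C (c i) + Polynomial.C (algebraMap K R (b i)) * Polynomial.X :
          Polynomial R) ^ s i).coeff (s i) = algebraMap K R (b i) ^ s i := by
        have := Polynomial.coeff_pow_of_natDegree_le (m := s i) h1
        simpa using this
      simp only [Finset.prod_insert hi, Finset.sum_insert hi]
      refine ⟨Polynomial.natDegree_mul_le_of_le h2 ih.1, ?_⟩
      rw [Polynomial.coeff_mul_add_eq_of_natDegree_le h2 ih.1, h3, ih.2]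
      simp
  have hterm : ∀ s ∈ p.support, (Finset.univ.sum fun i => s i) = k := by
    intro s hs
    have := hp (mem_support_iff.1 hs)
    rw [← this, Finsupp.weight_apply, Finsupp.sum_fintype _ _ (by simp)]
    simp
  rw [aeval_def, eval₂_eq']
  refine ⟨?_, ?_⟩
  · refine Polynomial.natDegree_sum_le_of_forall_le _ _ ?_
    intro s hs
    rw [← hterm s hs, Polynomial.algebraMap_apply]
    exact (Polynomial.natDegree_C_mul_le _ _).trans (hmon s _).1
  · rw [Polynomial.finsetSum_coeff, eval_eq', map_sum]
    refine Finset.sum_congr rfl ?_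
    intro s hs
    rw [← hterm s hs, Polynomial.algebraMap_apply, Polynomial.coeff_C_mul, (hmon s _).2]
    simp

/-- The Rees-type subalgebra. -/
noncomputable def rees (K : Type*) {ι E : Type*} [Field K] [CommRing E] [Algebra K E] (z : ι → E) :
    Subalgebra K (Polynomial E) :=
  Algebra.adjoin K (insert Polynomial.X (Set.range fun i => Polynomial.C (z i) * Polynomial.X))

theorem aeval_CX_homog {K E : Type*} [Field K] [CommRing E] [Algebra K E] {r : ℕ}
    (z : Fin r → E) (p : MvPolynomial (Fin r) K) (k : ℕ) (hp : p.IsHomogeneous k) :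
    (aeval (fun i => Polynomial.C (z i) * Polynomial.X) p : Polynomial E) =
      Polynomial.C (aeval z p) * Polynomial.X ^ k := by
  have hterm : ∀ s ∈ p.support, (Finset.univ.sum fun i => s i) = k := by
    intro s hs
    have := hp (mem_support_iff.1 hs)
    rw [← this, Finsupp.weight_apply, Finsupp.sum_fintype _ _ (by simp)]
    simp
  rw [aeval_def, eval₂_eq', aeval_def, eval₂_eq', map_sum, Finset.sum_mul]
  refine Finset.sum_congr rfl ?_
  intro s hs
  rw [← hterm s hs, Polynomial.algebraMap_apply]
  simp only [mul_pow, Finset.prod_mul_distrib, Finset.prod_pow_eq_pow_sum, map_mul, map_prod,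
    map_pow]
  ring

theorem isIntegral_trans_adjoin {K R : Type*} [Field K] [CommRing R] [Algebra K R]
    (A' : Subalgebra K R) (S : Set R) (hS : ∀ s ∈ S, IsIntegral A' s) (y : R)
    (hy : IsIntegral (Algebra.adjoin K S) y) : IsIntegral A' y := by
  have hle : Algebra.adjoin K S ≤ (integralClosure A' R).restrictScalars K :=
    Algebra.adjoin_le fun s hs => hS s hs
  obtain ⟨p, hp, hpe⟩ := hy
  have : IsIntegral (integralClosure A' R) y := by
    let φ : Algebra.adjoin K S →+* integralClosure A' R :=
      (Subalgebra.inclusion hle).toRingHom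
    refine ⟨p.map φ, hp.map _, ?_⟩
    rw [Polynomial.eval₂_map]
    exact hpe
  exact isIntegral_trans _ this

theorem noether_step {K E : Type*} [Field K] [Infinite K] [CommRing E] [Algebra K E] {r : ℕ}
    (z : Fin (r + 1) → E) (P : MvPolynomial (Fin (r + 1)) K) (hP : P ≠ 0) (hPz : aeval z P = 0) :
    ∃ b : Fin r → K, ∀ y : Polynomial E, IsIntegral (rees K z) y →
      IsIntegral (rees K (fun i => z i.castSucc - algebraMap K E (b i) * z (Fin.last r))) y := by
  set N := P.totalDegree with hN
  set H := homogeneousComponent N P with hH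
  have hH0 : H ≠ 0 := by
    intro h0
    obtain ⟨s, hs, hs2⟩ := Finset.exists_mem_eq_sup P.support (by simpa using hP)
      (fun s => s.sum fun _ e => e)
    have : coeff s H = 0 := by rw [h0, coeff_zero]
    rw [hH, coeff_homogeneousComponent, if_pos] at this
    · exact (mem_support_iff.1 hs) this
    · rw [hN, totalDegree, hs2]; rfl
  obtain ⟨a, ha⟩ : ∃ a : Fin (r+1) → K, eval a (H * X (Fin.last r)) ≠ 0 := by
    by_contra! hcon
    exact mul_ne_zero hH0 (X_ne_zero _) (MvPolynomial.funext fun a => by simpa using hcon a)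
  rw [map_mul, eval_X] at ha
  have ha1 := left_ne_zero_of_mul ha
  have ha2 := right_ne_zero_of_mul ha
  set b : Fin (r + 1) → K := fun i => a i / a (Fin.last r) with hb
  have hbl : b (Fin.last r) = 1 := div_self ha2
  have hHh : H.IsHomogeneous N := homogeneousComponent_isHomogeneous _ _
  have hHb : eval b H ≠ 0 := by
    intro h0
    apply ha1
    have : a = fun i => a (Fin.last r) * b i := by
      funext i; simp only [hb]; field_simp
    rw [this]
    have key : ∀ (q : MvPolynomial (Fin (r+1)) K) (k : ℕ) (t : K), q.IsHomogeneous k →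
        eval (fun i => t * b i) q = t ^ k * eval b q := by
      intro q k t hq
      rw [eval_eq', eval_eq', Finset.mul_sum]
      refine Finset.sum_congr rfl fun s hs => ?_
      have := hq (mem_support_iff.1 hs)
      rw [Finsupp.weight_apply, Finsupp.sum_fintype _ _ (by simp)] at this
      simp only [mul_pow, Finset.prod_mul_distrib, Finset.prod_pow_eq_pow_sum]
      simp at this
      rw [this]; ring
    rw [key _ _ _ hHh, h0, mul_zero]
  refine ⟨fun i => b i.castSucc, fun y hy => ?_⟩
  set z' : Fin r → E := fun i => z i.castSucc - algebraMap K E (b i.castSucc) * z (Fin.last r)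
    with hz'
  set A' := rees K z' with hA'
  have hX : (Polynomial.X : Polynomial E) ∈ A' := Algebra.subset_adjoin (Set.mem_insert _ _)
  have hz'm : ∀ i, (Polynomial.C (z' i) * Polynomial.X : Polynomial E) ∈ A' := fun i =>
    Algebra.subset_adjoin (Set.mem_insert_of_mem _ ⟨i, rfl⟩)
  let c : Fin (r + 1) → A' := Fin.lastCases 0 (fun i => ⟨_, hz'm i⟩)
  have hc : ∀ i, ((c i : A') : Polynomial E) + algebraMap K (Polynomial E) (b i) *
      (Polynomial.C (z (Fin.last r)) * Polynomial.X) = Polynomial.C (z i) * Polynomial.X := by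
    intro i
    refine Fin.lastCases ?_ (fun i => ?_) i
    · simp [c, hbl]
    · simp only [c, Fin.lastCases_castSucc, hz', map_sub, map_mul, Polynomial.algebraMap_apply]
      ring
  have hlast : IsIntegral A' (Polynomial.C (z (Fin.last r)) * Polynomial.X : Polynomial E) := by
    let f : Fin (r + 1) → Polynomial A' := fun i =>
      Polynomial.C (c i) + Polynomial.C (algebraMap K A' (b i)) * Polynomial.X
    let T : A' := ⟨_, hX⟩
    let Q : Polynomial A' := ∑ k ∈ Finset.range (N + 1),
      Polynomial.C (T ^ (N - k)) * aeval f (homogeneousComponent k P)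
    have hf := fun k => aeval_lin_homog b c (homogeneousComponent k P) k
      (homogeneousComponent_isHomogeneous _ _)
    have hQd : Q.natDegree ≤ N := by
      refine Polynomial.natDegree_sum_le_of_forall_le _ _ fun k hk => ?_
      exact (Polynomial.natDegree_C_mul_le _ _).trans ((hf k).1.trans
        (Nat.lt_succ_iff.1 (Finset.mem_range.1 hk)))
    have hQc : Q.coeff N = algebraMap K A' (eval b H) := by
      rw [Polynomial.finsetSum_coeff, Finset.sum_range_succ, Finset.sum_eq_zero, zero_add,
        Polynomial.coeff_C_mul, (hf N).2]
      · simp [hH]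
      · intro k hk
        rw [Polynomial.coeff_C_mul, Polynomial.coeff_eq_zero_of_natDegree_lt, mul_zero]
        exact (hf k).1.trans_lt (Finset.mem_range.1 hk)
    have hQe : Polynomial.aeval (Polynomial.C (z (Fin.last r)) * Polynomial.X : Polynomial E) Q
        = 0 := by
      have h1 : ∀ k, Polynomial.aeval (Polynomial.C (z (Fin.last r)) * Polynomial.X : Polynomial E)
          (aeval f (homogeneousComponent k P)) =
            Polynomial.C (aeval z (homogeneousComponent k P)) * Polynomial.X ^ k := by
        intro k
        rw [← aeval_CX_homog z _ k (homogeneousComponent_isHomogeneous _ _)]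
        have := comp_aeval_apply (f := f) ((Polynomial.aeval (R := A')
          (Polynomial.C (z (Fin.last r)) * Polynomial.X : Polynomial E)).restrictScalars K)
          (homogeneousComponent k P)
        rw [AlgHom.restrictScalars_apply] at this
        rw [this]
        congr 2
        funext i
        rw [← hc i]
        simp only [f, AlgHom.restrictScalars_apply, map_add, map_mul, Polynomial.aeval_C,
          Polynomial.aeval_X]
        rfl
      simp only [Q, map_sum, map_mul, h1, Polynomial.aeval_C]
      have h2 : ∀ k ∈ Finset.range (N + 1), algebraMap A' (Polynomial E) (T ^ (N - k)) *
          (Polynomial.C (aeval z (homogeneousComponent k P)) * Polynomial.X ^ k) =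
          Polynomial.C (aeval z (homogeneousComponent k P)) * Polynomial.X ^ N := by
        intro k hk
        have hk' : k ≤ N := Nat.lt_succ_iff.1 (Finset.mem_range.1 hk)
        have : algebraMap A' (Polynomial E) (T ^ (N - k)) = Polynomial.X ^ (N - k) := by
          rw [map_pow]; rfl
        rw [this, mul_left_comm, ← pow_add, Nat.sub_add_cancel hk']
      rw [Finset.sum_congr rfl h2, ← Finset.sum_mul, ← map_sum, ← map_sum, hN,
        sum_homogeneousComponent, hPz]
      simp
    refine ⟨Polynomial.C (algebraMap K A' (eval b H)⁻¹) * Q, ?_, ?_⟩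
    · refine Polynomial.monic_of_natDegree_le_of_coeff_eq_one N
        ((Polynomial.natDegree_C_mul_le _ _).trans hQd) ?_
      rw [Polynomial.coeff_C_mul, hQc, ← map_mul, inv_mul_cancel₀ hHb, map_one]
    · rw [← Polynomial.aeval_def, map_mul, hQe, mul_zero]
  refine isIntegral_trans_adjoin A' _ ?_ y hy
  intro s hs
  have hal : ∀ a : A', IsIntegral A' (a : Polynomial E) := fun a => isIntegral_algebraMap
  rcases hs with rfl | ⟨i, rfl⟩
  · exact hal ⟨_, hX⟩
  · simp only
    rw [← hc i]
    refine (hal _).add (IsIntegral.mul ?_ hlast)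
    exact hal (algebraMap K A' (b i))

theorem rees_coeff {K E ι : Type*} [Field K] [CommRing E] [Algebra K E]
    (z : ι → E) (y : Polynomial E) (hy : y ∈ rees K z) :
    ∀ k, ∃ p : MvPolynomial ι K, p.totalDegree ≤ k ∧ aeval z p = y.coeff k := by
  classical
  have hdeg : ∀ {p q : MvPolynomial ι K} {k}, p.totalDegree ≤ k → q.totalDegree ≤ k →
      (p + q).totalDegree ≤ k := fun hp hq =>
    (totalDegree_add _ _).trans (max_le hp hq)
  induction hy using Algebra.adjoin_induction with
  | mem x hx =>
    intro k
    rcases hx with rfl | ⟨i, rfl⟩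
    · by_cases hk : k = 1
      · exact ⟨1, by simp, by simp [hk]⟩
      · exact ⟨0, by simp, by simp [Polynomial.coeff_X, Ne.symm hk]⟩
    · by_cases hk : k = 1
      · subst hk
        exact ⟨X i, by simp [totalDegree_X], by simp⟩
      · exact ⟨0, by simp, by simp [Polynomial.coeff_X, Ne.symm hk]⟩
  | algebraMap a =>
    intro k
    by_cases hk : k = 0
    · exact ⟨C a, by simp, by simp [hk]⟩
    · exact ⟨0, by simp, by simp [Polynomial.algebraMap_apply, Polynomial.coeff_C, hk]⟩
  | add x y _ _ hx hy =>
    intro k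
    obtain ⟨p, hp, hp2⟩ := hx k
    obtain ⟨q, hq, hq2⟩ := hy k
    exact ⟨p + q, hdeg hp hq, by simp [hp2, hq2]⟩
  | mul x y _ _ hx hy =>
    intro k
    choose p hp hp2 using hx
    choose q hq hq2 using hy
    refine ⟨∑ ij ∈ Finset.HasAntidiagonal.antidiagonal k, p ij.1 * q ij.2, ?_, ?_⟩
    · refine (totalDegree_finsetSum _ _).trans (Finset.sup_le fun ij hij => ?_)
      rw [← Finset.HasAntidiagonal.mem_antidiagonal.1 hij]
      exact (totalDegree_mul _ _).trans (add_le_add (hp _) (hq _))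
    · rw [Polynomial.coeff_mul, map_sum]
      exact Finset.sum_congr rfl fun ij _ => by rw [map_mul, hp2, hq2]

theorem filInt_of_rees {K E ι : Type*} [Field K] [CommRing E] [Algebra K E]
    (z : ι → E) (x : E)
    (hx : IsIntegral (rees K z) (Polynomial.C x * Polynomial.X : Polynomial E)) :
    FilInt K z x := by
  obtain ⟨Q, hQm, hQ⟩ := hx
  have h := fun i => rees_coeff z (Q.coeff i : Polynomial E) (Q.coeff i).2
  choose p hp hp2 using h
  refine ⟨Q.natDegree, fun i => p i (Q.natDegree - i), fun i hi => ?_, ?_⟩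
  · have := hp i (Q.natDegree - i)
    show (p i (Q.natDegree - i)).totalDegree + i ≤ _
    omega
  · rw [Polynomial.eval₂_eq_sum_range, Finset.sum_range_succ] at hQ
    have h2 := congrArg (fun q => Polynomial.coeff q Q.natDegree) hQ
    simp only [Polynomial.coeff_add, Polynomial.finsetSum_coeff, Polynomial.coeff_zero] at h2
    rw [hQm.coeff_natDegree] at h2
    rw [add_comm, ← h2]
    congr 1
    · refine Finset.sum_congr rfl fun i hi => ?_
      have hi' := Finset.mem_range.1 hi
      rw [hp2, mul_pow, ← Polynomial.C_pow, ← mul_assoc, Polynomial.coeff_mul_X_pow',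
        if_pos hi'.le, Polynomial.coeff_mul_C]
      rfl
    · rw [map_one, one_mul, mul_pow, ← Polynomial.C_pow, Polynomial.coeff_C_mul_X_pow, if_pos rfl]

theorem exists_noether {K E : Type*} [Field K] [Infinite K] [CommRing E] [Nontrivial E]
    [Algebra K E] {n : ℕ} (x : Fin n → E) :
    ∃ (r : ℕ) (M : Fin r → Fin n → K),
      AlgebraicIndependent K (fun i => ∑ j, M i j • x j) ∧
      ∀ j, FilInt K (fun i => ∑ j, M i j • x j) (x j) := by
  classical
  let Pr : ℕ → Prop := fun r => ∃ M : Fin r → Fin n → K,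
    ∀ j, IsIntegral (rees K (fun i => ∑ j, M i j • x j))
      (Polynomial.C (x j) * Polynomial.X : Polynomial E)
  have hex : ∃ r, Pr r := by
    refine ⟨n, fun i => Pi.single i 1, fun j => ?_⟩
    have : (Polynomial.C (x j) * Polynomial.X : Polynomial E) ∈
        rees K (fun i : Fin n => ∑ j, (Pi.single i 1 : Fin n → K) j • x j) := by
      refine Algebra.subset_adjoin (Set.mem_insert_of_mem _ ⟨j, ?_⟩)
      simp [Pi.single_apply]
    exact isIntegral_algebraMap (x := (⟨_, this⟩ : rees K _))
  obtain ⟨M, hM⟩ := Nat.find_spec hex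
  have hmin := fun m => Nat.find_min (H := hex) (m := m)
  generalize Nat.find hex = r at M hM hmin
  refine ⟨r, M, ?_, fun j => filInt_of_rees _ _ (hM j)⟩
  rw [algebraicIndependent_iff]
  intro P hPz
  by_contra hP
  cases r with
  | zero =>
    apply hP
    rw [P.eq_C_of_isEmpty] at hPz ⊢
    rw [aeval_C] at hPz
    rw [(algebraMap K E).injective (hPz.trans (map_zero _).symm), C_0]
  | succ r =>
    obtain ⟨b, hb⟩ := noether_step _ P hP hPz
    refine hmin r (Nat.lt_succ_self r)
      ⟨fun i j => M i.castSucc j - b i * M (Fin.last r) j, fun j => ?_⟩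
    have := hb _ (hM j)
    have he : (fun i => ∑ j, (M (Fin.castSucc i) j - b i * M (Fin.last r) j) • x j) =
        fun i : Fin r => (∑ j, M i.castSucc j • x j) -
          algebraMap K E (b i) * ∑ j, M (Fin.last r) j • x j := by
      funext i
      simp only [sub_smul, Finset.sum_sub_distrib, mul_smul, ← Finset.smul_sum]
      rw [Algebra.smul_def (b i)]
    rw [he]
    exact this

end Noether
end TB

namespace TB

section MinpolyDegree

/-- the total degree of a polynomial in one more variable -/
noncomputable def td {K : Type*} [Field K] {r : ℕ} (F : Polynomial (MvPolynomial (Fin r) K)) : ℕ :=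
  ((optionEquivLeft K (Fin r)).symm F).totalDegree

theorem td_mul {K : Type*} [Field K] {r : ℕ} {F G : Polynomial (MvPolynomial (Fin r) K)}
    (hF : F ≠ 0) (hG : G ≠ 0) : td (F * G) = td F + td G := by
  unfold td
  rw [map_mul, totalDegree_mul_of_isDomain]
  · simpa using hF
  · simpa using hG

theorem natDegree_le_td {K : Type*} [Field K] {r : ℕ} (F : Polynomial (MvPolynomial (Fin r) K)) :
    F.natDegree ≤ td F := by
  have := natDegree_optionEquivLeft K ((optionEquivLeft K (Fin r)).symm F)
  rw [AlgEquiv.apply_symm_apply] at this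
  rw [this]
  exact degreeOf_le_totalDegree _ _

theorem coeff_le_td {K : Type*} [Field K] {r : ℕ} (F : Polynomial (MvPolynomial (Fin r) K))
    (i : ℕ) (hi : i ≤ F.natDegree) : (F.coeff i).totalDegree + i ≤ td F := by
  have := totalDegree_coeff_optionEquivLeft_add_le K (Fin r) ((optionEquivLeft K (Fin r)).symm F) i
    (hi.trans (natDegree_le_td F))
  rwa [AlgEquiv.apply_symm_apply] at this

theorem td_le {K : Type*} [Field K] {r : ℕ} (F : Polynomial (MvPolynomial (Fin r) K)) (N : ℕ)
    (h : ∀ i ≤ F.natDegree, (F.coeff i).totalDegree + i ≤ N) : td F ≤ N := by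
  unfold td
  rw [optionEquivLeft_symm_apply]
  rw [F.as_sum_range_C_mul_X_pow, map_sum]
  refine (totalDegree_finsetSum _ _).trans (Finset.sup_le fun i hi => ?_)
  rw [map_mul, map_pow, Polynomial.aevalTower_C, Polynomial.aevalTower_X]
  refine (totalDegree_mul _ _).trans (le_trans ?_ (h i (Nat.lt_succ_iff.1 (Finset.mem_range.1 hi))))
  refine add_le_add ?_ ((totalDegree_pow _ _).trans (by simp [totalDegree_X]))
  exact totalDegree_rename_le _ _

variable {K : Type*} [Field K] {r : ℕ} {B : Type*} [CommRing B] [Algebra K B]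
    [Algebra (MvPolynomial (Fin r) K) B] [IsScalarTower K (MvPolynomial (Fin r) K) B]

theorem aeval_eq_algebraMap (p : MvPolynomial (Fin r) K) :
    aeval (fun i => algebraMap (MvPolynomial (Fin r) K) B (X i)) p = algebraMap _ B p := by
  have : aeval (fun i => algebraMap (MvPolynomial (Fin r) K) B (X i)) =
      IsScalarTower.toAlgHom K (MvPolynomial (Fin r) K) B := by
    ext i; simp
  rw [this]; rfl

theorem FilInt.exists_poly {x : B}
    (h : FilInt K (fun i => algebraMap (MvPolynomial (Fin r) K) B (X i)) x) :
    ∃ G : Polynomial (MvPolynomial (Fin r) K), G.Monic ∧ Polynomial.aeval x G = 0 ∧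
      td G ≤ G.natDegree := by
  obtain ⟨N, c, hc, he⟩ := h
  have hdeg : (∑ i ∈ Finset.range N, Polynomial.C (c i) * Polynomial.X ^ i).degree <
      (N : WithBot ℕ) := by
    refine (Polynomial.degree_sum_le _ _).trans_lt ?_
    rw [Finset.sup_lt_iff (WithBot.bot_lt_coe _)]
    intro i hi
    exact (Polynomial.degree_C_mul_X_pow_le _ _).trans_lt
      (by exact_mod_cast Finset.mem_range.1 hi)
  have hm := Polynomial.monic_X_pow_add hdeg
  have hnd : (Polynomial.X ^ N + ∑ i ∈ Finset.range N,
      Polynomial.C (c i) * Polynomial.X ^ i).natDegree = N := by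
    refine Polynomial.natDegree_eq_of_degree_eq_some ?_
    rw [Polynomial.degree_add_eq_left_of_degree_lt (by rwa [Polynomial.degree_X_pow]),
      Polynomial.degree_X_pow]
  refine ⟨_, hm, ?_, ?_⟩
  · simp only [map_add, map_sum, map_mul, map_pow, Polynomial.aeval_X, Polynomial.aeval_C]
    simpa only [aeval_eq_algebraMap] using he
  · refine td_le _ _ fun i hi => ?_
    rw [hnd] at hi ⊢
    simp only [Polynomial.coeff_add, Polynomial.finsetSum_coeff, Polynomial.coeff_C_mul,
      Polynomial.coeff_X_pow, mul_ite, mul_one, mul_zero]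
    rcases hi.lt_or_eq with h | h
    · rw [if_neg h.ne, zero_add, Finset.sum_ite_eq, if_pos (Finset.mem_range.2 h)]
      exact hc i h
    · subst h
      simp

theorem FilInt.isIntegral {x : B}
    (h : FilInt K (fun i => algebraMap (MvPolynomial (Fin r) K) B (X i)) x) :
    IsIntegral (MvPolynomial (Fin r) K) x := by
  obtain ⟨G, hG, he, -⟩ := h.exists_poly
  exact ⟨G, hG, he⟩

theorem FilInt.td_minpoly [IsDomain B] [Module.IsTorsionFree (MvPolynomial (Fin r) K) B] {x : B}
    (h : FilInt K (fun i => algebraMap (MvPolynomial (Fin r) K) B (X i)) x) :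
    td (minpoly (MvPolynomial (Fin r) K) x) ≤ (minpoly (MvPolynomial (Fin r) K) x).natDegree := by
  have hi := h.isIntegral
  obtain ⟨G, hG, he, hd⟩ := h.exists_poly
  obtain ⟨Q, hQ⟩ := minpoly.isIntegrallyClosed_dvd hi he
  have hF := minpoly.monic hi
  have hQ0 : Q ≠ 0 := by rintro rfl; exact hG.ne_zero (by simpa using hQ)
  rw [hQ, td_mul hF.ne_zero hQ0, Polynomial.natDegree_mul hF.ne_zero hQ0] at hd
  have := natDegree_le_td Q
  omega

end MinpolyDegree
end TB

namespace TB

section Hilbert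

open Classical in
/-- exponent vectors of weighted degree at most `t` -/
noncomputable def cntSet {ι : Type*} [Fintype ι] (D : ι → ℕ) (t : ℕ) : Finset (ι → ℕ) :=
  (Fintype.piFinset fun _ : ι => Finset.range (t + 1)).filter fun a => ∑ i, D i * a i ≤ t

theorem mem_cntSet {ι : Type*} [Fintype ι] {D : ι → ℕ} (hD : ∀ i, 1 ≤ D i) {t : ℕ} {a : ι → ℕ} :
    a ∈ cntSet D t ↔ ∑ i, D i * a i ≤ t := by
  classical
  simp only [cntSet, Finset.mem_filter, Fintype.mem_piFinset, Finset.mem_range]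
  refine ⟨fun h => h.2, fun h => ⟨fun i => ?_, h⟩⟩
  have h1 := Finset.single_le_sum (f := fun i => D i * a i) (fun i _ => Nat.zero_le _)
    (Finset.mem_univ i)
  have h2 : a i ≤ D i * a i := Nat.le_mul_of_pos_left _ (hD i)
  omega

/-- number of monomials of degree at most `t` -/
noncomputable def cnt (ι : Type*) [Fintype ι] (t : ℕ) : ℕ := (cntSet (fun _ : ι => 1) t).card

theorem cnt_congr {ι κ : Type*} [Fintype ι] [Fintype κ] (h : Fintype.card ι = Fintype.card κ)
    (t : ℕ) : cnt ι t = cnt κ t := by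
  obtain ⟨e⟩ := Fintype.card_eq.1 h
  refine Finset.card_equiv (e.arrowCongr (Equiv.refl ℕ)) fun a => ?_
  rw [mem_cntSet (fun _ => le_rfl), mem_cntSet (fun _ => le_rfl)]
  have : ∑ i : κ, 1 * (e.arrowCongr (Equiv.refl ℕ)) a i = ∑ i, 1 * a i := by
    simp only [one_mul]
    rw [← e.sum_comp]
    simp
  rw [this]

theorem cnt_le_prod_mul {ι : Type*} [Fintype ι] (D : ι → ℕ) (hD : ∀ i, 1 ≤ D i) (t : ℕ) :
    cnt ι t ≤ (∏ i, D i) * (cntSet D t).card := by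
  classical
  have : (∏ i, D i) * (cntSet D t).card =
      ((Fintype.piFinset fun i => Finset.range (D i)) ×ˢ cntSet D t).card := by
    rw [Finset.card_product, Fintype.card_piFinset]
    simp
  rw [this]
  refine Finset.card_le_card_of_injOn (fun a => (fun i => a i % D i, fun i => a i / D i)) ?_ ?_
  · intro a ha
    have ha' : a ∈ cntSet (fun _ : ι => 1) t := ha
    rw [mem_cntSet (fun _ => le_rfl)] at ha'
    simp only [Finset.coe_product, Set.mem_prod, Finset.mem_coe]
    refine ⟨?_, (mem_cntSet hD).2 ?_⟩
    · rw [Fintype.mem_piFinset]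
      exact fun i => Finset.mem_range.2 (Nat.mod_lt _ (hD i))
    · refine le_trans (Finset.sum_le_sum fun i _ => ?_) ha'
      rw [one_mul]; exact Nat.mul_div_le _ _
  · intro a _ b _ hab
    simp only [Prod.mk.injEq] at hab
    funext i
    rw [← Nat.mod_add_div (a i) (D i), ← Nat.mod_add_div (b i) (D i)]
    have h1 := congrFun hab.1 i
    have h2 := congrFun hab.2 i
    rw [h1, h2]

theorem card_cntSet_le {ι : Type*} [Fintype ι] (D : ι → ℕ) (t : ℕ) :
    (cntSet D t).card ≤ (t + 1) ^ Fintype.card ι := by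
  classical
  refine (Finset.card_filter_le _ _).trans ?_
  rw [Fintype.card_piFinset]
  simp

theorem growth_bound (f : ℕ → ℕ) (N C Q e : ℕ) (hf0 : 1 ≤ f 0) (hf : ∀ t, f t ≤ (t + 1) ^ N)
    (h : ∀ t, e * f t ≤ Q * f (t + C)) : e ≤ Q := by
  by_contra hlt
  push Not at hlt
  have hQ : 0 < Q := by
    rcases Nat.eq_zero_or_pos Q with rfl | hQ
    · have := h 0
      rw [zero_mul] at this
      have : 1 ≤ e * f 0 := Nat.mul_pos (by omega) hf0
      omega
    · exact hQ
  have hiter : ∀ k, (Q + 1) ^ k ≤ Q ^ k * f (k * C) := by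
    intro k
    induction k with
    | zero => simpa using hf0
    | succ k ih =>
      calc (Q + 1) ^ (k + 1) = (Q + 1) ^ k * (Q + 1) := pow_succ _ _
        _ ≤ (Q ^ k * f (k * C)) * (Q + 1) := Nat.mul_le_mul_right _ ih
        _ = Q ^ k * ((Q + 1) * f (k * C)) := by ring
        _ ≤ Q ^ k * (e * f (k * C)) := by gcongr; omega
        _ ≤ Q ^ k * (Q * f (k * C + C)) := Nat.mul_le_mul_left _ (h _)
        _ = Q ^ (k + 1) * f ((k + 1) * C) := by rw [pow_succ, add_mul, one_mul, mul_assoc]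
  set r : ℝ := (Q + 1) / Q with hr
  have hQr : (0 : ℝ) < Q := by exact_mod_cast hQ
  have hr1 : 1 < r := by rw [hr, one_lt_div hQr]; linarith
  have hlim := tendsto_pow_const_div_const_pow_of_one_lt N hr1
  have hpos : (0 : ℝ) < 1 / (C + 1) ^ N := by positivity
  obtain ⟨k, hk, hk1⟩ := ((hlim.eventually (gt_mem_nhds hpos)).and
    (Filter.eventually_ge_atTop 1)).exists
  have h1 : r ^ k ≤ (C + 1) ^ N * (k : ℝ) ^ N := by
    have h2 : ((Q + 1 : ℕ) : ℝ) ^ k ≤ Q ^ k * (f (k * C) : ℝ) := by exact_mod_cast hiter k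
    have h3 : (f (k * C) : ℝ) ≤ ((C + 1) * k) ^ N := by
      have : f (k * C) ≤ ((C + 1) * k) ^ N := (hf _).trans (Nat.pow_le_pow_left (by nlinarith) _)
      exact_mod_cast this
    rw [hr, div_pow, div_le_iff₀ (by positivity), ← mul_pow]
    calc ((Q : ℝ) + 1) ^ k ≤ Q ^ k * (f (k * C) : ℝ) := by exact_mod_cast h2
      _ ≤ Q ^ k * ((C + 1) * k) ^ N := by gcongr
      _ = _ := by ring
  rw [div_lt_div_iff₀ (by positivity) (by positivity)] at hk
  nlinarith

/-- linear independence of `u` over the polynomial ring in `w` -/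
def Indep (K : Type*) {ι S : Type*} [Field K] [CommRing S] [Algebra K S] {e : ℕ} (u : Fin e → S)
    (w : ι → S) : Prop :=
  ∀ p : Fin e → MvPolynomial ι K, ∑ i, u i * aeval w (p i) = 0 → ∀ i, p i = 0

/-- Hilbert function bound -/
def HB {K σ S : Type*} [Field K] [CommRing S] [Algebra K S] (ψ : MvPolynomial σ K →ₐ[K] S)
    (q : ℕ) (ι : Type*) [Fintype ι] : Prop :=
  ∃ C, ∀ s, ∀ (τ : Type) [Fintype τ] (f : τ → MvPolynomial σ K), (∀ i, (f i).totalDegree ≤ s) →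
    LinearIndependent K (fun i => ψ (f i)) → Fintype.card τ ≤ q * cnt ι (s + C)

theorem indep_linearIndependent {K ι S : Type*} [Field K] [CommRing S] [Algebra K S] [Fintype ι]
    {e : ℕ} {u : Fin e → S} {w : ι → S} (h : Indep K u w) (T : Finset (ι → ℕ)) :
    LinearIndependent K (fun ia : Fin e × T => u ia.1 * ∏ j, w j ^ (ia.2 : ι → ℕ) j) := by
  classical
  rw [Fintype.linearIndependent_iff]
  intro g hg
  let p : Fin e → MvPolynomial ι K := fun i => ∑ a : T,
    monomial (Finsupp.equivFunOnFinite.symm (a : ι → ℕ)) (g (i, a))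
  have hp : ∑ i, u i * aeval w (p i) = 0 := by
    rw [← hg, Fintype.sum_prod_type]
    refine Finset.sum_congr rfl fun i _ => ?_
    rw [map_sum, Finset.mul_sum]
    refine Finset.sum_congr rfl fun a _ => ?_
    rw [aeval_monomial, Finsupp.prod_fintype _ _ (by simp), Algebra.smul_def]
    simp only [Finsupp.equivFunOnFinite_symm_apply_apply]
    ring
  have h0 := h p hp
  rintro ⟨i, a⟩
  have := congrArg (coeff (Finsupp.equivFunOnFinite.symm (a : ι → ℕ))) (h0 i)
  simp only [p, coeff_sum, coeff_monomial, coeff_zero] at this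
  rw [Finset.sum_eq_single a] at this
  · simpa using this
  · intro b _ hb
    rw [if_neg]
    intro heq
    exact hb (Subtype.ext (Finsupp.equivFunOnFinite.symm.injective heq))
  · simp

theorem count_bound {K σ S ι κ : Type*} [Field K] [CommRing S] [Algebra K S] [Fintype ι]
    [Fintype κ] (hcard : Fintype.card ι = Fintype.card κ)
    {ψ : MvPolynomial σ K →ₐ[K] S} {q : ℕ} (hψ : HB ψ q ι) {e : ℕ}
    (b : Fin e → MvPolynomial σ K) (h : κ → MvPolynomial σ K) (D : κ → ℕ) (hD : ∀ i, 1 ≤ D i)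
    (hh : ∀ i, (h i).totalDegree ≤ D i) (hI : Indep K (fun i => ψ (b i)) (fun i => ψ (h i))) :
    e ≤ q * ∏ i, D i := by
  classical
  obtain ⟨C, hC⟩ := hψ
  set B := Finset.univ.sup fun i => (b i).totalDegree with hB
  -- reindexing to `Type`
  refine growth_bound (fun t => (cntSet D t).card) (Fintype.card κ) (B + C) _ e ?_
    (fun t => card_cntSet_le D t) (fun t => ?_)
  · refine Finset.card_pos.2 ⟨0, (mem_cntSet hD).2 (by simp)⟩
  have hli := indep_linearIndependent hI (cntSet D t)
  let N := Fintype.card (Fin e × cntSet D t)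
  let eq : Fin N ≃ Fin e × cntSet D t := (Fintype.equivFin _).symm
  have key := hC (t + B) (Fin N)
    (fun x => b (eq x).1 * ∏ j, h j ^ ((eq x).2 : κ → ℕ) j) (fun x => ?_) ?_
  · have hN : Fintype.card (Fin N) = e * (cntSet D t).card := by
      simp [N]
    rw [hN, cnt_congr hcard] at key
    refine key.trans ?_
    rw [mul_assoc]
    refine Nat.mul_le_mul_left _ ?_
    have := cnt_le_prod_mul D hD (t + B + C)
    rwa [add_assoc] at this ⊢
  · refine (totalDegree_mul _ _).trans ?_
    rw [add_comm]
    refine add_le_add ?_ (Finset.le_sup (f := fun i => (b i).totalDegree) (Finset.mem_univ _))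
    refine (totalDegree_finsetProd _ _).trans ?_
    refine le_trans (Finset.sum_le_sum fun j _ => ?_) ((mem_cntSet hD).1 (eq x).2.2)
    refine (totalDegree_pow _ _).trans ?_
    rw [mul_comm]
    exact Nat.mul_le_mul_right _ (hh j)
  · have := hli.comp eq eq.injective
    convert this using 1
    funext x
    simp [eq]

theorem exists_HB {K σ E ι : Type*} [Field K] [CommRing E] [IsDomain E] [Algebra K E] [Fintype ι]
    [Fintype σ] (z : ι → E) (x : σ → E) (hx : ∀ j, FilInt K z (x j)) (δ : ℕ) (v : Fin δ → E)
    (hv : ∀ y : E, ∃ ρ : MvPolynomial ι K, aeval z ρ ≠ 0 ∧ ∃ p : Fin δ → MvPolynomial ι K,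
      aeval z ρ * y = ∑ i, aeval z (p i) * v i) :
    HB (aeval x : MvPolynomial σ K →ₐ[K] E) δ ι := by
  classical
  choose N c hc he using hx
  have hN : ∀ j, 0 < N j := by
    intro j
    rcases Nat.eq_zero_or_pos (N j) with h | h
    · have := he j
      rw [h] at this
      simp at this
    · exact h
  let G : ℕ → Set E := fun s => {y | ∃ (β : σ → ℕ) (p : MvPolynomial ι K), (∀ j, β j < N j) ∧
    p.totalDegree + ∑ j, β j ≤ s ∧ y = aeval z p * ∏ j, x j ^ β j}
  let W : ℕ → Submodule K E := fun s => Submodule.span K (G s)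
  -- multiplication by a variable
  have hstep : ∀ s j, ∀ y ∈ W s, x j * y ∈ W (s + 1) := by
    intro s j y hy
    induction hy using Submodule.span_induction with
    | zero => rw [mul_zero]; exact zero_mem _
    | add a b _ _ ha hb => rw [mul_add]; exact add_mem ha hb
    | smul k a _ ha => rw [mul_smul_comm]; exact Submodule.smul_mem _ _ ha
    | mem y hy =>
      obtain ⟨β, p, hβ, hp, rfl⟩ := hy
      have hup : ∀ i, ∏ l, x l ^ (Function.update β j i) l =
          x j ^ i * ∏ l ∈ Finset.univ.erase j, x l ^ β l := by
        intro i
        rw [← Finset.mul_prod_erase _ _ (Finset.mem_univ j), Function.update_self]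
        congr 1
        refine Finset.prod_congr rfl fun l hl => ?_
        rw [Function.update_of_ne (Finset.ne_of_mem_erase hl)]
      have hsup : ∀ i, ∑ l, (Function.update β j i) l =
          i + ∑ l ∈ Finset.univ.erase j, β l := by
        intro i
        rw [← Finset.add_sum_erase _ _ (Finset.mem_univ j), Function.update_self]
        congr 1
        refine Finset.sum_congr rfl fun l hl => ?_
        rw [Function.update_of_ne (Finset.ne_of_mem_erase hl)]
      have hb0 : ∏ l, x l ^ β l = x j ^ β j * ∏ l ∈ Finset.univ.erase j, x l ^ β l := by
        rw [← hup, Function.update_eq_self]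
      have hs0 : ∑ l, β l = β j + ∑ l ∈ Finset.univ.erase j, β l := by
        rw [← hsup, Function.update_eq_self]
      by_cases hlt : β j + 1 < N j
      · refine Submodule.subset_span ⟨Function.update β j (β j + 1), p, ?_, ?_, ?_⟩
        · intro l
          by_cases hl : l = j
          · subst hl; simpa using hlt
          · rw [Function.update_of_ne hl]; exact hβ l
        · rw [hsup]; omega
        · rw [hup, hb0, pow_succ]; ring
      · have hNj : N j = β j + 1 := by have := hβ j; omega
        have : x j * (aeval z p * ∏ l, x l ^ β l) = ∑ i ∈ Finset.range (N j),
            (-(1 : K)) • (aeval z (c j i * p) * ∏ l, x l ^ (Function.update β j i) l) := by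
          have h1 : x j ^ N j = - ∑ i ∈ Finset.range (N j), aeval z (c j i) * x j ^ i :=
            eq_neg_of_add_eq_zero_left (he j)
          rw [hb0]
          calc x j * (aeval z p * (x j ^ β j * ∏ l ∈ Finset.univ.erase j, x l ^ β l))
              = x j ^ N j * (aeval z p * ∏ l ∈ Finset.univ.erase j, x l ^ β l) := by
                rw [hNj, pow_succ]; ring
            _ = _ := by
                rw [h1, neg_mul, Finset.sum_mul, ← Finset.sum_neg_distrib]
                refine Finset.sum_congr rfl fun i _ => ?_
                rw [hup, neg_smul, one_smul, map_mul]
                ring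
        rw [this]
        refine sum_mem fun i hi => Submodule.smul_mem _ _ (Submodule.subset_span
          ⟨Function.update β j i, _, ?_, ?_, rfl⟩)
        · intro l
          by_cases hl : l = j
          · subst hl; simpa using hi
          · rw [Function.update_of_ne hl]; exact hβ l
        · have h1 := hc j i (Finset.mem_range.1 hi)
          have h2 := totalDegree_mul (c j i) p
          rw [hsup]; omega
  have hmono : ∀ s t, s ≤ t → W s ≤ W t := by
    intro s t hst
    refine Submodule.span_mono ?_
    rintro y ⟨β, p, h1, h2, h3⟩
    exact ⟨β, p, h1, h2.trans hst, h3⟩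
  have hpow : ∀ j k s, ∀ y ∈ W s, x j ^ k * y ∈ W (s + k) := by
    intro j k
    induction k with
    | zero => intro s y hy; simpa using hy
    | succ k ih =>
      intro s y hy
      rw [pow_succ', mul_assoc]
      exact hstep _ j _ (ih s y hy)
  have hmon : ∀ (a : σ → ℕ) (t : Finset σ), ∏ j ∈ t, x j ^ a j ∈ W (∑ j ∈ t, a j) := by
    intro a t
    induction t using Finset.induction_on with
    | empty =>
      refine Submodule.subset_span ⟨0, 1, fun j => hN j, ?_, ?_⟩ <;> simp
    | insert j t hj ih =>
      rw [Finset.prod_insert hj, Finset.sum_insert hj, add_comm]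
      exact hpow _ _ _ _ ih
  have hpoly : ∀ s (f : MvPolynomial σ K), f.totalDegree ≤ s → aeval x f ∈ W s := by
    intro s f hf
    rw [aeval_def, eval₂_eq']
    refine sum_mem fun a ha => ?_
    rw [← Algebra.smul_def]
    refine Submodule.smul_mem _ _ (hmono _ _ ?_ (hmon a _))
    refine le_trans ?_ hf
    have := le_totalDegree ha
    rwa [Finsupp.sum_fintype _ _ (by simp)] at this
  -- common denominators
  choose ρ hρ P hP using fun β : (∀ j, Fin (N j)) => hv (∏ j, x j ^ (β j : ℕ))
  let R : MvPolynomial ι K := ∏ β, ρ β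
  have hR : aeval z R ≠ 0 := by
    rw [map_prod]; exact Finset.prod_ne_zero_iff.2 fun β _ => hρ β
  let Q : (∀ j, Fin (N j)) → Fin δ → MvPolynomial ι K := fun β i =>
    (∏ γ ∈ Finset.univ.erase β, ρ γ) * P β i
  have hQ : ∀ β : (∀ j, Fin (N j)), aeval z R * ∏ j, x j ^ (β j : ℕ) =
      ∑ i, aeval z (Q β i) * v i := by
    intro β
    simp only [R, Q]
    rw [← Finset.mul_prod_erase _ _ (Finset.mem_univ β), map_mul, mul_right_comm, hP,
      Finset.sum_mul]
    refine Finset.sum_congr rfl fun i _ => ?_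
    rw [map_mul]; ring
  obtain ⟨C, hC⟩ : ∃ C, ∀ β i, (Q β i).totalDegree ≤ C := by
    obtain ⟨C, hC⟩ := (Set.finite_range fun βi : (∀ j, Fin (N j)) × Fin δ =>
      (Q βi.1 βi.2).totalDegree).bddAbove
    exact ⟨C, fun β i => hC ⟨(β, i), rfl⟩⟩
  clear_value Q R
  refine ⟨C, fun s τ _ f hf hli => ?_⟩
  let fam : Fin δ × cntSet (fun _ : ι => 1) (s + C) → E := fun ia =>
    (∏ j, z j ^ (ia.2 : ι → ℕ) j) * v ia.1
  have hfam : ∀ (p : MvPolynomial ι K) i, p.totalDegree ≤ s + C →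
      aeval z p * v i ∈ Submodule.span K (Set.range fam) := by
    intro p i hp
    rw [aeval_def, eval₂_eq', Finset.sum_mul]
    refine sum_mem fun a ha => ?_
    rw [mul_assoc, ← Algebra.smul_def]
    refine Submodule.smul_mem _ _ (Submodule.subset_span ⟨(i, ⟨a, ?_⟩), rfl⟩)
    rw [mem_cntSet (fun _ => le_rfl)]
    have := le_totalDegree ha
    rw [Finsupp.sum_fintype _ _ (by simp)] at this
    simp only [one_mul]
    omega
  have hWfam : ∀ y ∈ W s, aeval z R * y ∈ Submodule.span K (Set.range fam) := by
    intro y hy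
    induction hy using Submodule.span_induction with
    | zero => rw [mul_zero]; exact zero_mem _
    | add a b _ _ ha hb => rw [mul_add]; exact add_mem ha hb
    | smul k a _ ha => rw [mul_smul_comm]; exact Submodule.smul_mem _ _ ha
    | mem y hy =>
      obtain ⟨β, p, hβ, hp, rfl⟩ := hy
      rw [mul_left_comm, hQ fun j => ⟨β j, hβ j⟩, Finset.mul_sum]
      refine sum_mem fun i _ => ?_
      rw [← mul_assoc, ← map_mul]
      refine hfam _ _ ((totalDegree_mul _ _).trans (add_le_add (by omega) ?_))
      exact hC _ _
  have hli2 : LinearIndependent K (fun i => aeval z R * aeval x (f i)) := by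
    have := hli.map' (LinearMap.mulLeft K (aeval z R : E)) (by
      rw [LinearMap.ker_eq_bot]
      exact fun a b hab => mul_left_cancel₀ hR hab)
    exact this
  have hle : Fintype.card τ ≤ Module.finrank K (Submodule.span K (Set.range fam)) := by
    have : FiniteDimensional K (Submodule.span K (Set.range fam)) :=
      FiniteDimensional.span_of_finite K (Set.finite_range _)
    have h3 : LinearIndependent K (fun i => (⟨aeval z R * aeval x (f i),
        hWfam _ (hpoly s _ (hf i))⟩ : Submodule.span K (Set.range fam))) := by
      refine LinearIndependent.of_comp (Submodule.subtype _) ?_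
      exact hli2
    exact h3.fintype_card_le_finrank
  refine hle.trans ((finrank_range_le_card fam).trans ?_)
  simp [cnt]

end Hilbert
end TB

namespace TB

section Fibre

theorem exists_algHom_of_isMaximal {K C : Type*} [Field K] [IsAlgClosed K] [CommRing C] [Algebra K C]
    [Algebra.FiniteType K C] (M : Ideal C) (hM : M.IsMaximal) :
    ∃ φ : C →ₐ[K] K, RingHom.ker φ = M := by
  let _ : Field (C ⧸ M) := Ideal.Quotient.field M
  have hft : Algebra.FiniteType K (C ⧸ M) :=
    Algebra.FiniteType.of_surjective (Ideal.Quotient.mkₐ K M) Ideal.Quotient.mk_surjective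
  have hfin : Module.Finite K (C ⧸ M) := finite_of_finite_type_of_isJacobsonRing K (C ⧸ M)
  have hb : Function.Bijective (algebraMap K (C ⧸ M)) :=
    IsAlgClosed.algebraMap_bijective_of_isIntegral
  let e : K ≃ₐ[K] (C ⧸ M) := AlgEquiv.ofBijective (Algebra.ofId K (C ⧸ M)) hb
  refine ⟨e.symm.toAlgHom.comp (Ideal.Quotient.mkₐ K M), ?_⟩
  ext x
  rw [RingHom.mem_ker]
  simp [Ideal.Quotient.eq_zero_iff_mem]

theorem ker_isMaximal {K C : Type*} [Field K] [CommRing C] [Algebra K C] (φ : C →ₐ[K] K) :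
    (RingHom.ker φ).IsMaximal := by
  refine RingHom.ker_isMaximal_of_surjective φ ?_
  intro x
  exact ⟨algebraMap K C x, by simp⟩

theorem algHom_ext_ker {K C : Type*} [Field K] [CommRing C] [Algebra K C] (φ φ' : C →ₐ[K] K)
    (h : RingHom.ker φ ≤ RingHom.ker φ') : φ = φ' := by
  ext x
  have h1 : x - algebraMap K C (φ x) ∈ RingHom.ker φ := by
    rw [RingHom.mem_ker]; simp
  have h2 := h h1
  rw [RingHom.mem_ker, map_sub, AlgHom.commutes, sub_eq_zero] at h2
  exact h2.symm

variable {K : Type} [Field K] [IsAlgClosed K] {r : ℕ} {C : Type} [CommRing C] [IsDomain C]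
    [Algebra K C] [Algebra.FiniteType K C]
    [Algebra (MvPolynomial (Fin r) K) C] [IsScalarTower K (MvPolynomial (Fin r) K) C]

theorem zmt_at (hfin : {φ : C →ₐ[K] K |
      ∀ i, φ (algebraMap (MvPolynomial (Fin r) K) C (X i)) = 0}.Finite)
    (φ : C →ₐ[K] K) (hφ : ∀ i, φ (algebraMap (MvPolynomial (Fin r) K) C (X i)) = 0) :
    ∃ ρ : C, φ ρ ≠ 0 ∧ IsIntegral (MvPolynomial (Fin r) K) ρ ∧
      ∀ x, ∃ m : ℕ, IsIntegral (MvPolynomial (Fin r) K) (ρ ^ m * x) := by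
  classical
  let A := MvPolynomial (Fin r) K
  have hftA : Algebra.FiniteType A C := Algebra.FiniteType.of_restrictScalars_finiteType K A C
  have hJac : IsJacobsonRing C := isJacobsonRing_of_finiteType (A := K)
  let q : PrimeSpectrum C := ⟨RingHom.ker φ, (ker_isMaximal φ).isPrime⟩
  have hqp : q.asIdeal.IsPrime := q.isPrime
  have hX : ∀ i, algebraMap A C (X i) ∈ q.asIdeal := fun i => (RingHom.mem_ker).2 (hφ i)
  -- points of the fibre
  have hpt : ∀ Q : PrimeSpectrum C, (∀ i, algebraMap A C (X i) ∈ Q.asIdeal) →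
      ∃ φ' ∈ hfin.toFinset, RingHom.ker φ' = Q.asIdeal := by
    intro Q hQ
    have h1 : Q.asIdeal.jacobson = Q.asIdeal := IsJacobsonRing.out hJac Q.isPrime.isRadical
    have h2 : hfin.toFinset.inf
        (fun φ' => if Q.asIdeal ≤ RingHom.ker φ' then RingHom.ker φ' else ⊤) ≤ Q.asIdeal := by
      refine le_trans (le_sInf ?_) h1.le
      rintro M ⟨hQM, hM⟩
      obtain ⟨φ', hφ'⟩ := exists_algHom_of_isMaximal (K := K) M hM
      refine (Finset.inf_le (b := φ') ?_).trans ?_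
      · rw [Set.Finite.mem_toFinset]
        intro i
        have : algebraMap A C (X i) ∈ RingHom.ker φ' := hφ' ▸ hQM (hQ i)
        exact this
      · rw [if_pos (hφ' ▸ hQM), hφ']
    obtain ⟨φ', hm, hle⟩ := (Ideal.IsPrime.inf_le' Q.isPrime).1 h2
    split_ifs at hle with hif
    · exact ⟨φ', hm, le_antisymm hle hif⟩
    · exact absurd (top_le_iff.1 hle) Q.isPrime.ne_top
  have hfibX : ∀ Q ∈ PrimeSpectrum.comap (algebraMap A C) ⁻¹'
      {PrimeSpectrum.comap (algebraMap A C) q}, ∀ i, algebraMap A C (X i) ∈ Q.asIdeal := by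
    intro Q hQ i
    have hQ' : PrimeSpectrum.comap (algebraMap A C) Q = PrimeSpectrum.comap (algebraMap A C) q := hQ
    have h3 : (X i : A) ∈ (PrimeSpectrum.comap (algebraMap A C) q).asIdeal := hX i
    rw [← hQ'] at h3
    exact h3
  have hfibfin : (PrimeSpectrum.comap (algebraMap A C) ⁻¹'
      {PrimeSpectrum.comap (algebraMap A C) q}).Finite := by
    refine (hfin.image fun φ' : C →ₐ[K] K =>
      (⟨RingHom.ker φ', (ker_isMaximal φ').isPrime⟩ : PrimeSpectrum C)).subset ?_
    intro Q hQ
    obtain ⟨φ', hm, hk⟩ := hpt Q (hfibX Q hQ)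
    exact ⟨φ', (Set.Finite.mem_toFinset _).1 hm, PrimeSpectrum.ext hk⟩
  have hqf : Algebra.QuasiFiniteAt A q.asIdeal := by
    refine Algebra.QuasiFiniteAt.of_isOpen_singleton_fiber q ?_
    have : Finite (PrimeSpectrum.comap (algebraMap A C) ⁻¹'
      {PrimeSpectrum.comap (algebraMap A C) q}) := hfibfin
    have : T1Space (PrimeSpectrum.comap (algebraMap A C) ⁻¹'
        {PrimeSpectrum.comap (algebraMap A C) q}) := by
      refine ⟨fun Q => ?_⟩
      obtain ⟨φ', hm, hk⟩ := hpt Q.1 (hfibX Q.1 Q.2)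
      have h4 : IsClosed ({Q.1} : Set (PrimeSpectrum C)) := by
        rw [PrimeSpectrum.isClosed_singleton_iff_isMaximal, ← hk]
        exact ker_isMaximal φ'
      have h5 := h4.preimage (continuous_subtype_val
        (p := fun Q => Q ∈ PrimeSpectrum.comap (algebraMap A C) ⁻¹'
        {PrimeSpectrum.comap (algebraMap A C) q}))
      convert h5 using 1
      ext Q'
      simp [Subtype.ext_iff]
    exact isOpen_discrete _
  obtain ⟨ρ, hρ1, hρ2, hρ3⟩ := (Algebra.zariskisMainProperty_iff).1
    (Algebra.ZariskisMainProperty.of_finiteType (R := A) q.asIdeal)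
  exact ⟨ρ, hρ1, hρ2, hρ3⟩

theorem exists_indep_aux (ht : (r : Cardinal) ≤ Algebra.trdeg K C)
    (hfin : {φ : C →ₐ[K] K |
      ∀ i, φ (algebraMap (MvPolynomial (Fin r) K) C (X i)) = 0}.Finite) {m : ℕ}
    (φ : Fin m → C →ₐ[K] K) (hinj : Function.Injective φ)
    (hφ : ∀ k i, φ k (algebraMap (MvPolynomial (Fin r) K) C (X i)) = 0) :
    ∃ u : Fin m → C, Indep K u (fun i => algebraMap (MvPolynomial (Fin r) K) C (X i)) := by
  classical
  let A := MvPolynomial (Fin r) K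
  rcases Nat.eq_zero_or_pos m with rfl | hm
  · exact ⟨Fin.elim0, fun p _ i => i.elim0⟩
  choose ρ hρ1 hρ2 hρ3 using fun k => zmt_at hfin (φ k) (hφ k)
  have hρ0 : ∀ k, ρ k ≠ 0 := fun k h0 => hρ1 k (by rw [h0, map_zero])
  set ℓ : Fin r → C := fun i => algebraMap A C (X i) with hℓ
  have hal : ∀ a : A, algebraMap A C a ∈ Algebra.adjoin K (Set.range ℓ) := by
    intro a
    rw [← aeval_eq_algebraMap, Algebra.adjoin_range_eq_range_aeval]
    exact ⟨a, rfl⟩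
  have hIntg : ∀ x : C, IsIntegral A x → IsIntegral (Algebra.adjoin K (Set.range ℓ)) x := by
    rintro x ⟨p, hp, hpe⟩
    let g : A →+* Algebra.adjoin K (Set.range ℓ) :=
      (algebraMap A C).codRestrict (Algebra.adjoin K (Set.range ℓ)) hal
    refine ⟨p.map g, hp.map g, ?_⟩
    rw [Polynomial.eval₂_map]
    exact hpe
  have halg : Algebra.IsAlgebraic (Algebra.adjoin K (Set.range ℓ)) C := by
    refine ⟨fun x => ?_⟩
    let k : Fin m := ⟨0, hm⟩
    obtain ⟨N, hN⟩ := hρ3 k x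
    exact IsAlgebraic.of_mul (y := ρ k ^ N) (mem_nonZeroDivisors_of_ne_zero (pow_ne_zero _ (hρ0 k)))
      (hIntg _ ((hρ2 k).pow N)).isAlgebraic (hIntg _ hN).isAlgebraic
  have htb : IsTranscendenceBasis K ℓ :=
    Algebra.IsAlgebraic.isTranscendenceBasis_of_le_trdeg_of_finite K ℓ (by simpa using ht)
  have hAinj : Function.Injective (algebraMap A C) := by
    intro a b hab
    rw [← aeval_eq_algebraMap, ← aeval_eq_algebraMap] at hab
    exact htb.1 hab
  have htf : Module.IsTorsionFree A C := by
    have : FaithfulSMul A C := (faithfulSMul_iff_algebraMap_injective A C).2 hAinj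
    infer_instance
  -- separating integral elements
  let I : Submodule K C := Subalgebra.toSubmodule ((integralClosure A C).restrictScalars K)
  have hImem : ∀ x, x ∈ I ↔ IsIntegral A x := fun x => Iff.rfl
  have hsep : ∀ k l, k ≠ l → ∃ h : I, φ k h ≠ φ l h := by
    intro k l hkl
    by_cases hc : φ k (ρ k) = φ l (ρ k)
    · obtain ⟨f, hf⟩ : ∃ f, φ k f ≠ φ l f := by
        by_contra! hcon
        exact hkl (hinj (AlgHom.ext hcon))
      obtain ⟨N, hN⟩ := hρ3 k f
      refine ⟨⟨_, (hImem _).2 hN⟩, ?_⟩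
      simp only [map_mul, map_pow, ← hc]
      intro h
      exact hf (mul_left_cancel₀ (pow_ne_zero _ (hρ1 k)) h)
    · exact ⟨⟨_, (hImem _).2 (hρ2 k)⟩, hc⟩
  let sub : Fin m × Fin m → Submodule K I := fun kl =>
    LinearMap.ker (((φ kl.1).toLinearMap - (φ kl.2).toLinearMap).comp I.subtype)
  let s : Finset (Submodule K I) := (Finset.univ.filter fun kl : Fin m × Fin m =>
    kl.1 ≠ kl.2).image sub
  have hs : (⊤ : Submodule K I) ∉ s := by
    intro htop
    obtain ⟨⟨k, l⟩, hkl, he⟩ := Finset.mem_image.1 htop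
    obtain ⟨h, hh⟩ := hsep k l (Finset.mem_filter.1 hkl).2
    have : h ∈ sub (k, l) := by rw [he]; trivial
    rw [LinearMap.mem_ker] at this
    apply hh
    simpa [sub_eq_zero] using this
  have hne := Subspace.biUnion_ne_univ_of_top_notMem hs
  obtain ⟨h, hh⟩ := (Set.ne_univ_iff_exists_notMem _).1 hne
  have hdist : Function.Injective fun k => φ k (h : C) := by
    intro k l hkl
    by_contra hne
    apply hh
    refine Set.mem_biUnion (x := sub (k, l)) ?_ ?_
    · exact Finset.mem_coe.2 (Finset.mem_image.2 ⟨(k, l), Finset.mem_filter.2 ⟨Finset.mem_univ _, hne⟩, rfl⟩)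
    · change h ∈ LinearMap.ker _
      rw [LinearMap.mem_ker]
      simpa [sub_eq_zero] using hkl
  have hhi : IsIntegral A (h : C) := h.2
  set F := minpoly A (h : C) with hF
  have hFm : F.Monic := minpoly.monic hhi
  let F0 : Polynomial K := F.map (constantCoeff : A →+* K)
  have hroots : ∀ k, F0.IsRoot (φ k (h : C)) := by
    intro k
    have h1 : ((φ k : C →+* K).comp (algebraMap A C)) = constantCoeff := by
      apply MvPolynomial.ringHom_ext
      · intro a
        have : algebraMap A C (MvPolynomial.C a) = algebraMap K C a := by
          rw [IsScalarTower.algebraMap_apply K A C]; rfl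
        simp [this]
      · intro i
        simpa using hφ k i
    have h2 : Polynomial.aeval (h : C) F = 0 := minpoly.aeval A (h : C)
    rw [Polynomial.IsRoot.def, Polynomial.eval_map, ← h1]
    have h3 := Polynomial.hom_eval₂ F (algebraMap A C) (φ k : C →+* K) (h : C)
    rw [← Polynomial.aeval_def, h2, map_zero] at h3
    exact h3.symm
  have hdeg : m ≤ F.natDegree := by
    have h0 : F0 ≠ 0 := (hFm.map _).ne_zero
    have h1 : (Finset.univ.image fun k => φ k (h : C)) ⊆ F0.roots.toFinset := by
      intro x hx
      obtain ⟨k, -, rfl⟩ := Finset.mem_image.1 hx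
      rw [Multiset.mem_toFinset, Polynomial.mem_roots h0]
      exact hroots k
    have h2 := Finset.card_le_card h1
    rw [Finset.card_image_of_injective _ hdist, Finset.card_fin] at h2
    calc m ≤ _ := h2
      _ ≤ F0.roots.card := Multiset.toFinset_card_le _
      _ ≤ F0.natDegree := Polynomial.card_roots' _
      _ ≤ F.natDegree := Polynomial.natDegree_map_le
  refine ⟨fun i => (h : C) ^ (i : ℕ), fun p hp => ?_⟩
  let P : Polynomial A := ∑ i : Fin m, Polynomial.C (p i) * Polynomial.X ^ (i : ℕ)
  have hP : P = 0 := by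
    by_contra hP0
    have h1 : Polynomial.aeval (h : C) P = 0 := by
      rw [← hp]
      simp only [P, map_sum, map_mul, map_pow, Polynomial.aeval_X, Polynomial.aeval_C]
      refine Finset.sum_congr rfl fun i _ => ?_
      rw [hℓ, aeval_eq_algebraMap, mul_comm]
    have h2 := minpoly.IsIntegrallyClosed.degree_le_of_ne_zero hP0 h1
    have h3 : P.degree < (m : WithBot ℕ) := by
      refine (Polynomial.degree_sum_le _ _).trans_lt ?_
      rw [Finset.sup_lt_iff (WithBot.bot_lt_coe _)]
      intro i _
      exact (Polynomial.degree_C_mul_X_pow_le _ _).trans_lt (by exact_mod_cast i.2)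
    rw [← hF, Polynomial.degree_eq_natDegree hFm.ne_zero] at h2
    have h4 : ((F.natDegree : ℕ) : WithBot ℕ) < (m : WithBot ℕ) := h2.trans_lt h3
    have : F.natDegree < m := by exact_mod_cast h4
    omega
  intro i
  have := congrArg (fun Q => Polynomial.coeff Q (i : ℕ)) hP
  simp only [P, Polynomial.finsetSum_coeff, Polynomial.coeff_C_mul, Polynomial.coeff_X_pow,
    Polynomial.coeff_zero, mul_ite, mul_one, mul_zero] at this
  rw [Finset.sum_eq_single i] at this
  · simpa using this
  · intro j _ hj
    rw [if_neg]
    exact fun h => hj (Fin.ext h.symm)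
  · simp

end Fibre

theorem exists_indep {K : Type} [Field K] [IsAlgClosed K] {r : ℕ} {C : Type} [CommRing C]
    [IsDomain C] [Algebra K C] [Algebra.FiniteType K C] (ht : (r : Cardinal) ≤ Algebra.trdeg K C)
    (ℓ : Fin r → C) (hfin : {φ : C →ₐ[K] K | ∀ i, φ (ℓ i) = 0}.Finite) {m : ℕ}
    (φ : Fin m → C →ₐ[K] K) (hinj : Function.Injective φ) (hφ : ∀ k i, φ k (ℓ i) = 0) :
    ∃ u : Fin m → C, Indep K u ℓ := by
  let _ : Algebra (MvPolynomial (Fin r) K) C := (aeval ℓ).toAlgebra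
  have hX : ∀ i, algebraMap (MvPolynomial (Fin r) K) C (X i) = ℓ i := fun i => aeval_X ℓ i
  have : IsScalarTower K (MvPolynomial (Fin r) K) C :=
    IsScalarTower.of_algebraMap_eq fun a => ((aeval ℓ).commutes a).symm
  have := exists_indep_aux (r := r) ht (by simpa only [hX] using hfin) φ hinj
    (by simpa only [hX] using hφ)
  simpa only [hX] using this

end TB

namespace TB

section Generic

variable {K : Type} [Field K] [IsAlgClosed K] [CharZero K] {r : ℕ} {B : Type} [CommRing B]
    [IsDomain B]
    [Algebra K B] [Algebra.FiniteType K B]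
    [Algebra (MvPolynomial (Fin r) K) B] [IsScalarTower K (MvPolynomial (Fin r) K) B]
    [Algebra.IsIntegral (MvPolynomial (Fin r) K) B]
    [FaithfulSMul (MvPolynomial (Fin r) K) B]

/-- lifting a point through an integral extension -/
theorem exists_lift_point (h : B) (a : Fin r → K) (t : K)
    (ht : ((minpoly (MvPolynomial (Fin r) K) h).map (eval a)).IsRoot t) :
    ∃ ψ : B →ₐ[K] K, (∀ i, ψ (algebraMap (MvPolynomial (Fin r) K) B (X i)) = a i) ∧ ψ h = t := by
  let A := MvPolynomial (Fin r) K
  have hi : IsIntegral A h := Algebra.IsIntegral.isIntegral h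
  let Θ : Polynomial A →ₐ[A] B := Polynomial.aeval h
  let _ : Algebra (Polynomial A) B := Θ.toRingHom.toAlgebra
  have htow : IsScalarTower A (Polynomial A) B :=
    IsScalarTower.of_algebraMap_eq fun x => (Θ.commutes x).symm
  have hIntg : Algebra.IsIntegral (Polynomial A) B := Algebra.IsIntegral.tower_top (R := A)
  let ev : Polynomial A →+* K := Polynomial.eval₂RingHom (eval a) t
  have hle : Ideal.comap (algebraMap (Polynomial A) B) ⊥ ≤ RingHom.ker ev := by
    intro p hp
    have hp' : Polynomial.aeval h p = 0 := (Ideal.mem_bot).1 (Ideal.mem_comap.1 hp)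
    obtain ⟨q, rfl⟩ := minpoly.isIntegrallyClosed_dvd hi hp'
    rw [RingHom.mem_ker, map_mul]
    have : ev (minpoly A h) = 0 := by
      rw [Polynomial.IsRoot.def, Polynomial.eval_map] at ht
      exact ht
    rw [this, zero_mul]
  have hprime : (RingHom.ker ev).IsPrime := RingHom.ker_isPrime ev
  obtain ⟨Q, -, hQ, hQ2⟩ := Ideal.exists_ideal_over_prime_of_isIntegral (RingHom.ker ev)
    (⊥ : Ideal B) hle
  obtain ⟨M, hM, hQM⟩ := Ideal.exists_le_maximal Q hQ.ne_top
  obtain ⟨ψ, hψ⟩ := exists_algHom_of_isMaximal (K := K) M hM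
  have hker : ∀ p : Polynomial A, ev p = 0 → ψ (Polynomial.aeval h p) = 0 := by
    intro p hp
    have h1 : p ∈ Ideal.comap (algebraMap (Polynomial A) B) Q := hQ2 ▸ hp
    have h2 : Polynomial.aeval h p ∈ RingHom.ker ψ := hψ ▸ hQM h1
    exact h2
  refine ⟨ψ, fun i => ?_, ?_⟩
  · have h0 : ev (Polynomial.C (X i - C (a i))) = 0 := by
      change Polynomial.eval₂ (eval a) t (Polynomial.C (X i - C (a i))) = 0
      rw [Polynomial.eval₂_C, map_sub, eval_X, eval_C, sub_self]
    have := hker (Polynomial.C (X i - C (a i))) h0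
    have h3 : algebraMap A B (C (a i)) = algebraMap K B (a i) := by
      rw [IsScalarTower.algebraMap_apply K A B]; rfl
    simp only [Polynomial.aeval_C, map_sub, h3, AlgHom.commutes] at this
    exact sub_eq_zero.1 this
  · have h0 : ev (Polynomial.X - Polynomial.C (C t)) = 0 := by
      change Polynomial.eval₂ (eval a) t (Polynomial.X - Polynomial.C (C t)) = 0
      rw [Polynomial.eval₂_sub, Polynomial.eval₂_X, Polynomial.eval₂_C, eval_C, sub_self]
    have := hker (Polynomial.X - Polynomial.C (C t)) h0
    have h3 : algebraMap A B (C t) = algebraMap K B t := by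
      rw [IsScalarTower.algebraMap_apply K A B]; rfl
    simp only [Polynomial.aeval_C, map_sub, h3, AlgHom.commutes, Polynomial.aeval_X] at this
    exact sub_eq_zero.1 this

variable {F : Type} [Field F] [Algebra B F] [IsFractionRing B F]
    [Algebra (MvPolynomial (Fin r) K) F] [IsScalarTower (MvPolynomial (Fin r) K) B F]
    [Algebra (FractionRing (MvPolynomial (Fin r) K)) F]
    [IsScalarTower (MvPolynomial (Fin r) K) (FractionRing (MvPolynomial (Fin r) K)) F]
    [FiniteDimensional (FractionRing (MvPolynomial (Fin r) K)) F]

/-- every element of `F` has an `A`-multiple in `B` -/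
theorem exists_mul_mem (α : F) : ∃ a : MvPolynomial (Fin r) K, a ≠ 0 ∧
    ∃ b : B, algebraMap (MvPolynomial (Fin r) K) F a * α = algebraMap B F b := by
  let A := MvPolynomial (Fin r) K
  obtain ⟨b1, b2, hb2, rfl⟩ := IsFractionRing.div_surjective (A := B) α
  have hb0 : b2 ≠ 0 := nonZeroDivisors.ne_zero hb2
  have halg : IsAlgebraic A b2 := (Algebra.IsIntegral.isIntegral b2).isAlgebraic
  obtain ⟨a, ha, c, hc⟩ := halg.exists_nonzero_dvd hb2
  refine ⟨a, ha, b1 * c, ?_⟩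
  have hb0' : algebraMap B F b2 ≠ 0 := by
    simpa using hb0
  rw [IsScalarTower.algebraMap_apply A B F, hc, map_mul, map_mul]
  field_simp

theorem exists_primitive_in : ∃ h : B, (minpoly (MvPolynomial (Fin r) K) h).natDegree =
    Module.finrank (FractionRing (MvPolynomial (Fin r) K)) F := by
  let A := MvPolynomial (Fin r) K
  have hch : CharZero (FractionRing A) :=
    charZero_of_injective_algebraMap (R := K) (FaithfulSMul.algebraMap_injective _ _)
  obtain ⟨α, hα⟩ := Field.exists_primitive_element (FractionRing A) F
  obtain ⟨a, ha, h, hh⟩ := exists_mul_mem (K := K) (r := r) (B := B) α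
  refine ⟨h, ?_⟩
  have hi : IsIntegral A h := Algebra.IsIntegral.isIntegral h
  have h1 := minpoly.isIntegrallyClosed_eq_field_fractions (FractionRing A) F hi
  have htop : IntermediateField.adjoin (FractionRing A) {algebraMap B F h} = ⊤ := by
    rw [eq_top_iff, ← hα, IntermediateField.adjoin_simple_le_iff]
    have h2 : α = algebraMap (FractionRing A) F (algebraMap A (FractionRing A) a)⁻¹ *
        algebraMap B F h := by
      rw [← hh, IsScalarTower.algebraMap_apply A (FractionRing A) F, map_inv₀, ← mul_assoc,
        inv_mul_cancel₀, one_mul]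
      simpa using ha
    rw [h2]
    exact mul_mem (IntermediateField.algebraMap_mem _ _) (IntermediateField.mem_adjoin_simple_self _ _)
  have h3 : (minpoly (FractionRing A) (algebraMap B F h)).natDegree =
      (minpoly A h).natDegree := by
    rw [h1, (minpoly.monic hi).natDegree_map]
  rw [← h3, ← IntermediateField.adjoin.finrank (Algebra.IsIntegral.isIntegral _), htop,
    IntermediateField.finrank_top']

theorem exists_fibre (F : Type) [Field F] [Algebra B F] [IsFractionRing B F]
    [Algebra (MvPolynomial (Fin r) K) F] [IsScalarTower (MvPolynomial (Fin r) K) B F]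
    [Algebra (FractionRing (MvPolynomial (Fin r) K)) F]
    [IsScalarTower (MvPolynomial (Fin r) K) (FractionRing (MvPolynomial (Fin r) K)) F]
    [FiniteDimensional (FractionRing (MvPolynomial (Fin r) K)) F] :
    ∃ (a : Fin r → K) (ψ : Fin (Module.finrank (FractionRing (MvPolynomial (Fin r) K)) F) →
      (B →ₐ[K] K)), Function.Injective ψ ∧
      ∀ k i, ψ k (algebraMap (MvPolynomial (Fin r) K) B (X i)) = a i := by
  classical
  let A := MvPolynomial (Fin r) K
  have hch : CharZero (FractionRing A) :=
    charZero_of_injective_algebraMap (R := K) (FaithfulSMul.algebraMap_injective _ _)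
  obtain ⟨h, hh⟩ := exists_primitive_in (K := K) (r := r) (B := B) (F := F)
  rw [← hh]
  have hi : IsIntegral A h := Algebra.IsIntegral.isIntegral h
  set G := minpoly A h with hG
  have hGm : G.Monic := minpoly.monic hi
  have h1 : minpoly (FractionRing A) (algebraMap B F h) = G.map (algebraMap A (FractionRing A)) :=
    minpoly.isIntegrallyClosed_eq_field_fractions (FractionRing A) F hi
  have hsep : (G.map (algebraMap A (FractionRing A))).Separable := by
    rw [← h1]
    exact (minpoly.irreducible (Algebra.IsIntegral.isIntegral _)).separable
  obtain ⟨u, v, huv⟩ := hsep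
  obtain ⟨bu, hbu⟩ := IsLocalization.integerNormalization_map_to_map (nonZeroDivisors A) u
  obtain ⟨bv, hbv⟩ := IsLocalization.integerNormalization_map_to_map (nonZeroDivisors A) v
  set U := IsLocalization.integerNormalization (nonZeroDivisors A) u
  set V := IsLocalization.integerNormalization (nonZeroDivisors A) v
  have hbez : Polynomial.C (bv : A) * U * G + Polynomial.C (bu : A) * V * Polynomial.derivative G
      = Polynomial.C ((bu : A) * bv) := by
    apply Polynomial.map_injective _ (IsFractionRing.injective A (FractionRing A))
    simp only [Polynomial.map_add, Polynomial.map_mul, Polynomial.map_C, hbu, hbv, map_mul]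
    rw [← Polynomial.derivative_map]
    have e1 : ∀ (b : A) (w : Polynomial (FractionRing A)),
        b • w = Polynomial.C (algebraMap A (FractionRing A) b) * w := by
      intro b w
      rw [← algebraMap_smul (FractionRing A) b w, Polynomial.smul_eq_C_mul]
    have e1u := e1 bu u
    have e1v := e1 bv v
    have e2 := congrArg (fun w => Polynomial.C (algebraMap A (FractionRing A) bu) *
      Polynomial.C (algebraMap A (FractionRing A) bv) * w) huv
    simp only [mul_one] at e2
    rw [← e2]
    erw [e1u, e1v]
    ring
  have hne : ((bu : A) * bv) ≠ 0 :=
    mul_ne_zero (nonZeroDivisors.coe_ne_zero bu) (nonZeroDivisors.coe_ne_zero bv)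
  obtain ⟨a, ha⟩ : ∃ a : Fin r → K, eval a ((bu : A) * bv) ≠ 0 := by
    by_contra! hcon
    exact hne (MvPolynomial.funext fun a => by simpa using hcon a)
  let Ga : Polynomial K := G.map (eval a)
  have hGa : Ga.Separable := by
    have h2 := congrArg (Polynomial.map (eval a)) hbez
    simp only [Polynomial.map_add, Polynomial.map_mul, Polynomial.map_C] at h2
    rw [← Polynomial.derivative_map] at h2
    set cc := eval a ((bu : A) * bv) with hcc
    refine ⟨Polynomial.C cc⁻¹ * (Polynomial.C (eval a (bv : A)) * U.map (eval a)),
      Polynomial.C cc⁻¹ * (Polynomial.C (eval a (bu : A)) * V.map (eval a)), ?_⟩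
    have h3 : Polynomial.C cc⁻¹ * Polynomial.C cc = (1 : Polynomial K) := by
      rw [← Polynomial.C_mul, inv_mul_cancel₀ ha, Polynomial.C_1]
    rw [← h3, ← h2]
    ring
  have hGd : Ga.natDegree = G.natDegree := hGm.natDegree_map _
  have hcard : Fintype.card (Ga.rootSet K) = G.natDegree := by
    rw [← hGd]
    exact Polynomial.card_rootSet_eq_natDegree hGa (IsAlgClosed.splits _)
  let e : Fin G.natDegree ≃ Ga.rootSet K := (Fintype.equivFinOfCardEq hcard).symm
  have hex : ∀ k, ∃ ψ : B →ₐ[K] K, (∀ i, ψ (algebraMap A B (X i)) = a i) ∧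
      ψ h = (e k : K) := by
    intro k
    refine exists_lift_point h a _ ?_
    have := (Polynomial.mem_rootSet.1 (e k).2).2
    simpa using this
  choose ψ hψ1 hψ2 using hex
  refine ⟨a, ψ, ?_, hψ1⟩
  intro k l hkl
  apply e.injective
  apply Subtype.ext
  rw [← hψ2, ← hψ2, hkl]

end Generic
end TB

namespace TB

set_option maxHeartbeats 1000000 in
theorem core {K : Type} [Field K] [IsAlgClosed K] [CharZero K] {r n : ℕ} {B : Type} [CommRing B]
    [IsDomain B] [Algebra K B] [Algebra.FiniteType K B] (θ : Fin r → B) (x : Fin n → B)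
    (hx : Algebra.adjoin K (Set.range x) = ⊤) (hθ : AlgebraicIndependent K θ)
    (hfil : ∀ j, FilInt K θ (x j)) :
    ∃ δ : ℕ, 1 ≤ δ ∧
      (∃ (a : Fin r → K) (ψ : Fin δ → (B →ₐ[K] K)), Function.Injective ψ ∧
        ∀ k i, ψ k (θ i) = a i) ∧
      (∃ v : Fin δ → FractionRing B, ∀ y : FractionRing B, ∃ ρ : MvPolynomial (Fin r) K, ρ ≠ 0 ∧
        ∃ p : Fin δ → MvPolynomial (Fin r) K,
          algebraMap B (FractionRing B) (aeval θ ρ) * y =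
            ∑ i, algebraMap B (FractionRing B) (aeval θ (p i)) * v i) ∧
      (∀ j, ∃ P : Polynomial (MvPolynomial (Fin r) K), 1 ≤ P.natDegree ∧ P.natDegree ≤ δ ∧
        td P ≤ P.natDegree ∧
        Polynomial.eval₂ (aeval θ : MvPolynomial (Fin r) K →ₐ[K] B).toRingHom (x j) P = 0 ∧
        Polynomial.eval₂ (aeval θ : MvPolynomial (Fin r) K →ₐ[K] B).toRingHom (x j)
          (Polynomial.derivative P) ≠ 0 ∧ P.Monic) := by
  classical
  let A := MvPolynomial (Fin r) K
  let _ : Algebra A B := (aeval θ : MvPolynomial (Fin r) K →ₐ[K] B).toRingHom.toAlgebra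
  have hmap : ∀ p : A, algebraMap A B p = aeval θ p := fun p => rfl
  have hX : (fun i => algebraMap A B (X i)) = θ := by
    funext i; exact aeval_X θ i
  have htow : IsScalarTower K A B :=
    IsScalarTower.of_algebraMap_eq fun a => ((aeval θ).commutes a).symm
  have hinj : Function.Injective (algebraMap A B) := hθ
  have hfaith : FaithfulSMul A B := (faithfulSMul_iff_algebraMap_injective A B).2 hinj
  have hfil' : ∀ j, FilInt K (fun i => algebraMap A B (X i)) (x j) := by
    rw [hX]; exact hfil
  have hIntg : Algebra.IsIntegral A B := by
    have h1 : Algebra.adjoin K (Set.range x) ≤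
        (integralClosure A B).restrictScalars K := by
      refine Algebra.adjoin_le ?_
      rintro _ ⟨j, rfl⟩
      exact (hfil' j).isIntegral
    rw [hx] at h1
    exact ⟨fun b => h1 (Algebra.mem_top (R := K) (x := b))⟩
  have hft : Algebra.FiniteType A B := Algebra.FiniteType.of_restrictScalars_finiteType K A B
  have hfinB : Module.Finite A B := Algebra.IsIntegral.finite
  let F := FractionRing B
  have hfF : FaithfulSMul A F := (faithfulSMul_iff_algebraMap_injective A F).2 (by
    rw [IsScalarTower.algebraMap_eq A B F]
    exact (IsFractionRing.injective B F).comp hinj)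
  let k := FractionRing A
  let _ : Algebra k F := FractionRing.liftAlgebra A F
  have htow2 : IsScalarTower A k F := FractionRing.isScalarTower_liftAlgebra A F
  have hfd : FiniteDimensional k F := by
    obtain ⟨s, hs⟩ := hfinB.fg_top
    refine ⟨⟨s.image (algebraMap B F), ?_⟩⟩
    rw [eq_top_iff]
    intro α _
    obtain ⟨a, ha, b, hb⟩ := exists_mul_mem (K := K) (r := r) (B := B) α
    have hb' : algebraMap B F b ∈ Submodule.span k ((s.image (algebraMap B F) : Finset F) : Set F) := by
      clear hb
      have : b ∈ Submodule.span A (s : Set B) := by rw [hs]; trivial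
      induction this using Submodule.span_induction with
      | zero => rw [map_zero]; exact zero_mem _
      | add p q _ _ hp hq => rw [map_add]; exact add_mem hp hq
      | smul c p _ hp =>
        rw [Algebra.smul_def, map_mul, ← IsScalarTower.algebraMap_apply A B F,
          IsScalarTower.algebraMap_apply A k F, ← Algebra.smul_def]
        exact Submodule.smul_mem _ _ hp
      | mem y hy =>
        refine Submodule.subset_span ?_
        simp only [Finset.coe_image]
        exact Set.mem_image_of_mem _ hy
    have h2 : α = (algebraMap A k a)⁻¹ • algebraMap B F b := by
      rw [← hb, Algebra.smul_def, map_inv₀, ← IsScalarTower.algebraMap_apply A k F, ← mul_assoc,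
        inv_mul_cancel₀, one_mul]
      simpa using ha
    rw [h2]
    exact Submodule.smul_mem _ _ hb'
  have hch : CharZero k :=
    charZero_of_injective_algebraMap (R := K) (FaithfulSMul.algebraMap_injective _ _)
  refine ⟨Module.finrank k F, Module.finrank_pos, ?_, ?_, ?_⟩
  · obtain ⟨a, ψ, h1, h2⟩ := exists_fibre (K := K) (r := r) (B := B) F
    refine ⟨a, ψ, h1, fun k i => ?_⟩
    rw [← h2 k i, ← congrFun hX i]
  · let v := Module.finBasis k F
    refine ⟨v, fun y => ?_⟩
    obtain ⟨ρ, hρ⟩ := IsLocalization.exist_integer_multiples_of_finite (nonZeroDivisors A)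
      (fun i => v.repr y i)
    choose p hp using hρ
    refine ⟨ρ, nonZeroDivisors.coe_ne_zero ρ, p, ?_⟩
    conv_lhs => rw [← v.sum_repr y]
    rw [Finset.mul_sum]
    refine Finset.sum_congr rfl fun i _ => ?_
    have h3 := congrArg (algebraMap k F) (hp i)
    rw [← IsScalarTower.algebraMap_apply A k F, Algebra.smul_def, map_mul,
      ← IsScalarTower.algebraMap_apply A k F, IsScalarTower.algebraMap_apply A B F,
      IsScalarTower.algebraMap_apply A B F] at h3
    rw [← hmap, ← hmap, h3, Algebra.smul_def]
    ring
  · intro j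
    have hi : IsIntegral A (x j) := (hfil' j).isIntegral
    have h1 : minpoly k (algebraMap B F (x j)) = (minpoly A (x j)).map (algebraMap A k) :=
      minpoly.isIntegrallyClosed_eq_field_fractions k F hi
    refine ⟨minpoly A (x j), minpoly.natDegree_pos hi, ?_, (hfil' j).td_minpoly, minpoly.aeval A (x j), ?_,
      minpoly.monic hi⟩
    · rw [← (minpoly.monic hi).natDegree_map (algebraMap A k), ← h1]
      exact minpoly.natDegree_le _
    · have hsep : (minpoly k (algebraMap B F (x j))).Separable :=
        Algebra.IsSeparable.isSeparable k _
      have h4 := hsep.aeval_derivative_ne_zero (S := F) (x := algebraMap B F (x j))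
        (minpoly.aeval k (algebraMap B F (x j)))
      rw [h1, Polynomial.derivative_map, Polynomial.aeval_map_algebraMap,
        Polynomial.aeval_algebraMap_apply] at h4
      intro h5
      apply h4
      have h6 : Polynomial.aeval (x j) (Polynomial.derivative (minpoly A (x j))) = 0 := h5
      rw [h6, map_zero]

end TB

namespace TB

section Var

variable {K : Type} [Field K] {n : ℕ}

/-- coordinate ring -/
abbrev CR (W : Set (Fin n → K)) : Type := MvPolynomial (Fin n) K ⧸ vanishingIdeal K W

/-- coordinate functions -/
noncomputable def cx (W : Set (Fin n → K)) (j : Fin n) : CR W := Ideal.Quotient.mk _ (X j)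

theorem aeval_cx (W : Set (Fin n → K)) (f : MvPolynomial (Fin n) K) :
    aeval (cx W) f = Ideal.Quotient.mk (vanishingIdeal K W) f := by
  have : aeval (cx W) = Ideal.Quotient.mkₐ K (vanishingIdeal K W) := by
    ext j; simp [cx]
  rw [this]; rfl

theorem aeval_cx_eq_zero {W : Set (Fin n → K)} {f : MvPolynomial (Fin n) K} :
    aeval (cx W) f = 0 ↔ f ∈ vanishingIdeal K W := by
  rw [aeval_cx, Ideal.Quotient.eq_zero_iff_mem]

theorem adjoin_cx (W : Set (Fin n → K)) : Algebra.adjoin K (Set.range (cx W)) = ⊤ := by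
  rw [Algebra.adjoin_range_eq_range_aeval, eq_top_iff]
  intro b _
  obtain ⟨f, rfl⟩ := Ideal.Quotient.mk_surjective b
  exact ⟨f, aeval_cx W f⟩

theorem cx_finiteType (W : Set (Fin n → K)) : Algebra.FiniteType K (CR W) :=
  Algebra.FiniteType.of_surjective (Ideal.Quotient.mkₐ K _) Ideal.Quotient.mk_surjective

/-- evaluation at a point -/
noncomputable def evPt {W : Set (Fin n → K)} (p : Fin n → K) (hp : p ∈ W) : CR W →ₐ[K] K :=
  Ideal.Quotient.liftₐ _ (aeval p) fun _ hf => hf p hp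

theorem evPt_mk {W : Set (Fin n → K)} (p : Fin n → K) (hp : p ∈ W) (f : MvPolynomial (Fin n) K) :
    evPt p hp (Ideal.Quotient.mk _ f) = eval p f := by
  simp [evPt, aeval_eq_eval]

theorem evPt_cx {W : Set (Fin n → K)} (p : Fin n → K) (hp : p ∈ W) (j : Fin n) :
    evPt p hp (cx W j) = p j := by
  rw [cx, evPt_mk, eval_X]

theorem algHom_mk {W : Set (Fin n → K)} (φ : CR W →ₐ[K] K) (f : MvPolynomial (Fin n) K) :
    φ (Ideal.Quotient.mk _ f) = eval (fun j => φ (cx W j)) f := by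
  rw [← aeval_cx, ← aeval_eq_eval]
  change φ.comp (aeval (cx W)) f = _
  congr 1
  ext j; simp

theorem algHom_mem {W : Set (Fin n → K)} (hW : IsAlgebraicSet W) (φ : CR W →ₐ[K] K) :
    (fun j => φ (cx W j)) ∈ W := by
  obtain ⟨I, rfl⟩ := hW
  intro f hf
  have : f ∈ vanishingIdeal K (zeroLocus K I) := le_vanishingIdeal_zeroLocus I hf
  rw [aeval_eq_eval]
  change eval _ f = 0
  rw [← algHom_mk, Ideal.Quotient.eq_zero_iff_mem.2 this, map_zero]

theorem algHom_ext_cx {W : Set (Fin n → K)} {φ ψ : CR W →ₐ[K] K}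
    (h : ∀ j, φ (cx W j) = ψ (cx W j)) : φ = ψ := by
  refine AlgHom.ext fun b => ?_
  obtain ⟨f, rfl⟩ := Ideal.Quotient.mk_surjective b
  rw [algHom_mk, algHom_mk]
  simp only [h]

theorem noether_variety [Infinite K] (W : Set (Fin n → K)) (hI : (vanishingIdeal K W).IsPrime) :
    ∃ M : Fin (varDim W) → Fin n → K, LinearIndependent K M ∧
      AlgebraicIndependent K (fun i => ∑ j, M i j • cx W j) ∧
      ∀ j, FilInt K (fun i => ∑ j, M i j • cx W j) (cx W j) := by
  obtain ⟨r, M, h1, h2⟩ := exists_noether (K := K) (cx W)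
  have hr : varDim W = r := by
    let θ := fun i => ∑ j, M i j • cx W j
    let A := MvPolynomial (Fin r) K
    let _ : Algebra A (CR W) := (aeval θ : MvPolynomial (Fin r) K →ₐ[K] CR W).toRingHom.toAlgebra
    have hX : (fun i => algebraMap A (CR W) (X i)) = θ := by
      funext i; exact aeval_X θ i
    have htow : IsScalarTower K A (CR W) :=
      IsScalarTower.of_algebraMap_eq fun a => ((aeval θ).commutes a).symm
    have hinj : Function.Injective (algebraMap A (CR W)) := h1
    have hfil' : ∀ j, FilInt K (fun i => algebraMap A (CR W) (X i)) (cx W j) := by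
      rw [hX]; exact h2
    have hIntg : Algebra.IsIntegral A (CR W) := by
      have h1 : Algebra.adjoin K (Set.range (cx W)) ≤
          (integralClosure A (CR W)).restrictScalars K := by
        refine Algebra.adjoin_le ?_
        rintro _ ⟨j, rfl⟩
        exact (hfil' j).isIntegral
      rw [adjoin_cx] at h1
      exact ⟨fun b => h1 (Algebra.mem_top (R := K) (x := b))⟩
    have := ringKrullDim_mvPoly_integral hinj
    unfold varDim
    rw [this]
    rfl
  subst hr
  refine ⟨M, ?_, h1, h2⟩
  rw [Fintype.linearIndependent_iff]
  intro c hc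
  have h3 := h1.linearIndependent
  rw [Fintype.linearIndependent_iff] at h3
  apply h3
  simp only [Finset.smul_sum, smul_smul]
  rw [Finset.sum_comm]
  refine Finset.sum_eq_zero fun j _ => ?_
  rw [← Finset.sum_smul]
  have := congrFun hc j
  simp only [Finset.sum_apply, Pi.smul_apply, smul_eq_mul, Pi.zero_apply] at this
  rw [this, zero_smul]

theorem varDim_le [Infinite K] (W : Set (Fin n → K)) (hI : (vanishingIdeal K W).IsPrime) :
    varDim W ≤ n := by
  obtain ⟨M, h, -⟩ := noether_variety W hI
  simpa using h.fintype_card_le_finrank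

theorem exists_linear_forms {r : ℕ} (hr : r ≤ n) (L : AffineSubspace K (Fin n → K))
    (hL : Module.finrank K L.direction = n - r) (p0 : Fin n → K) (hp0 : p0 ∈ L) :
    ∃ ℓ : Fin r → MvPolynomial (Fin n) K, (∀ i, (ℓ i).totalDegree ≤ 1) ∧
      ∀ p, p ∈ L ↔ ∀ i, eval p (ℓ i) = 0 := by
  have hq : Module.finrank K ((Fin n → K) ⧸ L.direction) = r := by
    have := L.direction.finrank_quotient_add_finrank
    rw [hL, Module.finrank_fin_fun] at this
    omega
  let e : ((Fin n → K) ⧸ L.direction) ≃ₗ[K] (Fin r → K) :=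
    LinearEquiv.ofFinrankEq _ _ (by rw [hq, Module.finrank_fin_fun])
  let f : (Fin n → K) →ₗ[K] (Fin r → K) := e.toLinearMap ∘ₗ L.direction.mkQ
  have hf : ∀ v, f v = 0 ↔ v ∈ L.direction := by
    intro v
    simp [f]
  refine ⟨fun i => ∑ j, C (f (Pi.single j 1) i) * (X j - C (p0 j)), fun i => ?_, fun p => ?_⟩
  · refine (totalDegree_finsetSum _ _).trans (Finset.sup_le fun j _ => ?_)
    refine (totalDegree_mul _ _).trans ?_
    rw [totalDegree_C, zero_add]
    refine (totalDegree_sub _ _).trans ?_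
    simp
  · rw [← AffineSubspace.vsub_right_mem_direction_iff_mem hp0, ← hf, funext_iff]
    refine forall_congr' fun i => ?_
    have h1 : f (p -ᵥ p0) = ∑ j, (p j - p0 j) • f (Pi.single j 1) := by
      conv_lhs => rw [pi_eq_sum_univ' (p -ᵥ p0)]
      rw [map_sum]
      refine Finset.sum_congr rfl fun j _ => ?_
      rw [map_smul]
      rfl
    rw [h1]
    simp [mul_comm]

/-- points of a finite linear section give independent elements -/
theorem section_indep [IsAlgClosed K] (W : Set (Fin n → K)) (hW : IsAlgebraicSet W)
    (hI : (vanishingIdeal K W).IsPrime) (L : AffineSubspace K (Fin n → K))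
    (hL : Module.finrank K L.direction = n - varDim W)
    (hfin : (W ∩ (L : Set (Fin n → K))).Finite) :
    ∃ (ℓ : Fin (varDim W) → MvPolynomial (Fin n) K)
      (u : Fin (W ∩ (L : Set (Fin n → K))).ncard → CR W),
      (∀ i, (ℓ i).totalDegree ≤ 1) ∧ Indep K u (fun i => aeval (cx W) (ℓ i)) := by
  have hinf : Infinite K := IsAlgClosed.instInfinite
  rcases Set.eq_empty_or_nonempty (W ∩ (L : Set (Fin n → K))) with he | ⟨p0, hp0W, hp0⟩
  · refine ⟨fun _ => 0, fun _ => 0, by simp, ?_⟩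
    intro p _ i
    rw [he, Set.ncard_empty] at i
    exact i.elim0
  obtain ⟨ℓ, hℓ1, hℓ2⟩ := exists_linear_forms (varDim_le W hI) L hL p0 hp0
  have := cx_finiteType W
  obtain ⟨M, -, hM, -⟩ := noether_variety W hI
  have ht : (varDim W : Cardinal) ≤ Algebra.trdeg K (CR W) := by
    simpa using hM.cardinalMk_le_trdeg
  have hfin2 : Finite (W ∩ (L : Set (Fin n → K)) : Set (Fin n → K)) := hfin
  let e : (W ∩ (L : Set (Fin n → K)) : Set (Fin n → K)) ≃ Fin (W ∩ (L : Set (Fin n → K))).ncard :=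
    (Finite.equivFinOfCardEq (Nat.card_coe_set_eq _))
  obtain ⟨u, hu⟩ := exists_indep (K := K) ht (fun i => aeval (cx W) (ℓ i)) (by
    refine Set.Finite.of_injOn (f := fun φ : CR W →ₐ[K] K => fun j => φ (cx W j))
      (t := W ∩ (L : Set (Fin n → K))) ?_ ?_ hfin
    · intro φ hφ
      refine ⟨algHom_mem hW φ, (hℓ2 _).2 fun i => ?_⟩
      have := hφ i
      rw [aeval_cx, algHom_mk] at this
      exact this
    · intro φ _ ψ _ h
      exact algHom_ext_cx fun j => congrFun h j)
    (fun k => evPt (e.symm k : Fin n → K) (e.symm k).2.1) (by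
      intro k l hkl
      apply e.symm.injective
      apply Subtype.ext
      funext j
      have := congrArg (fun φ : CR W →ₐ[K] K => φ (cx W j)) hkl
      simpa only [evPt_cx] using this) (by
      intro k i
      rw [aeval_cx, evPt_mk]
      exact (hℓ2 _).1 (e.symm k).2.2 i)
  exact ⟨ℓ, u, hℓ1, hu⟩

end Var
end TB

namespace TB

theorem aeval_map' {K ι E E' : Type*} [Field K] [CommRing E] [Algebra K E] [CommRing E']
    [Algebra K E'] (z : ι → E) (f : E →ₐ[K] E') (p : MvPolynomial ι K) :
    aeval (fun i => f (z i)) p = f (aeval z p) := by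
  change aeval (fun i => f (z i)) p = (f.comp (aeval z)) p
  congr 1
  ext i; simp

theorem FilInt.map' {K ι E E' : Type*} [Field K] [CommRing E] [Algebra K E] [CommRing E']
    [Algebra K E'] {z : ι → E} {x : E} (h : FilInt K z x) (f : E →ₐ[K] E') :
    FilInt K (fun i => f (z i)) (f x) := by
  obtain ⟨N, c, hc, he⟩ := h
  refine ⟨N, c, hc, ?_⟩
  have := congrArg f he
  simp only [map_add, map_sum, map_mul, map_pow, map_zero] at this
  rw [← this]
  congr 1
  refine Finset.sum_congr rfl fun i _ => ?_
  congr 1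
  exact aeval_map' z f _

theorem Indep.map' {K ι S S' : Type*} [Field K] [CommRing S] [Algebra K S] [CommRing S']
    [Algebra K S'] {e : ℕ} {u : Fin e → S} {w : ι → S} (h : Indep K u w) (f : S →ₐ[K] S')
    (hf : Function.Injective f) : Indep K (fun i => f (u i)) (fun i => f (w i)) := by
  intro p hp
  apply h
  apply hf
  rw [map_zero, ← hp, map_sum]
  refine Finset.sum_congr rfl fun i _ => ?_
  rw [map_mul]
  congr 1
  exact (aeval_map' w f _).symm

section Var

variable {K : Type} [Field K] {n : ℕ} [IsAlgClosed K] [CharZero K]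

theorem V_core (V : Set (Fin n → K)) (h1 : IsIrreducibleVariety V) [IsDomain (CR V)] :
    ∃ (M : Fin (varDim V) → Fin n → K) (θ : Fin (varDim V) → CR V) (δ : ℕ),
      (∀ i, θ i = ∑ j, M i j • cx V j) ∧
      AlgebraicIndependent K θ ∧ (∀ j, FilInt K θ (cx V j)) ∧
      1 ≤ δ ∧ δ ≤ geomDegree V ∧
      (∃ v : Fin δ → FractionRing (CR V), ∀ y : FractionRing (CR V),
        ∃ ρ : MvPolynomial (Fin (varDim V)) K, ρ ≠ 0 ∧
        ∃ p : Fin δ → MvPolynomial (Fin (varDim V)) K,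
          algebraMap (CR V) (FractionRing (CR V)) (aeval θ ρ) * y =
            ∑ i, algebraMap (CR V) (FractionRing (CR V)) (aeval θ (p i)) * v i) ∧
      (∀ j, ∃ P : Polynomial (MvPolynomial (Fin (varDim V)) K), 1 ≤ P.natDegree ∧
        P.natDegree ≤ δ ∧ td P ≤ P.natDegree ∧
        Polynomial.eval₂ (aeval θ : MvPolynomial (Fin (varDim V)) K →ₐ[K] CR V).toRingHom
          (cx V j) P = 0 ∧
        Polynomial.eval₂ (aeval θ : MvPolynomial (Fin (varDim V)) K →ₐ[K] CR V).toRingHom (cx V j)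
          (Polynomial.derivative P) ≠ 0) := by
  classical
  obtain ⟨hW, hI⟩ := h1
  have hinf : Infinite K := IsAlgClosed.instInfinite
  obtain ⟨M, hMl, hMa, hMf⟩ := noether_variety V hI
  have := cx_finiteType V
  set θ : Fin (varDim V) → CR V := fun i => ∑ j, M i j • cx V j with hθ
  obtain ⟨δ, hδ, ⟨a, ψ, hψ1, hψ2⟩, ⟨v, hv⟩, hP⟩ := core θ (cx V) (adjoin_cx V) hMa hMf
  refine ⟨M, θ, δ, fun i => rfl, hMa, hMf, hδ, ?_, ⟨v, hv⟩, fun j => ?_⟩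
  swap
  · obtain ⟨P, q1, q2, q3, q4, q5, -⟩ := hP j
    exact ⟨P, q1, q2, q3, q4, q5⟩
  let F := FractionRing (CR V)
  let ι : CR V →ₐ[K] F := IsScalarTower.toAlgHom K (CR V) F
  have hι : Function.Injective ι := IsFractionRing.injective (CR V) F
  have hιa : ∀ p : MvPolynomial (Fin (varDim V)) K, aeval (fun i => ι (θ i)) p = ι (aeval θ p) :=
    fun p => aeval_map' θ ι p
  have hHB : HB (aeval (fun j => ι (cx V j)) : MvPolynomial (Fin n) K →ₐ[K] F) δ
      (Fin (varDim V)) := by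
    refine exists_HB (fun i => ι (θ i)) _ (fun j => (hMf j).map' ι) δ v fun y => ?_
    obtain ⟨ρ, hρ, p, hp⟩ := hv y
    refine ⟨ρ, ?_, p, ?_⟩
    · rw [hιa]
      intro h0
      apply hρ
      apply hMa
      apply hι
      rw [h0, map_zero, map_zero]
    · simp only [hιa]
      exact hp
  have hbdd : ∀ (L : AffineSubspace K (Fin n → K)),
      Module.finrank K L.direction = n - varDim V → (V ∩ (L : Set (Fin n → K))).Finite →
      (V ∩ (L : Set (Fin n → K))).ncard ≤ δ := by
    intro L hL hfin
    obtain ⟨ℓ, u, hℓ, hu⟩ := section_indep V hW hI L hL hfin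
    choose b hb using fun k => Ideal.Quotient.mk_surjective (u k)
    have h3 := hu.map' ι hι
    have h4 : ∀ f : MvPolynomial (Fin n) K,
        aeval (fun j => ι (cx V j)) f = ι (aeval (cx V) f) := fun p => aeval_map' (cx V) ι p
    have := count_bound (κ := Fin (varDim V)) rfl hHB b ℓ (fun _ => 1) (fun _ => le_rfl) hℓ (by
      simp only [h4, aeval_cx, hb]
      simp only [aeval_cx] at h3
      exact h3)
    simpa using this
  -- the section
  let pt : Fin δ → (Fin n → K) := fun k j => ψ k (cx V j)
  have hptinj : Function.Injective pt := by
    intro k l hkl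
    apply hψ1
    exact algHom_ext_cx fun j => congrFun hkl j
  have hptθ : ∀ k i, ∑ j, M i j * pt k j = a i := by
    intro k i
    rw [← hψ2 k i, hθ]
    simp [pt, map_sum]
  let f : (Fin n → K) →ₗ[K] (Fin (varDim V) → K) := Matrix.mulVecLin (Matrix.of M)
  have hfa : ∀ p i, f p i = ∑ j, M i j * p j := fun p i => rfl
  have hrange : LinearMap.range f = ⊤ := by
    apply Submodule.eq_top_of_finrank_eq
    change (Matrix.of M).rank = _
    rw [LinearIndependent.rank_matrix (by exact hMl)]
    simp
  let L : AffineSubspace K (Fin n → K) := AffineSubspace.mk' (pt ⟨0, hδ⟩) (LinearMap.ker f)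
  have hLmem : ∀ p, p ∈ L ↔ ∀ i, ∑ j, M i j * p j = a i := by
    intro p
    rw [AffineSubspace.mem_mk', LinearMap.mem_ker, vsub_eq_sub, map_sub, sub_eq_zero, funext_iff]
    simp only [hfa, hptθ]
  have hLdim : Module.finrank K L.direction = n - varDim V := by
    rw [AffineSubspace.direction_mk']
    have := f.finrank_range_add_finrank_ker
    rw [hrange, finrank_top, Module.finrank_fin_fun, Module.finrank_fin_fun] at this
    omega
  have hLfin : (V ∩ (L : Set (Fin n → K))).Finite := by
    choose P q1 q2 q3 q4 q5 q6 using hP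
    refine (Set.Finite.pi' (t := fun j => ((P j).map (eval a)).rootSet K)
      (fun j => Polynomial.rootSet_finite _ _)).subset ?_
    rintro p ⟨hpV, hpL⟩ j
    rw [Polynomial.mem_rootSet]
    refine ⟨((q6 j).map _).ne_zero, ?_⟩
    have h5 := congrArg (evPt p hpV) (q4 j)
    change (evPt p hpV : CR V →+* K) _ = _ at h5
    rw [Polynomial.hom_eval₂, map_zero] at h5
    have h6 : (evPt p hpV : CR V →+* K).comp
        (aeval θ : MvPolynomial (Fin (varDim V)) K →ₐ[K] CR V).toRingHom = eval a := by
      refine MvPolynomial.ringHom_ext (fun c => ?_) fun i => ?_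
      · simp
      · have := (hLmem p).1 hpL i
        simp only [AlgHom.toRingHom_eq_coe, RingHom.coe_comp, RingHom.coe_coe, Function.comp_apply,
          aeval_X, eval_X, hθ, map_sum, map_smul, evPt_cx, smul_eq_mul]
        exact this
    rw [h6] at h5
    rw [Polynomial.coe_aeval_eq_eval, Polynomial.eval_map]
    rw [← h5]
    congr 1
    exact (evPt_cx p hpV j).symm
  have hmem : (V ∩ (L : Set (Fin n → K))).ncard ≤ geomDegree V := by
    refine le_csSup ⟨δ, ?_⟩ ⟨L, hLdim, hLfin, rfl⟩
    rintro m ⟨L', h1, h2, rfl⟩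
    exact hbdd L' h1 h2
  refine le_trans ?_ hmem
  have hsub : Set.range pt ⊆ V ∩ (L : Set (Fin n → K)) := by
    rintro _ ⟨k, rfl⟩
    exact ⟨algHom_mem hW (ψ k), (hLmem _).2 (hptθ k)⟩
  have := Set.ncard_le_ncard hsub hLfin
  rwa [Set.ncard_range_of_injective hptinj, Nat.card_fin] at this

end Var
end TB

namespace TB

section LA

/-- linearly independent rows: the rank statement -/
theorem la_range {F : Type*} [Field F] {e n : ℕ} (a : Fin e → Fin n → F)
    (ha : LinearIndependent F a) : LinearMap.range (Matrix.mulVecLin (Matrix.of a)) = ⊤ := by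
  apply Submodule.eq_top_of_finrank_eq
  change (Matrix.of a).rank = _
  rw [LinearIndependent.rank_matrix (by exact ha)]
  simp

theorem la_ker {F : Type*} [Field F] {e n : ℕ} (a : Fin e → Fin n → F)
    (ha : LinearIndependent F a) :
    e + Module.finrank F (LinearMap.ker (Matrix.mulVecLin (Matrix.of a))) = n := by
  have := (Matrix.mulVecLin (Matrix.of a)).finrank_range_add_finrank_ker
  rwa [la_range a ha, finrank_top, Module.finrank_fin_fun, Module.finrank_fin_fun] at this

theorem la_right_inv {F : Type*} [Field F] {e n : ℕ} (a : Fin e → Fin n → F)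
    (ha : LinearIndependent F a) :
    ∃ U : Fin e → Fin n → F, ∀ i j, ∑ k, a i k * U j k = if i = j then 1 else 0 := by
  have h := LinearMap.range_eq_top.1 (la_range a ha)
  choose U hU using fun j => h (Pi.single j 1)
  refine ⟨U, fun i j => ?_⟩
  have := congrFun (hU j) i
  rw [Pi.single_apply] at this
  exact this

theorem la_indep {F : Type*} [Field F] {e n : ℕ} (a : Fin e → Fin n → F) (U : Fin e → Fin n → F)
    (q : F) (hq : q ≠ 0) (h : ∀ i j, ∑ k, a i k * U j k = if i = j then q else 0) :
    LinearIndependent F a := by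
  rw [Fintype.linearIndependent_iff]
  intro g hg j
  have h1 : ∑ k, (∑ i, g i * a i k) * U j k = 0 := by
    refine Finset.sum_eq_zero fun k _ => ?_
    have := congrFun hg k
    simp only [Finset.sum_apply, Pi.smul_apply, smul_eq_mul, Pi.zero_apply] at this
    rw [this, zero_mul]
  have h2 : ∑ k, (∑ i, g i * a i k) * U j k = ∑ i, g i * ∑ k, a i k * U j k := by
    simp only [Finset.sum_mul, Finset.mul_sum]
    rw [Finset.sum_comm]
    simp only [mul_assoc]
  rw [h2] at h1
  simp only [h] at h1
  simpa [hq] using h1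

end LA

section Dv

variable {K : Type*} [Field K] {n : ℕ} {S : Type*} [CommRing S] [Algebra K S]

/-- directional derivative of `f` at `x` along `y` -/
noncomputable def Dv (x y : Fin n → S) (f : MvPolynomial (Fin n) K) : S :=
  ∑ k, aeval x (pderiv k f) * y k

theorem Dv_add (x y : Fin n → S) (f g : MvPolynomial (Fin n) K) :
    Dv x y (f + g) = Dv x y f + Dv x y g := by
  simp [Dv, add_mul, Finset.sum_add_distrib]

theorem Dv_mul (x y : Fin n → S) (f g : MvPolynomial (Fin n) K) :
    Dv x y (f * g) = aeval x f * Dv x y g + aeval x g * Dv x y f := by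
  simp only [Dv, pderiv_mul, map_add, map_mul, Finset.mul_sum, ← Finset.sum_add_distrib]
  refine Finset.sum_congr rfl fun k _ => ?_
  ring

theorem Dv_C (x y : Fin n → S) (c : K) : Dv x y (C c) = 0 := by
  simp [Dv]

theorem Dv_one (x y : Fin n → S) : Dv x y (1 : MvPolynomial (Fin n) K) = 0 := by
  simp [Dv]

theorem Dv_zero (x y : Fin n → S) : Dv x y (0 : MvPolynomial (Fin n) K) = 0 := by
  simp [Dv]

theorem Dv_X (x y : Fin n → S) (j : Fin n) : Dv x y (X j : MvPolynomial (Fin n) K) = y j := by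
  classical
  simp only [Dv, pderiv_X]
  rw [Finset.sum_eq_single j]
  · simp
  · intro b _ hb
    rw [Pi.single_eq_of_ne (Ne.symm hb)]
    simp
  · simp

theorem Dv_sum {ι : Type*} (s : Finset ι) (x y : Fin n → S) (f : ι → MvPolynomial (Fin n) K) :
    Dv x y (∑ i ∈ s, f i) = ∑ i ∈ s, Dv x y (f i) := by
  classical
  induction s using Finset.induction_on with
  | empty => simp [Dv_zero]
  | insert a s ha ih => rw [Finset.sum_insert ha, Finset.sum_insert ha, Dv_add, ih]

theorem Dv_map {S' : Type*} [CommRing S'] [Algebra K S'] (φ : S →ₐ[K] S') (x y : Fin n → S)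
    (f : MvPolynomial (Fin n) K) :
    φ (Dv x y f) = Dv (fun k => φ (x k)) (fun k => φ (y k)) f := by
  simp only [Dv, map_sum, map_mul, aeval_map']

theorem Dv_aeval_zero {r : ℕ} (x y : Fin n → S) (Θ : Fin r → MvPolynomial (Fin n) K)
    (h : ∀ i, Dv x y (Θ i) = 0) (Q : MvPolynomial (Fin r) K) : Dv x y (aeval Θ Q) = 0 := by
  induction Q using MvPolynomial.induction_on with
  | C a => rw [aeval_C]; exact Dv_C x y a
  | add p q hp hq => rw [map_add, Dv_add, hp, hq, add_zero]
  | mul_X p i hp => rw [map_mul, aeval_X, Dv_mul, hp, h i]; simp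

theorem Dv_pow (x y : Fin n → S) (f : MvPolynomial (Fin n) K) (m : ℕ) :
    Dv x y (f ^ m) = (m : S) * aeval x f ^ (m - 1) * Dv x y f := by
  induction m with
  | zero => simp [Dv_one]
  | succ m ih =>
    rw [pow_succ, Dv_mul, ih]
    rcases m with _ | m
    · simp
    · simp only [Nat.add_sub_cancel, map_pow]
      push_cast
      ring

theorem Dv_eval₂ {r : ℕ} (x y : Fin n → S) (Θ : Fin r → MvPolynomial (Fin n) K)
    (h : ∀ i, Dv x y (Θ i) = 0) (g : MvPolynomial (Fin n) K)
    (P : Polynomial (MvPolynomial (Fin r) K)) :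
    Dv x y (Polynomial.eval₂ (aeval Θ : MvPolynomial (Fin r) K →ₐ[K] _).toRingHom g P) =
      aeval x (Polynomial.eval₂ (aeval Θ : MvPolynomial (Fin r) K →ₐ[K] _).toRingHom g
        (Polynomial.derivative P)) * Dv x y g := by
  induction P using Polynomial.induction_on' with
  | add p q hp hq =>
    simp only [Polynomial.eval₂_add, Dv_add, hp, hq, Polynomial.derivative_add, map_add, add_mul]
  | monomial m a =>
    rw [Polynomial.eval₂_monomial, Polynomial.derivative_monomial, Polynomial.eval₂_monomial,
      Dv_mul, Dv_pow]
    have := Dv_aeval_zero x y Θ h a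
    change Dv x y ((aeval Θ : MvPolynomial (Fin r) K →ₐ[K] _).toRingHom a) = 0 at this
    rw [this, mul_zero, add_zero, map_mul, map_mul, map_mul, map_natCast, map_natCast, map_pow]
    ring

theorem totalDegree_pderiv_add_le (f : MvPolynomial (Fin n) K) (k : Fin n) (N : ℕ) (hN : 1 ≤ N)
    (hf : f.totalDegree ≤ N) : (pderiv k f).totalDegree + 1 ≤ N := by
  suffices (pderiv k f).totalDegree ≤ N - 1 by omega
  rw [f.as_sum, map_sum]
  refine (totalDegree_finsetSum _ _).trans (Finset.sup_le fun s hs => ?_)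
  have h1 := (le_totalDegree hs).trans hf
  rw [pderiv_monomial]
  by_cases hsk : s k = 0
  · rw [hsk]; simp
  refine (totalDegree_monomial_le _ _).trans ?_
  have h2 : (s - Finsupp.single k 1) + Finsupp.single k 1 = s := by
    apply tsub_add_cancel_of_le
    rw [Finsupp.single_le_iff]
    omega
  have h3 : (s.sum fun _ e => e) = ((s - Finsupp.single k 1).sum fun _ e => e) + 1 := by
    conv_lhs => rw [← h2]
    rw [Finsupp.sum_add_index' (by simp) (by simp)]
    simp
  change ((s - Finsupp.single k 1).sum fun _ e => e) ≤ N - 1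
  omega

theorem totalDegree_Dv_le {σ : Type*} (a b : Fin n → σ) (f : MvPolynomial (Fin n) K) (N : ℕ)
    (hN : 1 ≤ N) (hf : f.totalDegree ≤ N) :
    (Dv (S := MvPolynomial σ K) (fun j => X (a j)) (fun j => X (b j)) f).totalDegree ≤ N := by
  refine (totalDegree_finsetSum _ _).trans (Finset.sup_le fun k _ => ?_)
  refine (totalDegree_mul _ _).trans ?_
  rw [totalDegree_X]
  refine le_trans ?_ (totalDegree_pderiv_add_le f k N hN hf)
  gcongr
  have := totalDegree_rename_le a (pderiv k f)
  have h2 : (aeval fun j => (X (a j) : MvPolynomial σ K)) = rename a := by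
    ext j; simp
  rwa [h2]

theorem totalDegree_eval₂_le {r : ℕ} (Θ : Fin r → MvPolynomial (Fin n) K)
    (hΘ : ∀ i, (Θ i).totalDegree ≤ 1) (j : Fin n) (P : Polynomial (MvPolynomial (Fin r) K)) :
    (Polynomial.eval₂ (aeval Θ : MvPolynomial (Fin r) K →ₐ[K] _).toRingHom (X j) P).totalDegree
      ≤ td P := by
  have h1 : ∀ Q : MvPolynomial (Fin r) K, (aeval Θ Q).totalDegree ≤ Q.totalDegree := by
    intro Q
    rw [aeval_def, eval₂_eq']
    refine (totalDegree_finsetSum _ _).trans (Finset.sup_le fun s hs => ?_)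
    refine (totalDegree_mul _ _).trans ?_
    refine le_trans ?_ (le_totalDegree hs)
    rw [algebraMap_eq, totalDegree_C, zero_add]
    refine (totalDegree_finsetProd _ _).trans ?_
    rw [Finsupp.sum_fintype _ _ (by simp)]
    refine Finset.sum_le_sum fun i _ => ?_
    refine (totalDegree_pow _ _).trans ?_
    nlinarith [hΘ i, Nat.zero_le (s i)]
  rw [Polynomial.eval₂_eq_sum_range]
  refine (totalDegree_finsetSum _ _).trans (Finset.sup_le fun i hi => ?_)
  refine (totalDegree_mul _ _).trans (le_trans ?_ (coeff_le_td P i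
    (Nat.lt_succ_iff.1 (Finset.mem_range.1 hi))))
  refine add_le_add (h1 _) ?_
  exact (totalDegree_X_pow _ _).le

end Dv

section Tr

theorem trdeg_le_varDim {K : Type} [Field K] [Infinite K] {n : ℕ} (W : Set (Fin n → K))
    (hI : (vanishingIdeal K W).IsPrime) : Algebra.trdeg K (CR W) ≤ (varDim W : Cardinal) := by
  obtain ⟨M, -, h1, h2⟩ := noether_variety W hI
  set θ := fun i => ∑ j, M i j • cx W j with hθ
  have hIntg : ∀ j, IsIntegral (Algebra.adjoin K (Set.range θ)) (cx W j) := by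
    intro j
    let A := MvPolynomial (Fin (varDim W)) K
    let _ : Algebra A (CR W) := (aeval θ : A →ₐ[K] CR W).toRingHom.toAlgebra
    have hX : (fun i => algebraMap A (CR W) (X i)) = θ := by
      funext i; exact aeval_X θ i
    have htow : IsScalarTower K A (CR W) :=
      IsScalarTower.of_algebraMap_eq fun a => ((aeval θ).commutes a).symm
    have hfil' : ∀ j, FilInt K (fun i => algebraMap A (CR W) (X i)) (cx W j) := by
      rw [hX]; exact h2
    obtain ⟨P, hP, hP2⟩ := (hfil' j).isIntegral
    have hmem : ∀ p : A, aeval θ p ∈ Algebra.adjoin K (Set.range θ) := by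
      intro p
      rw [Algebra.adjoin_range_eq_range_aeval]
      exact ⟨p, rfl⟩
    let g : A →+* Algebra.adjoin K (Set.range θ) :=
      (aeval θ : A →ₐ[K] CR W).toRingHom.codRestrict (Algebra.adjoin K (Set.range θ)) hmem
    refine ⟨P.map g, hP.map g, ?_⟩
    rw [Polynomial.eval₂_map]
    exact hP2
  have hint2 : Algebra.IsIntegral (Algebra.adjoin K (Set.range θ)) (CR W) := by
    have h1 : Algebra.adjoin K (Set.range (cx W)) ≤
        (integralClosure (Algebra.adjoin K (Set.range θ)) (CR W)).restrictScalars K := by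
      refine Algebra.adjoin_le ?_
      rintro _ ⟨j, rfl⟩
      exact hIntg j
    rw [adjoin_cx] at h1
    exact ⟨fun b => h1 (Algebra.mem_top (R := K) (x := b))⟩
  have : Algebra.IsAlgebraic (Algebra.adjoin K (Set.range θ)) (CR W) :=
    ⟨fun b => (hint2.isIntegral b).isAlgebraic⟩
  have h3 := Algebra.IsAlgebraic.trdeg_le_cardinalMk (R := K) (A := CR W) (Set.range θ)
  refine h3.trans ?_
  refine Cardinal.mk_range_le.trans ?_
  simp

end Tr
end TB

namespace TB

section Smooth

variable {K : Type} [Field K] {n : ℕ}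

/-- the gradient of `f`, over the function field -/
noncomputable def row (V : Set (Fin n → K)) [IsDomain (CR V)] (f : MvPolynomial (Fin n) K) :
    Fin n → FractionRing (CR V) :=
  fun k => algebraMap (CR V) (FractionRing (CR V)) (aeval (cx V) (pderiv k f))

theorem exists_point_ne {V : Set (Fin n → K)} {q : CR V} (hq : q ≠ 0) :
    ∃ (p : Fin n → K) (hp : p ∈ V), evPt p hp q ≠ 0 := by
  obtain ⟨f, rfl⟩ := Ideal.Quotient.mk_surjective q
  by_contra! hcon
  apply hq
  rw [Ideal.Quotient.eq_zero_iff_mem]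
  intro p hp
  have := hcon p hp
  rw [evPt_mk] at this
  rw [aeval_eq_eval]; exact this

theorem evPt_aeval {V : Set (Fin n → K)} (p : Fin n → K) (hp : p ∈ V)
    (f : MvPolynomial (Fin n) K) : evPt p hp (aeval (cx V) f) = eval p f := by
  rw [aeval_cx, evPt_mk]

/-- tangent space as a submodule contained in a kernel -/
theorem tangentDim_le {V : Set (Fin n → K)} (p : Fin n → K) (T : Submodule K (Fin n → K))
    (h : tangentSpaceAt V p ⊆ T) : tangentDimAt V p ≤ Module.finrank K T :=
  Submodule.finrank_mono (Submodule.span_le.2 h)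

theorem rows_le {V : Set (Fin n → K)} [IsDomain (CR V)] (h2 : IsSmoothVariety V) {e : ℕ}
    (f : Fin e → MvPolynomial (Fin n) K) (hf : ∀ i, f i ∈ vanishingIdeal K V)
    (hind : LinearIndependent (FractionRing (CR V)) (fun i => row V (f i))) :
    e + varDim V ≤ n := by
  classical
  let F := FractionRing (CR V)
  obtain ⟨U, hU⟩ := la_right_inv _ hind
  obtain ⟨q, hq⟩ := IsLocalization.exist_integer_multiples_of_finite (nonZeroDivisors (CR V))
    (fun jk : Fin e × Fin n => (U jk.1 jk.2 : F))
  choose W hW using hq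
  obtain ⟨p, hp, hpq⟩ := exists_point_ne (nonZeroDivisors.coe_ne_zero q)
  have h3 : ∀ i j, ∑ k, aeval (cx V) (pderiv k (f i)) * W (j, k) = if i = j then (q : CR V) else 0 := by
    intro i j
    apply IsFractionRing.injective (CR V) F
    have hij : ∑ k, row V (f i) k * U j k = if i = j then (1 : F) else 0 := hU i j
    have : ∑ k, algebraMap (CR V) F q * (row V (f i) k * U j k) =
        if i = j then algebraMap (CR V) F q else 0 := by
      rw [← Finset.mul_sum, hij, mul_ite, mul_one, mul_zero]
    rw [apply_ite (algebraMap (CR V) F), map_zero, ← this, map_sum]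
    refine Finset.sum_congr rfl fun k _ => ?_
    rw [map_mul, hW, Algebra.smul_def, row]
    ring
  have h4 : ∀ i j, ∑ k, eval p (pderiv k (f i)) * evPt p hp (W (j, k)) =
      if i = j then evPt p hp (q : CR V) else 0 := by
    intro i j
    have := congrArg (evPt p hp) (h3 i j)
    simpa only [map_sum, map_mul, evPt_aeval, apply_ite (evPt p hp), map_zero] using this
  have h5 := la_indep (fun i k => eval p (pderiv k (f i))) (fun j k => evPt p hp (W (j, k))) _ hpq h4
  have h6 := la_ker _ h5
  have h7 := tangentDim_le (V := V) p
    (LinearMap.ker (Matrix.mulVecLin (Matrix.of fun i k => eval p (pderiv k (f i))))) (by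
      intro y hy
      rw [SetLike.mem_coe, LinearMap.mem_ker]
      funext i
      exact hy (f i) (hf i))
  have h8 : tangentDimAt V p = varDim V := h2 p hp
  omega

theorem row_kill {V : Set (Fin n → K)} [IsDomain (CR V)] (h2 : IsSmoothVariety V) {e : ℕ}
    (he : e + varDim V = n)
    (f : Fin e → MvPolynomial (Fin n) K) (hf : ∀ i, f i ∈ vanishingIdeal K V)
    (hind : LinearIndependent (FractionRing (CR V)) (fun i => row V (f i)))
    (y : Fin n → FractionRing (CR V)) (hy : ∀ i, ∑ k, row V (f i) k * y k = 0)
    (g : MvPolynomial (Fin n) K) (hg : g ∈ vanishingIdeal K V) : ∑ k, row V g k * y k = 0 := by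
  by_contra hne
  have h3 : LinearIndependent (FractionRing (CR V))
      (fun i => row V ((Fin.cons g f : Fin (e + 1) → MvPolynomial (Fin n) K) i)) := by
    have : (fun i => row V ((Fin.cons g f : Fin (e + 1) → MvPolynomial (Fin n) K) i)) =
        Fin.cons (row V g) (fun i => row V (f i)) := by
      funext i
      refine Fin.cases ?_ (fun i => ?_) i
      · simp
      · simp
    rw [this, linearIndependent_finCons]
    refine ⟨hind, fun hmem => hne ?_⟩
    generalize row V g = a at hmem
    induction hmem using Submodule.span_induction with
    | zero => simp
    | add a b _ _ ha hb =>
      simp only [Pi.add_apply, add_mul, Finset.sum_add_distrib, ha, hb, add_zero]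
    | smul c a _ ha =>
      simp only [Pi.smul_apply, smul_eq_mul, mul_assoc, ← Finset.mul_sum, ha, mul_zero]
    | mem a ha =>
      obtain ⟨i, rfl⟩ := ha
      exact hy i
  have := rows_le h2 (Fin.cons g f : Fin (e + 1) → MvPolynomial (Fin n) K)
    (fun i => by
      refine Fin.cases ?_ (fun i => ?_) i
      · simpa using hg
      · simpa using hf i) h3
  omega

theorem tangent_extend {V : Set (Fin n → K)} [IsDomain (CR V)] (h2 : IsSmoothVariety V)
    (p : Fin n → K) (hp : p ∈ V) (v : Fin n → K) (hv : v ∈ tangentSpaceAt V p) :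
    ∃ y : Fin n → CR V, (∀ k, evPt p hp (y k) = v k) ∧
      ∀ g ∈ vanishingIdeal K V, Dv (cx V) y g = 0 := by
  classical
  let F := FractionRing (CR V)
  let s : Set (Fin n → K) := {w | ∃ f ∈ vanishingIdeal K V, w = fun k => eval p (pderiv k f)}
  obtain ⟨e, w, hw1, hw2, hw3⟩ : ∃ (e : ℕ) (w : Fin e → Fin n → K), (∀ i, w i ∈ s) ∧
      Submodule.span K (Set.range w) = Submodule.span K s ∧ LinearIndependent K w :=
    ⟨_, Submodule.exists_fun_fin_finrank_span_eq K s⟩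
  choose f hf1 hf2 using hw1
  have hker := la_ker w hw3
  have hT : tangentSpaceAt V p = (LinearMap.ker (Matrix.mulVecLin (Matrix.of w)) : Set (Fin n → K)) := by
    ext y
    rw [SetLike.mem_coe, LinearMap.mem_ker, _root_.funext_iff]
    constructor
    · intro hy i
      have := hy (f i) (hf1 i)
      change ∑ k, w i k * y k = 0
      rw [hf2 i]
      exact this
    · intro hy g hg
      have hmem : (fun k => eval p (pderiv k g)) ∈ Submodule.span K (Set.range w) := by
        rw [hw2]
        exact Submodule.subset_span ⟨g, hg, rfl⟩
      have : ∀ a ∈ Submodule.span K (Set.range w), ∑ k, a k * y k = 0 := by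
        intro a ha
        induction ha using Submodule.span_induction with
        | zero => simp
        | add a b _ _ ha hb =>
          simp only [Pi.add_apply, add_mul, Finset.sum_add_distrib, ha, hb, add_zero]
        | smul c a _ ha =>
          simp only [Pi.smul_apply, smul_eq_mul, mul_assoc, ← Finset.mul_sum, ha, mul_zero]
        | mem a ha =>
          obtain ⟨i, rfl⟩ := ha
          exact hy i
      exact this _ hmem
  have hdim : e + varDim V = n := by
    have h8 : tangentDimAt V p = varDim V := h2 p hp
    unfold tangentDimAt at h8
    rw [hT, Submodule.span_eq] at h8
    omega
  obtain ⟨U, hU⟩ := la_right_inv w hw3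
  -- matrices over the coordinate ring
  let J : Matrix (Fin e) (Fin n) (CR V) := Matrix.of fun i k => aeval (cx V) (pderiv k (f i))
  let Um : Matrix (Fin n) (Fin e) (CR V) := Matrix.of fun k j => algebraMap K (CR V) (U j k)
  let vB : Fin n → CR V := fun k => algebraMap K (CR V) (v k)
  let N := J * Um
  let ev : CR V →+* K := (evPt p hp : CR V →+* K)
  have hevJ : J.map ev = Matrix.of w := by
    ext i k
    rw [Matrix.map_apply, Matrix.of_apply, hf2 i]
    exact evPt_aeval p hp _
  have hevU : Um.map ev = Matrix.of fun k j => U j k := by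
    ext k j
    exact (evPt p hp).commutes _
  have hevN : N.map ev = 1 := by
    rw [Matrix.map_mul, hevJ, hevU]
    ext i j
    rw [Matrix.mul_apply, Matrix.one_apply]
    exact hU i j
  have hdet : ev N.det = 1 := by
    rw [RingHom.map_det]
    change (N.map ev).det = 1
    rw [hevN, Matrix.det_one]
  have hdet0 : N.det ≠ 0 := by
    intro h0
    rw [h0, map_zero] at hdet
    exact zero_ne_one hdet
  have hind : LinearIndependent F (fun i => row V (f i)) := by
    refine la_indep _ (fun j k => algebraMap (CR V) F ((Um * N.adjugate) k j))
      (algebraMap (CR V) F N.det) (by simpa using hdet0) fun i j => ?_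
    have h9 : J * (Um * N.adjugate) = N.det • 1 := by
      rw [← Matrix.mul_assoc, Matrix.mul_adjugate]
    have h10 := congrArg (algebraMap (CR V) F) (congrFun (congrFun h9 i) j)
    rw [Matrix.mul_apply, map_sum, Matrix.smul_apply, Matrix.one_apply] at h10
    simp only [map_mul] at h10
    refine Eq.trans ?_ (h10.trans ?_)
    · rfl
    · split_ifs <;> simp
  let y : Fin n → CR V := N.det • vB - Um.mulVec (N.adjugate.mulVec (J.mulVec vB))
  have hJy : J.mulVec y = 0 := by
    simp only [y]
    rw [Matrix.mulVec_sub, Matrix.mulVec_smul, Matrix.mulVec_mulVec, Matrix.mulVec_mulVec,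
      Matrix.mul_adjugate, Matrix.smul_mulVec, Matrix.one_mulVec, sub_self]
  refine ⟨y, fun k => ?_, fun g hg => ?_⟩
  · have hJv : ∀ i, ev (J.mulVec vB i) = 0 := by
      intro i
      rw [RingHom.map_mulVec, hevJ]
      have h11 : v ∈ LinearMap.ker (Matrix.mulVecLin (Matrix.of w)) := by
        rw [← SetLike.mem_coe, ← hT]; exact hv
      have h12 : ev ∘ vB = v := by
        funext k
        exact (evPt p hp).commutes _
      rw [h12]
      exact congrFun h11 i
    change ev (y k) = v k
    have hz : ev ∘ (J.mulVec vB) = 0 := funext hJv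
    have h13 : ev (Um.mulVec (N.adjugate.mulVec (J.mulVec vB)) k) = 0 := by
      rw [RingHom.map_mulVec]
      have : ev ∘ (N.adjugate.mulVec (J.mulVec vB)) = 0 := by
        funext i
        rw [Function.comp_apply, RingHom.map_mulVec, hz, Matrix.mulVec_zero]
      rw [this, Matrix.mulVec_zero]; rfl
    simp only [y, Pi.sub_apply, Pi.smul_apply, smul_eq_mul, map_sub, map_mul]
    rw [h13, hdet, one_mul, sub_zero]
    exact (evPt p hp).commutes _
  · apply IsFractionRing.injective (CR V) F
    rw [map_zero]
    have := row_kill h2 hdim f hf1 hind (fun k => algebraMap (CR V) F (y k)) (fun i => ?_) g hg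
    · rw [Dv, map_sum]
      simp only [map_mul]
      exact this
    · have h14 := congrArg (algebraMap (CR V) F) (congrFun hJy i)
      rw [Matrix.mulVec, dotProduct, map_sum, Pi.zero_apply, map_zero] at h14
      simp only [map_mul] at h14
      exact h14

end Smooth
end TB

namespace TB

section Frame

variable {K : Type} [Field K] {n : ℕ}

/-- coordinate functions in the function field -/
noncomputable def xF (V : Set (Fin n → K)) [IsDomain (CR V)] (j : Fin n) : FractionRing (CR V) :=
  algebraMap (CR V) (FractionRing (CR V)) (cx V j)

theorem aeval_xF (V : Set (Fin n → K)) [IsDomain (CR V)] (f : MvPolynomial (Fin n) K) :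
    aeval (xF V) f = algebraMap (CR V) (FractionRing (CR V)) (aeval (cx V) f) :=
  aeval_map' (cx V) (IsScalarTower.toAlgHom K (CR V) (FractionRing (CR V))) f

theorem Dv_xF (V : Set (Fin n → K)) [IsDomain (CR V)] (y : Fin n → FractionRing (CR V))
    (f : MvPolynomial (Fin n) K) : Dv (xF V) y f = ∑ k, row V f k * y k := by
  simp only [Dv, aeval_xF, row]

theorem exists_frame (V : Set (Fin n → K)) [IsDomain (CR V)] (h2 : IsSmoothVariety V)
    (M : Fin (varDim V) → Fin n → K) (θ : Fin (varDim V) → CR V) (δ : ℕ) (hδ : 1 ≤ δ)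
    (hθ : ∀ i, θ i = ∑ j, M i j • cx V j)
    (hP : ∀ j, ∃ P : Polynomial (MvPolynomial (Fin (varDim V)) K), 1 ≤ P.natDegree ∧
        P.natDegree ≤ δ ∧ td P ≤ P.natDegree ∧
        Polynomial.eval₂ (aeval θ : MvPolynomial (Fin (varDim V)) K →ₐ[K] CR V).toRingHom
          (cx V j) P = 0 ∧
        Polynomial.eval₂ (aeval θ : MvPolynomial (Fin (varDim V)) K →ₐ[K] CR V).toRingHom (cx V j)
          (Polynomial.derivative P) ≠ 0) :
    ∃ e : ℕ, e + varDim V = n ∧ ∃ (G : Fin e → MvPolynomial (Fin n) K)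
      (τ : Fin (varDim V) → Fin n → FractionRing (CR V)) (u : Fin e → Fin n → FractionRing (CR V)),
      (∀ i, G i ∈ vanishingIdeal K V) ∧ (∀ i, (G i).totalDegree ≤ δ) ∧
      (∀ g ∈ vanishingIdeal K V, ∀ k, Dv (xF V) (τ k) g = 0) ∧
      (∀ i j, Dv (xF V) (u j) (G i) = if i = j then 1 else 0) ∧
      (∀ i k, ∑ j, M i j • τ k j = if i = k then 1 else 0) ∧
      (∀ y : Fin n → FractionRing (CR V), (∀ g ∈ vanishingIdeal K V, Dv (xF V) y g = 0) →
        y = ∑ i, (∑ j, M i j • y j) • τ i) := by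
  classical
  let F := FractionRing (CR V)
  choose P q1 q2 q3 q4 q5 using hP
  let Θ : Fin (varDim V) → MvPolynomial (Fin n) K := fun i => ∑ j, C (M i j) * X j
  have hΘd : ∀ i, (Θ i).totalDegree ≤ 1 := by
    intro i
    refine (totalDegree_finsetSum _ _).trans (Finset.sup_le fun j _ => ?_)
    refine (totalDegree_mul _ _).trans ?_
    rw [totalDegree_C, totalDegree_X]
  have hΘθ : ∀ i, aeval (cx V) (Θ i) = θ i := by
    intro i
    simp only [Θ, hθ, map_sum, map_mul, aeval_X, aeval_C]
    exact Finset.sum_congr rfl fun j _ => (Algebra.smul_def _ _).symm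
  have hDΘ : ∀ (y : Fin n → F) i, Dv (xF V) y (Θ i) = ∑ j, M i j • y j := by
    intro y i
    simp only [Θ, Dv_sum, Dv_mul, Dv_X, Dv_C, mul_zero, add_zero, aeval_C, Algebra.smul_def]
    rfl
  let H : Fin n → MvPolynomial (Fin n) K := fun j =>
    Polynomial.eval₂ (aeval Θ : MvPolynomial (Fin (varDim V)) K →ₐ[K] _).toRingHom (X j) (P j)
  have heval : ∀ (j : Fin n) (Q : Polynomial (MvPolynomial (Fin (varDim V)) K)),
      aeval (cx V) (Polynomial.eval₂
        (aeval Θ : MvPolynomial (Fin (varDim V)) K →ₐ[K] _).toRingHom (X j) Q) =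
      Polynomial.eval₂ (aeval θ : MvPolynomial (Fin (varDim V)) K →ₐ[K] CR V).toRingHom
        (cx V j) Q := by
    intro j Q
    change (aeval (cx V) : MvPolynomial (Fin n) K →ₐ[K] CR V).toRingHom _ = _
    rw [Polynomial.hom_eval₂]
    have e1 : (aeval (cx V) : MvPolynomial (Fin n) K →ₐ[K] CR V).toRingHom.comp
        (aeval Θ : MvPolynomial (Fin (varDim V)) K →ₐ[K] _).toRingHom =
        (aeval θ : MvPolynomial (Fin (varDim V)) K →ₐ[K] CR V).toRingHom := by
      refine MvPolynomial.ringHom_ext (fun c => ?_) fun i => ?_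
      · simp
      · simp [hΘθ]
    rw [e1]
    congr 1
    exact aeval_X _ _
  have hHI : ∀ j, H j ∈ vanishingIdeal K V := by
    intro j
    rw [← aeval_cx_eq_zero, heval, q4]
  have hHd : ∀ j, (H j).totalDegree ≤ δ := fun j =>
    (totalDegree_eval₂_le Θ hΘd j (P j)).trans ((q3 j).trans (q2 j))
  have hinj : ∀ y : Fin n → F, (∀ j, Dv (xF V) y (H j) = 0) → (∀ i, ∑ j, M i j • y j = 0) →
      y = 0 := by
    intro y hy1 hy2
    funext j
    have h3 := hy1 j
    simp only [H] at h3
    rw [Dv_eval₂ _ _ _ (fun i => by rw [hDΘ]; exact hy2 i), Dv_X, aeval_xF, heval] at h3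
    rcases mul_eq_zero.1 h3 with h | h
    · exfalso
      apply q5 j
      apply IsFractionRing.injective (CR V) F
      rw [h, map_zero]
    · exact h
  obtain ⟨e, w, hw1, hw2, hw3⟩ : ∃ (e : ℕ) (w : Fin e → Fin n → F),
      (∀ i, w i ∈ Set.range fun j => row V (H j)) ∧
      Submodule.span F (Set.range w) = Submodule.span F (Set.range fun j => row V (H j)) ∧
      LinearIndependent F w :=
    ⟨_, Submodule.exists_fun_fin_finrank_span_eq F _⟩
  choose s hs using hw1
  have hw : w = fun i => row V (H (s i)) := by
    funext i; exact (hs i).symm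
  have hle : e + varDim V ≤ n := rows_le h2 (fun i => H (s i)) (fun i => hHI _) (by
    rw [← hw]; exact hw3)
  -- the linear map
  let Lm : (Fin n → F) →ₗ[F] (Fin e → F) × (Fin (varDim V) → F) :=
    (Matrix.mulVecLin (Matrix.of w)).prod
      (Matrix.mulVecLin (Matrix.of fun i j => algebraMap K F (M i j)))
  have hL1 : ∀ y i, (Lm y).1 i = Dv (xF V) y (H (s i)) := by
    intro y i
    rw [Dv_xF, ← congrFun hw i]
    rfl
  have hL2 : ∀ y i, (Lm y).2 i = ∑ j, M i j • y j := by
    intro y i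
    simp only [Algebra.smul_def]
    rfl
  have hspan : ∀ y : Fin n → F, (∀ i, Dv (xF V) y (H (s i)) = 0) → ∀ j, Dv (xF V) y (H j) = 0 := by
    intro y hy j
    rw [Dv_xF]
    have hmem : row V (H j) ∈ Submodule.span F (Set.range w) := by
      rw [hw2]; exact Submodule.subset_span ⟨j, rfl⟩
    generalize row V (H j) = a at hmem
    induction hmem using Submodule.span_induction with
    | zero => simp
    | add a b _ _ ha hb =>
      simp only [Pi.add_apply, add_mul, Finset.sum_add_distrib, ha, hb, add_zero]
    | smul c a _ ha =>
      simp only [Pi.smul_apply, smul_eq_mul, mul_assoc, ← Finset.mul_sum, ha, mul_zero]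
    | mem a ha =>
      obtain ⟨i, rfl⟩ := ha
      have := hy i
      rwa [Dv_xF, ← congrFun hw i] at this
  have hLinj : Function.Injective Lm := by
    rw [← LinearMap.ker_eq_bot, LinearMap.ker_eq_bot']
    intro y hy
    refine hinj y (hspan y fun i => ?_) fun i => ?_
    · rw [← hL1, hy]; rfl
    · rw [← hL2, hy]; rfl
  have hge := LinearMap.finrank_le_finrank_of_injective hLinj
  rw [Module.finrank_prod, Module.finrank_fin_fun, Module.finrank_fin_fun,
    Module.finrank_fin_fun] at hge
  have hen : e + varDim V = n := le_antisymm hle hge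
  let E := Lm.linearEquivOfInjective hLinj (by
    rw [Module.finrank_prod, Module.finrank_fin_fun, Module.finrank_fin_fun,
      Module.finrank_fin_fun, hen])
  have hE : ∀ z, Lm (E.symm z) = z := fun z => E.apply_symm_apply z
  let τ : Fin (varDim V) → Fin n → F := fun k => E.symm (0, Pi.single k 1)
  let u : Fin e → Fin n → F := fun k => E.symm (Pi.single k 1, 0)
  have hτ1 : ∀ k i, Dv (xF V) (τ k) (H (s i)) = 0 := by
    intro k i; rw [← hL1, hE]; rfl
  have hτ2 : ∀ i k, ∑ j, M i j • τ k j = if i = k then 1 else 0 := by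
    intro i k
    rw [← hL2, hE, ← Pi.single_apply]
  have hkill : ∀ y : Fin n → F, (∀ i, Dv (xF V) y (H (s i)) = 0) →
      ∀ g ∈ vanishingIdeal K V, Dv (xF V) y g = 0 := by
    intro y hy g hg
    rw [Dv_xF]
    refine row_kill h2 hen (fun i => H (s i)) (fun i => hHI _) (by rw [← hw]; exact hw3) y
      (fun i => ?_) g hg
    rw [← Dv_xF]; exact hy i
  refine ⟨e, hen, fun i => H (s i), τ, u, fun i => hHI _, fun i => hHd _, fun g hg k =>
    hkill _ (hτ1 k) g hg, ?_, hτ2, ?_⟩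
  · intro i j
    rw [← hL1, hE, ← Pi.single_apply]
  · intro y hy
    apply hLinj
    rw [map_sum]
    simp only [map_smul, τ, hE]
    refine Prod.ext ?_ ?_
    · rw [Prod.fst_sum]
      simp only [Prod.smul_fst, smul_zero, Finset.sum_const_zero]
      funext i
      rw [hL1]
      exact hy _ (hHI _)
    · rw [Prod.snd_sum]
      funext i
      rw [hL2]
      simp [Finset.sum_apply, Pi.single_apply]

end Frame
end TB

namespace TB

section TV

variable {K : Type} [Field K] {n : ℕ}

theorem comp_append {S S' : Type*} (φ : S → S') (a b : Fin n → S) :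
    (fun k => φ (Fin.append a b k)) = Fin.append (fun j => φ (a j)) (fun j => φ (b j)) := by
  funext k
  refine Fin.addCases (fun j => ?_) (fun j => ?_) k
  · simp only [Fin.append_left]
  · simp only [Fin.append_right]

theorem append_proj (w : Fin (n + n) → K) : Fin.append (fstProj w) (sndProj w) = w := by
  funext k
  refine Fin.addCases (fun j => ?_) (fun j => ?_) k
  · simp only [Fin.append_left]; rfl
  · simp only [Fin.append_right]; rfl

theorem Dv_lin {S : Type*} [CommRing S] [Algebra K S] {d : ℕ} (x : Fin n → S)
    (T : Fin d → Fin n → S) (a : Fin d → S) (g : MvPolynomial (Fin n) K) :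
    Dv x (fun j => ∑ i, a i * T i j) g = ∑ i, a i * Dv x (T i) g := by
  simp only [Dv, Finset.mul_sum]
  rw [Finset.sum_comm]
  refine Finset.sum_congr rfl fun i _ => Finset.sum_congr rfl fun j _ => ?_
  ring

/-- generic point of the tangent bundle -/
noncomputable def XX (V : Set (Fin n → K)) [IsDomain (CR V)] {d : ℕ}
    (τ : Fin d → Fin n → FractionRing (CR V)) :
    Fin (n + n) → MvPolynomial (Fin d) (FractionRing (CR V)) :=
  Fin.append (fun j => C (xF V j)) (fun j => ∑ i, X i * C (τ i j))

theorem eval_XX (V : Set (Fin n → K)) [IsDomain (CR V)] {d : ℕ}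
    (τ : Fin d → Fin n → FractionRing (CR V)) (z : Fin d → FractionRing (CR V))
    (f : MvPolynomial (Fin (n + n)) K) :
    eval z (aeval (XX V τ) f) = aeval (Fin.append (xF V) (fun j => ∑ i, z i * τ i j)) f := by
  have h := aeval_map' (XX V τ)
    ((aeval z : MvPolynomial (Fin d) (FractionRing (CR V)) →ₐ[FractionRing (CR V)]
      FractionRing (CR V)).restrictScalars K) f
  have h2 : (aeval z (aeval (XX V τ) f) : FractionRing (CR V)) = eval z (aeval (XX V τ) f) := by
    rw [aeval_eq_eval]
  rw [← h2]
  refine Eq.trans h.symm ?_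
  rw [XX, comp_append]
  congr 3
  · funext j; simp
  · funext j; simp

theorem aeval_append_xF (V : Set (Fin n → K)) [IsDomain (CR V)] (y : Fin n → CR V)
    (f : MvPolynomial (Fin (n + n)) K) :
    aeval (Fin.append (xF V) (fun j => algebraMap (CR V) (FractionRing (CR V)) (y j))) f =
      algebraMap (CR V) (FractionRing (CR V)) (aeval (Fin.append (cx V) y) f) := by
  have h := aeval_map' (Fin.append (cx V) y)
    (IsScalarTower.toAlgHom K (CR V) (FractionRing (CR V))) f
  rw [comp_append] at h
  exact h

theorem Dv_algebraMap (V : Set (Fin n → K)) [IsDomain (CR V)] (y : Fin n → CR V)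
    (f : MvPolynomial (Fin n) K) :
    Dv (xF V) (fun j => algebraMap (CR V) (FractionRing (CR V)) (y j)) f =
      algebraMap (CR V) (FractionRing (CR V)) (Dv (cx V) y f) :=
  (Dv_map (IsScalarTower.toAlgHom K (CR V) (FractionRing (CR V))) (cx V) y f).symm

theorem mem_of_XX {V : Set (Fin n → K)} [IsDomain (CR V)] (h2 : IsSmoothVariety V) {d : ℕ}
    (τ : Fin d → Fin n → FractionRing (CR V)) 
    (hτ : ∀ y : Fin n → FractionRing (CR V), (∀ g ∈ vanishingIdeal K V, Dv (xF V) y g = 0) →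
        ∃ z : Fin d → FractionRing (CR V), y = fun j => ∑ i, z i * τ i j)
    (f : MvPolynomial (Fin (n + n)) K) (hf : aeval (XX V τ) f = 0) :
    f ∈ vanishingIdeal K (tangentBundle V) := by
  intro w hw
  obtain ⟨hp, hv⟩ := hw
  obtain ⟨y, hy1, hy2⟩ := tangent_extend h2 _ hp _ hv
  obtain ⟨z, hz⟩ := hτ (fun j => algebraMap (CR V) (FractionRing (CR V)) (y j)) (fun g hg => by
    rw [Dv_algebraMap, hy2 g hg, map_zero])
  have h3 := eval_XX V τ z f
  rw [hf, map_zero, ← hz, aeval_append_xF] at h3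
  have h4 : aeval (Fin.append (cx V) y) f = 0 := by
    apply IsFractionRing.injective (CR V) (FractionRing (CR V))
    rw [← h3, map_zero]
  have h5 := aeval_map' (Fin.append (cx V) y) (evPt (fstProj w) hp) f
  rw [h4, map_zero, comp_append] at h5
  simp only [hy1, evPt_cx] at h5
  rw [← append_proj w]
  exact h5

theorem XX_of_mem [Infinite K] {V : Set (Fin n → K)} [IsDomain (CR V)] {d : ℕ}
    (τ : Fin d → Fin n → FractionRing (CR V)) 
    (hτ : ∀ g ∈ vanishingIdeal K V, ∀ k, Dv (xF V) (τ k) g = 0)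
    (f : MvPolynomial (Fin (n + n)) K) (hf : f ∈ vanishingIdeal K (tangentBundle V)) :
    aeval (XX V τ) f = 0 := by
  have key : ∀ y : Fin n → CR V, (∀ g ∈ vanishingIdeal K V, Dv (cx V) y g = 0) →
      aeval (Fin.append (cx V) y) f = 0 := by
    intro y hy
    by_contra hne
    obtain ⟨p, hp, hpe⟩ := exists_point_ne hne
    apply hpe
    rw [← aeval_map', comp_append]
    apply hf
    have e1 : fstProj (Fin.append (fun j => evPt p hp (cx V j)) fun j => evPt p hp (y j)) = p := by
      funext j
      simp [fstProj, evPt_cx]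
    refine ⟨by rw [e1]; exact hp, ?_⟩
    rw [e1]
    intro g hg
    have h6 := Dv_map (evPt p hp) (cx V) y g
    rw [hy g hg, map_zero] at h6
    rw [h6]
    refine Finset.sum_congr rfl fun j _ => ?_
    rw [aeval_map', evPt_aeval]
    simp only [sndProj, Fin.append_right]
  obtain ⟨q, hq⟩ := IsLocalization.exist_integer_multiples_of_finite (nonZeroDivisors (CR V))
    (fun ij : Fin d × Fin n => τ ij.1 ij.2)
  choose t ht using hq
  have hq0 : algebraMap (CR V) (FractionRing (CR V)) (q : CR V) ≠ 0 :=
    IsFractionRing.to_map_ne_zero_of_mem_nonZeroDivisors q.2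
  refine funext_set (fun _ => Set.range fun c : K =>
      algebraMap (CR V) (FractionRing (CR V)) (q : CR V) * algebraMap K (FractionRing (CR V)) c)
    (fun _ => Set.infinite_range_of_injective fun a b hab => ?_) fun z hz => ?_
  · exact (algebraMap K (FractionRing (CR V))).injective (mul_left_cancel₀ hq0 hab)
  · choose c hc using fun i => hz i (Set.mem_univ i)
    rw [eval_XX, map_zero]
    let y : Fin n → CR V := fun j => ∑ i, algebraMap K (CR V) (c i) * t (i, j)
    have hy : (fun j => ∑ i, z i * τ i j) =
        fun j => algebraMap (CR V) (FractionRing (CR V)) (y j) := by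
      funext j
      simp only [y, map_sum, map_mul]
      refine Finset.sum_congr rfl fun i _ => ?_
      rw [ht, ← hc, Algebra.smul_def, ← IsScalarTower.algebraMap_apply]
      ring
    rw [hy, aeval_append_xF, key, map_zero]
    intro g hg
    apply IsFractionRing.injective (CR V) (FractionRing (CR V))
    rw [← Dv_algebraMap, ← hy, Dv_lin, map_zero]
    exact Finset.sum_eq_zero fun i _ => by rw [hτ g hg, mul_zero]

theorem TV_algebraic {V : Set (Fin n → K)} (hV : IsAlgebraicSet V) :
    IsAlgebraicSet (tangentBundle V) := by
  refine ⟨vanishingIdeal K (tangentBundle V), Set.Subset.antisymm ?_ ?_⟩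
  · intro w hw f hf
    exact hf w hw
  · intro w hw
    refine ⟨?_, ?_⟩
    · obtain ⟨I, hI⟩ := hV
      rw [hI]
      intro f hf
      have h1 : rename (Fin.castAdd n) f ∈ vanishingIdeal K (tangentBundle V) := by
        intro w' hw'
        rw [aeval_rename]
        have h2 := hw'.1
        rw [hI] at h2
        exact h2 f hf
      have h3 := hw _ h1
      rw [aeval_rename] at h3
      exact h3
    · intro f hf
      have h0 : ∀ w' : Fin (n + n) → K, aeval w' (Dv (S := MvPolynomial (Fin (n + n)) K)
          (fun j => X (Fin.castAdd n j)) (fun j => X (Fin.natAdd n j)) f) =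
          ∑ i, eval (fstProj w') (pderiv i f) * sndProj w' i := by
        intro w'
        rw [Dv_map]
        simp only [aeval_X]
        rfl
      have h1 : Dv (S := MvPolynomial (Fin (n + n)) K)
          (fun j => X (Fin.castAdd n j)) (fun j => X (Fin.natAdd n j)) f ∈
          vanishingIdeal K (tangentBundle V) := by
        intro w' hw'
        rw [h0]
        exact hw'.2 f hf
      have h3 := hw _ h1
      rw [h0] at h3
      exact h3

/-- the coordinate ring of the tangent bundle embeds in a polynomial ring -/
theorem TV_struct [Infinite K] {V : Set (Fin n → K)} [IsDomain (CR V)] (h2 : IsSmoothVariety V)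
    (M : Fin (varDim V) → Fin n → K) (θ : Fin (varDim V) → CR V)
    (hθ : ∀ i, θ i = ∑ j, M i j • cx V j) (hθi : AlgebraicIndependent K θ)
    (τ : Fin (varDim V) → Fin n → FractionRing (CR V)) 
    (hτ1 : ∀ g ∈ vanishingIdeal K V, ∀ k, Dv (xF V) (τ k) g = 0)
    (hτ2 : ∀ i k, ∑ j, M i j • τ k j = if i = k then 1 else 0)
    (hτ3 : ∀ y : Fin n → FractionRing (CR V), (∀ g ∈ vanishingIdeal K V, Dv (xF V) y g = 0) →
        y = ∑ i, (∑ j, M i j • y j) • τ i) :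
    (vanishingIdeal K (tangentBundle V)).IsPrime ∧ varDim V + varDim V ≤ varDim (tangentBundle V) ∧
    ∃ φ : CR (tangentBundle V) →ₐ[K] MvPolynomial (Fin (varDim V)) (FractionRing (CR V)),
      Function.Injective φ ∧ ∀ f, φ (Ideal.Quotient.mk _ f) = aeval (XX V τ) f := by
  classical
  have hm : ∀ f, f ∈ vanishingIdeal K (tangentBundle V) ↔ aeval (XX V τ) f = 0 := by
    refine fun f => ⟨XX_of_mem τ hτ1 f, mem_of_XX h2 τ (fun y hy => ?_) f⟩
    refine ⟨fun i => ∑ j, M i j • y j, ?_⟩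
    conv_lhs => rw [hτ3 y hy]
    funext j
    simp [Finset.sum_apply]
  have hker : vanishingIdeal K (tangentBundle V) =
      RingHom.ker (aeval (XX V τ) : MvPolynomial (Fin (n + n)) K →ₐ[K] _) := by
    ext f; rw [hm]; rfl
  have hprime : (vanishingIdeal K (tangentBundle V)).IsPrime := by
    rw [hker]; exact RingHom.ker_isPrime _
  let φ : CR (tangentBundle V) →ₐ[K] MvPolynomial (Fin (varDim V)) (FractionRing (CR V)) :=
    Ideal.Quotient.liftₐ _ (aeval (XX V τ)) fun f hf => (hm f).1 hf
  have hφ : ∀ f, φ (Ideal.Quotient.mk _ f) = aeval (XX V τ) f := fun f => rfl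
  have hinj : Function.Injective φ := by
    rw [injective_iff_map_eq_zero]
    intro b hb
    obtain ⟨f, rfl⟩ := Ideal.Quotient.mk_surjective b
    rw [hφ, ← hm] at hb
    exact Ideal.Quotient.eq_zero_iff_mem.2 hb
  refine ⟨hprime, ?_, φ, hinj, hφ⟩
  have hx : AlgebraicIndependent K (fun i => algebraMap (CR V) (FractionRing (CR V)) (θ i)) :=
    hθi.map' (f := IsScalarTower.toAlgHom K (CR V) (FractionRing (CR V)))
      (IsFractionRing.injective (CR V) (FractionRing (CR V)))
  have hy : AlgebraicIndependent (FractionRing (CR V))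
      (X : Fin (varDim V) → MvPolynomial (Fin (varDim V)) (FractionRing (CR V))) :=
    MvPolynomial.algebraicIndependent_X _ _
  have hs := hx.sumElim_comp hy
  let w : Fin (varDim V) ⊕ Fin (varDim V) → CR (tangentBundle V) :=
    Sum.elim (fun i => Ideal.Quotient.mk _ (∑ j, C (M i j) * X (Fin.natAdd n j)))
      (fun i => Ideal.Quotient.mk _ (∑ j, C (M i j) * X (Fin.castAdd n j)))
  have hw : φ ∘ w = Sum.elim X (algebraMap (FractionRing (CR V))
      (MvPolynomial (Fin (varDim V)) (FractionRing (CR V))) ∘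
      fun i => algebraMap (CR V) (FractionRing (CR V)) (θ i)) := by
    funext s
    rcases s with i | i
    · simp only [Function.comp, w, Sum.elim_inl, hφ, map_sum, map_mul, aeval_X, aeval_C, XX,
        Fin.append_right, Finset.mul_sum]
      rw [Finset.sum_comm]
      have : ∀ k, ∑ j, algebraMap K (MvPolynomial (Fin (varDim V)) (FractionRing (CR V))) (M i j) *
          (X k * C (τ k j)) = X k * C (∑ j, M i j • τ k j) := by
        intro k
        rw [map_sum, Finset.mul_sum]
        refine Finset.sum_congr rfl fun j _ => ?_
        rw [Algebra.smul_def, map_mul, IsScalarTower.algebraMap_apply K (FractionRing (CR V)),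
          algebraMap_eq]
        ring
      simp only [this, hτ2]
      rw [Finset.sum_eq_single i] <;> simp +contextual [eq_comm]
    · simp only [Function.comp, w, Sum.elim_inr, hφ, map_sum, map_mul, aeval_X, aeval_C, XX,
        Fin.append_left, hθ, algebraMap_eq]
      refine Finset.sum_congr rfl fun j _ => ?_
      rw [show M i j • cx V j = algebraMap K (CR V) (M i j) * cx V j from
          Algebra.smul_def (R := K) (A := CR V) (M i j) (cx V j),
          map_mul, map_mul, IsScalarTower.algebraMap_apply K (FractionRing (CR V)),
          algebraMap_eq, ← IsScalarTower.algebraMap_apply]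
      rfl
  rw [← hw] at hs
  have h7 := ((AlgHom.algebraicIndependent_iff φ hinj).1 hs).cardinalMk_le_trdeg.trans
    (trdeg_le_varDim _ hprime)
  simp only [Cardinal.mk_sum, Cardinal.mk_fin, Cardinal.lift_natCast] at h7
  exact_mod_cast h7

end TV
end TB

namespace TB

section Count

variable {K : Type*} [Field K]

/-- constant coefficient as an algebra homomorphism -/
noncomputable def ccHom (K κ S : Type*) [Field K] [CommRing S] [Algebra K S] :
    MvPolynomial κ S →ₐ[K] S :=
  { (constantCoeff : MvPolynomial κ S →+* S) with
    commutes' := fun r => by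
      change constantCoeff (algebraMap K (MvPolynomial κ S) r) = _
      rw [IsScalarTower.algebraMap_apply K S, algebraMap_eq, constantCoeff_C] }

theorem ccHom_apply {κ S : Type*} [CommRing S] [Algebra K S] (f : MvPolynomial κ S) :
    ccHom K κ S f = coeff 0 f := rfl

theorem Indep.of_map {ι S S' : Type*} [CommRing S] [Algebra K S] [CommRing S']
    [Algebra K S'] {e : ℕ} {u : Fin e → S} {w : ι → S} (f : S →ₐ[K] S')
    (h : Indep K (fun i => f (u i)) (fun i => f (w i))) : Indep K u w := by
  intro p hp
  apply h
  have := congrArg f hp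
  rw [map_sum, map_zero] at this
  rw [← this]
  refine Finset.sum_congr rfl fun i _ => ?_
  rw [map_mul, aeval_map']

theorem Indep.sub {ι ι' S : Type*} [CommRing S] [Algebra K S] 
    {e : ℕ} {u : Fin e → S} {w : ι → S} (h : Indep K u w) (g : ι' → ι)
    (hg : Function.Injective g) : Indep K u (fun i => w (g i)) := by
  intro p hp i
  apply rename_injective g hg
  rw [map_zero]
  refine h (fun i => rename g (p i)) ?_ i
  rw [← hp]
  refine Finset.sum_congr rfl fun i _ => ?_
  rw [aeval_rename]; rfl

theorem aeval_sumElim {ι κ S : Type*} [CommRing S] [Algebra K S] (w : ι → MvPolynomial κ S)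
    (p : MvPolynomial (κ ⊕ ι) K) :
    aeval (Sum.elim X w) p = ∑ m ∈ (sumAlgEquiv K κ ι p).support,
      aeval w (coeff m (sumAlgEquiv K κ ι p)) * monomial m 1 := by
  have h1 : aeval (Sum.elim X w) p =
      eval₂ (aeval w : MvPolynomial ι K →ₐ[K] MvPolynomial κ S).toRingHom X
        (sumAlgEquiv K κ ι p) := by
    induction p using MvPolynomial.induction_on with
    | C a =>
      rw [aeval_C]
      rw [sumAlgEquiv_C_inl, eval₂_C]
      simp
    | add p q hp hq => rw [map_add, map_add, eval₂_add, hp, hq]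
    | mul_X p i hp =>
      rw [map_mul, map_mul, eval₂_mul, hp, aeval_X]
      congr 1
      rcases i with i | i
      · rw [sumAlgEquiv_X_inl, eval₂_X]; rfl
      · rw [sumAlgEquiv_X_inr, eval₂_C]; simp
  rw [h1, eval₂_eq]
  refine Finset.sum_congr rfl fun m _ => ?_
  rw [monomial_eq, C_1, one_mul]
  rfl

theorem indep_cons {ι κ S : Type*} [CommRing S] [Algebra K S] {e : ℕ}
    (b : Fin e → MvPolynomial κ S) (w : ι → MvPolynomial κ S)
    (h : Indep K (fun i => ccHom K κ S (b i)) (fun i => ccHom K κ S (w i))) :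
    Indep K b (Sum.elim X w) := by
  classical
  intro p hp
  have key : ∀ m : κ →₀ ℕ, ∀ i, coeff m (sumAlgEquiv K κ ι (p i)) = 0 := by
    intro m
    induction m using WellFoundedLT.induction with
    | ind m ih =>
      refine h (fun i => coeff m (sumAlgEquiv K κ ι (p i))) ?_
      have h1 := congrArg (coeff m) hp
      rw [coeff_sum, coeff_zero] at h1
      rw [← h1]
      refine Finset.sum_congr rfl fun i _ => ?_
      rw [aeval_map', ← map_mul, ccHom_apply, aeval_sumElim, Finset.mul_sum, coeff_sum]
      rw [Finset.sum_eq_single m]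
      · rw [← mul_assoc, coeff_mul_monomial']
        simp
      · intro m' _ hm'
        rw [← mul_assoc, coeff_mul_monomial']
        split_ifs with hle
        · rw [ih m' (lt_of_le_of_ne hle hm') i]; simp
        · rfl
      · intro hm
        rw [notMem_support_iff.1 hm]
        simp
  intro i
  apply (sumAlgEquiv K κ ι).injective
  rw [map_zero]
  ext m : 1
  rw [key, coeff_zero]

theorem FilInt.rename {ι ι' E : Type*} [CommRing E] [Algebra K E] {z : ι → E} (g : ι' → ι) {x : E}
    (h : FilInt K (fun i => z (g i)) x) : FilInt K z x := by
  obtain ⟨N, c, hc, he⟩ := h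
  refine ⟨N, fun i => MvPolynomial.rename g (c i), fun i hi => ?_, ?_⟩
  · exact (Nat.add_le_add_right (totalDegree_rename_le _ _) _).trans (hc i hi)
  · rw [← he]
    congr 1
    refine Finset.sum_congr rfl fun i _ => ?_
    rw [aeval_rename]; rfl

theorem FilInt.self {ι E : Type*} [CommRing E] [Algebra K E] (z : ι → E) (i : ι) :
    FilInt K z (z i) := by
  refine ⟨1, fun _ => -X i, fun j hj => ?_, ?_⟩
  · rw [totalDegree_neg, totalDegree_X]; omega
  · simp

theorem HB_poly {F : Type*} [Field F] [Algebra K F] {d n δ : ℕ} (θ : Fin d → F)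
    (hθ : AlgebraicIndependent K θ) (x : Fin n → F) (hx : ∀ j, FilInt K θ (x j)) (v : Fin δ → F)
    (hv : ∀ y : F, ∃ ρ : MvPolynomial (Fin d) K, ρ ≠ 0 ∧ ∃ p : Fin δ → MvPolynomial (Fin d) K,
      aeval θ ρ * y = ∑ i, aeval θ (p i) * v i) :
    HB (aeval (Fin.append (fun j => C (x j)) X) :
      MvPolynomial (Fin (n + n)) K →ₐ[K] MvPolynomial (Fin n) F) δ (Fin d ⊕ Fin n) := by
  let z : Fin d ⊕ Fin n → MvPolynomial (Fin n) F := Sum.elim (fun i => C (θ i)) X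
  have hz : ∀ q : MvPolynomial (Fin d) K, aeval z (MvPolynomial.rename Sum.inl q) =
      C (aeval θ q) := by
    intro q
    rw [aeval_rename]
    exact aeval_map' θ (IsScalarTower.toAlgHom K F (MvPolynomial (Fin n) F)) q
  refine exists_HB z _ (fun k => ?_) δ (fun i => C (v i)) ?_
  · refine Fin.addCases (fun j => ?_) (fun j => ?_) k
    · rw [Fin.append_left]
      exact FilInt.rename Sum.inl
        ((hx j).map' (IsScalarTower.toAlgHom K F (MvPolynomial (Fin n) F)))
    · rw [Fin.append_right]
      exact FilInt.self z (Sum.inr j)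
  · intro y
    suffices h : ∃ ρ : MvPolynomial (Fin d) K, ρ ≠ 0 ∧ ∃ p : Fin δ → MvPolynomial (Fin d ⊕ Fin n) K,
        aeval z (MvPolynomial.rename Sum.inl ρ) * y = ∑ i, aeval z (p i) * C (v i) by
      obtain ⟨ρ, hρ, p, hp⟩ := h
      refine ⟨_, ?_, p, hp⟩
      rw [hz]
      intro h0
      rw [C_eq_zero] at h0
      exact hρ ((injective_iff_map_eq_zero _).1 hθ _ h0)
    induction y using MvPolynomial.induction_on with
    | C a =>
      obtain ⟨ρ, hρ, p, hp⟩ := hv a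
      refine ⟨ρ, hρ, fun i => MvPolynomial.rename Sum.inl (p i), ?_⟩
      simp only [hz, ← C_mul, hp, map_sum]
    | add f g hf hg =>
      obtain ⟨ρ, hρ, p, hp⟩ := hf
      obtain ⟨ρ', hρ', p', hp'⟩ := hg
      refine ⟨ρ * ρ', mul_ne_zero hρ hρ', fun i => MvPolynomial.rename Sum.inl ρ' * p i +
        MvPolynomial.rename Sum.inl ρ * p' i, ?_⟩
      simp only [map_mul, map_add, add_mul, Finset.sum_add_distrib, mul_assoc, ← Finset.mul_sum,
        ← hp, ← hp']
      ring
    | mul_X f k hf =>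
      obtain ⟨ρ, hρ, p, hp⟩ := hf
      refine ⟨ρ, hρ, fun i => p i * X (Sum.inr k), ?_⟩
      rw [← mul_assoc, hp, Finset.sum_mul]
      refine Finset.sum_congr rfl fun i _ => ?_
      rw [map_mul, aeval_X]
      change _ = aeval z (p i) * X k * C (v i)
      ring

theorem Dv_add_right {S : Type*} [CommRing S] [Algebra K S] {n : ℕ} (x y y' : Fin n → S)
    (g : MvPolynomial (Fin n) K) : Dv x (fun j => y j + y' j) g = Dv x y g + Dv x y' g := by
  simp only [Dv, mul_add, Finset.sum_add_distrib]

end Count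
section Count2
variable {K : Type} [Field K]

theorem indep_frame {F : Type} [Field F] [Algebra K F] {d n e m r : ℕ} (x : Fin n → F)
    (τ : Fin d → Fin n → F) (u : Fin e → Fin n → F) (G : Fin e → MvPolynomial (Fin n) K)
    (hτ : ∀ i k, Dv x (τ k) (G i) = 0)
    (hu : ∀ i j, Dv x (u j) (G i) = if i = j then 1 else 0)
    (b : Fin m → MvPolynomial (Fin (n + n)) K) (ℓ : Fin r → MvPolynomial (Fin (n + n)) K)
    (hI : Indep K
      (fun i => aeval (Fin.append (fun j => C (x j)) (fun j => ∑ i, X i * C (τ i j)) :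
        Fin (n + n) → MvPolynomial (Fin d) F) (b i))
      (fun i => aeval (Fin.append (fun j => C (x j)) (fun j => ∑ i, X i * C (τ i j)) :
        Fin (n + n) → MvPolynomial (Fin d) F) (ℓ i))) :
    Indep K (fun i => aeval (Fin.append (fun j => C (x j)) X :
        Fin (n + n) → MvPolynomial (Fin n) F) (b i))
      (fun s => aeval (Fin.append (fun j => C (x j)) X :
        Fin (n + n) → MvPolynomial (Fin n) F)
        (Sum.elim (fun s => Dv (S := MvPolynomial (Fin (n + n)) K)
          (fun j => X (Fin.castAdd n j)) (fun j => X (Fin.natAdd n j)) (G s)) ℓ s)) := by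
  classical
  let S := MvPolynomial (Fin d) F
  let E2 := MvPolynomial (Fin e) S
  let y1 : Fin n → S := fun j => ∑ i, X i * C (τ i j)
  let Y : Fin n → E2 := fun k => C (y1 k) + ∑ s, X s * C (C (u s k))
  let cF : F →ₐ[K] S := IsScalarTower.toAlgHom K F S
  let cS : S →ₐ[K] E2 := IsScalarTower.toAlgHom K S E2
  let Ψ : MvPolynomial (Fin n) F →ₐ[K] E2 :=
    (aeval Y : MvPolynomial (Fin n) F →ₐ[F] E2).restrictScalars K
  have hΨ : ∀ f : MvPolynomial (Fin (n + n)) K,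
      Ψ (aeval (Fin.append (fun j => C (x j)) X) f) =
        aeval (Fin.append (fun j => cS (cF (x j))) Y) f := by
    intro f
    rw [← aeval_map', comp_append]
    have e1 : (fun j => Ψ (C (x j))) = fun j => cS (cF (x j)) := by
      funext j
      exact aeval_C Y (x j)
    have e2 : (fun j => Ψ (X j)) = Y := by
      funext j
      exact aeval_X Y j
    rw [e1, e2]
  refine Indep.of_map Ψ ?_
  simp only [hΨ]
  have hG : ∀ s, aeval (Fin.append (fun j => cS (cF (x j))) Y)
      (Dv (S := MvPolynomial (Fin (n + n)) K)
          (fun j => X (Fin.castAdd n j)) (fun j => X (Fin.natAdd n j)) (G s)) = X s := by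
    intro s
    rw [Dv_map]
    simp only [aeval_X, Fin.append_left, Fin.append_right]
    have h1 : Dv (fun j => cS (cF (x j))) (fun j => C (y1 j)) (G s) = 0 := by
      have h2 := Dv_map cS (fun j => cF (x j)) y1 (G s)
      refine h2.symm.trans ?_
      have h3 : Dv (fun j => cF (x j)) y1 (G s) = 0 := by
        refine (Dv_lin (fun j => cF (x j)) (fun i j => C (τ i j)) X (G s)).trans ?_
        refine Finset.sum_eq_zero fun i _ => ?_
        have h4 := Dv_map cF x (τ i) (G s)
        rw [hτ, map_zero] at h4
        rw [show Dv (fun j => cF (x j)) (fun j => C (τ i j)) (G s) = 0 from h4.symm, mul_zero]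
      rw [h3, map_zero]
    have h5 : Dv (fun j => cS (cF (x j))) (fun k => ∑ s, X s * C (C (u s k))) (G s) = X s := by
      refine (Dv_lin (fun j => cS (cF (x j))) (fun t k => C (C (u t k))) X (G s)).trans ?_
      have h6 : ∀ t, Dv (fun j => cS (cF (x j))) (fun k => (C (C (u t k)) : E2)) (G s) =
          if s = t then 1 else 0 := by
        intro t
        have h4 := Dv_map (cS.comp cF) x (u t) (G s)
        rw [hu] at h4
        refine Eq.trans h4.symm ?_
        split_ifs <;> simp
      simp only [h6]
      simp
    refine (Dv_add_right _ _ _ _).trans ?_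
    rw [h1, h5, zero_add]
  have hcc : ∀ f : MvPolynomial (Fin (n + n)) K, ccHom K (Fin e) S (aeval (Fin.append (fun j => cS (cF (x j))) Y) f) =
      aeval (Fin.append (fun j => C (x j)) y1) f := by
    intro f
    rw [← aeval_map', comp_append]
    have e1 : (fun j => ccHom K (Fin e) S (cS (cF (x j)))) = fun j => C (x j) := by
      funext j
      exact constantCoeff_C _ _
    have e2 : (fun j => ccHom K (Fin e) S (Y j)) = y1 := by
      funext j
      change constantCoeff (C (y1 j) + ∑ s, X s * C (C (u s j))) = _
      simp
    rw [e1, e2]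
  have e3 : Indep K
      (fun i => ccHom K (Fin e) S (aeval (Fin.append (fun j => cS (cF (x j))) Y) (b i)))
      (fun i => ccHom K (Fin e) S (aeval (Fin.append (fun j => cS (cF (x j))) Y) (ℓ i))) := by
    simp only [hcc]
    exact hI
  have hfin := indep_cons (K := K) (κ := Fin e) (S := S)
    (fun i => aeval (Fin.append (fun j => cS (cF (x j))) Y) (b i))
    (fun i => aeval (Fin.append (fun j => cS (cF (x j))) Y) (ℓ i)) e3
  convert hfin using 1
  funext s
  rcases s with s | s
  · exact hG s
  · rfl

end Count2
end TB

namespace TB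

theorem final_bound {K : Type} [Field K] [IsAlgClosed K] [CharZero K]
    {n : ℕ} (V : Set (Fin n → K)) (h1 : IsIrreducibleVariety V)
    (h2 : IsSmoothVariety V) :
    geomDegree (tangentBundle V) ≤ (geomDegree V) ^ (n + varDim V + 1) := by
  classical
  have hinf : Infinite K := IsAlgClosed.instInfinite
  have hp := h1.2
  have hdom : IsDomain (CR V) := Ideal.Quotient.isDomain _
  obtain ⟨M, θ, δ, hθ, hθi, hθf, hδ1, hδ2, ⟨v, hv⟩, hP⟩ := V_core V h1
  obtain ⟨e, he, G, τ, u, hG1, hG2, hτ1, hu, hτ2, hτ3⟩ := exists_frame V h2 M θ δ hδ1 hθ hP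
  obtain ⟨hprime, hdim, φ, hφ, hφm⟩ := TV_struct h2 M θ hθ hθi τ hτ1 hτ2 hτ3
  have halg := TV_algebraic h1.1
  have hx : AlgebraicIndependent K (fun i => algebraMap (CR V) (FractionRing (CR V)) (θ i)) :=
    hθi.map' (f := IsScalarTower.toAlgHom K (CR V) (FractionRing (CR V)))
      (IsFractionRing.injective (CR V) (FractionRing (CR V)))
  have hHB := HB_poly (K := K) (fun i => algebraMap (CR V) (FractionRing (CR V)) (θ i)) hx (xF V)
    (fun j => (hθf j).map' (IsScalarTower.toAlgHom K (CR V) (FractionRing (CR V)))) v (by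
      intro y
      obtain ⟨ρ, hρ, p, hp⟩ := hv y
      refine ⟨ρ, hρ, p, ?_⟩
      have e1 : ∀ q, aeval (fun i => algebraMap (CR V) (FractionRing (CR V)) (θ i)) q =
          algebraMap (CR V) (FractionRing (CR V)) (aeval θ q) :=
        aeval_map' θ (IsScalarTower.toAlgHom K (CR V) (FractionRing (CR V)))
      simp only [e1]
      exact hp)
  refine csSup_le' ?_
  rintro m ⟨L, hL, hfin, rfl⟩
  obtain ⟨ℓ, b, hℓ, hI⟩ := section_indep _ halg hprime L hL hfin
  choose b' hb' using fun i => Ideal.Quotient.mk_surjective (b i)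
  have hI2 := (hI.map' φ hφ).sub (Fin.castLE hdim) (Fin.castLE_injective hdim)
  simp only [aeval_cx, ← hb', hφm] at hI2
  have hI3 := indep_frame (xF V) τ u G (fun i k => hτ1 _ (hG1 i) k) hu b'
    (fun i => ℓ (Fin.castLE hdim i)) hI2
  have hcount := count_bound (by simp; omega) hHB b' _ (Sum.elim (fun _ => δ) (fun _ => 1))
    (by rintro (s | s) <;> simp [hδ1]) (by
      rintro (s | s)
      · exact totalDegree_Dv_le _ _ _ _ hδ1 (hG2 s)
      · exact hℓ _) hI3
  simp only [Fintype.prod_sum_type, Sum.elim_inl, Sum.elim_inr, Finset.prod_const, one_pow,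
    mul_one, Finset.card_univ, Fintype.card_fin] at hcount
  refine hcount.trans ?_
  rw [← pow_succ']
  refine (Nat.pow_le_pow_left hδ2 _).trans (Nat.pow_le_pow_right (hδ1.trans hδ2) ?_)
  omega

end TB

/-- For a smooth irreducible algebraic variety `V ⊆ A^n` of dimension `d`,
`deg(TV) ≤ deg(V)^{n+d+1}`. -/
theorem degree_tangentBundle_le_pow {K : Type} [Field K] [IsAlgClosed K] [CharZero K]
    {n d : ℕ} (V : Set (Fin n → K)) (h1 : IsIrreducibleVariety V)
    (h2 : IsSmoothVariety V) (hd : varDim V = d) :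
    geomDegree (tangentBundle V) ≤ (geomDegree V) ^ (n + d + 1) := by
  subst hd
  exact TB.final_bound V h1 h2
end
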